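/- arXiv:1211.5996 — 4 statements merged into one kernel-verified Lean document; each statement's English description precedes it below -/
import Mathlib

section
/- Let α < β be real numbers and δ > 0, and let S_− be the Selberg minorant for the interval [α, β] with parameter δ. Then S_−(x) ≤ χ_{(α,β)}(x) for all real x, where χ_{(α,β)} is the characteristic function of the open interval (α, β); in particular S_−(x) ≤ 0 for x outside (α, β). -/
open Real MeasureTheory
open scoped Classical

/-- The Beurling function on `ℝ`, with its removable singularities at the
nonpositive integers filled in by the limiting values: `B(z) = 1 + 2 (sin(πz)/π)^2
(1/z − Σ_{n=1}^∞ 1/(n+z)^2)` off the nonpositive integers (the formula already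
yields the limiting value `1` at `z = 0`), and `B(−m) = −1` for integers `m ≥ 1`. -/
noncomputable def beurlingB (x : ℝ) : ℝ :=
  if ∃ m : ℕ, x = -((m : ℝ) + 1) then -1
  else 1 + 2 * (Real.sin (Real.pi * x) / Real.pi) ^ 2 *
    (1 / x - ∑' n : ℕ, 1 / (((n : ℝ) + 1) + x) ^ 2)

/-- The Selberg minorant for the interval `[α, β]` with parameter `δ`:
`S₋(x) = −(1/2) (B(δ(α − x)) + B(δ(x − β)))`. -/
noncomputable def selbergMinus (α β δ : ℝ) (x : ℝ) : ℝ :=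
  -(1 / 2) * (beurlingB (δ * (α - x)) + beurlingB (δ * (x - β)))

open Finset in
/-- The upper bound in the partial fraction expansion of `π ^ 2 / sin (π x) ^ 2`, for `2 ^ N`
consecutive translates. -/
lemma sin_sq_mul_sum_two_pow_le (N : ℕ) (x : ℝ) :
    Real.sin (Real.pi * x) ^ 2 * ∑ k ∈ range (2 ^ N), 1 / (x + k) ^ 2 ≤ Real.pi ^ 2 := by
  induction N generalizing x with
  | zero =>
    rcases eq_or_ne x 0 with rfl | hx
    · simp [sq_nonneg]
    · have h : Real.sin (Real.pi * x) ^ 2 ≤ (Real.pi * x) ^ 2 := sq_le_sq.mpr abs_sin_le_abs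
      have hx2 : 0 < x ^ 2 := by positivity
      simp only [pow_zero, sum_range_one, Nat.cast_zero, add_zero, mul_one_div]
      rw [div_le_iff₀ hx2]
      linarith [mul_pow Real.pi x 2]
  | succ N ih =>
    have pairs (f : ℕ → ℝ) (n : ℕ) : ∑ k ∈ range (n * 2), f k =
        ∑ j ∈ range n, f (2 * j) + ∑ j ∈ range n, f (2 * j + 1) := by
      induction n with
      | zero => simp
      | succ n ih =>
        rw [add_mul, one_mul, sum_range_succ, sum_range_succ, ih, sum_range_succ, sum_range_succ,
          mul_comm n 2]
        ring
    have even : ∑ j ∈ range (2 ^ N), 1 / (x + (2 * j : ℕ)) ^ 2 =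
        1 / 4 * ∑ j ∈ range (2 ^ N), 1 / (x / 2 + j) ^ 2 := by
      rw [mul_sum]
      refine sum_congr rfl fun j _ ↦ ?_
      rw [show x + (2 * j : ℕ) = 2 * (x / 2 + j) by push_cast; ring, mul_pow, one_div, mul_inv]
      norm_num
    have odd : ∑ j ∈ range (2 ^ N), 1 / (x + (2 * j + 1 : ℕ)) ^ 2 =
        1 / 4 * ∑ j ∈ range (2 ^ N), 1 / ((x + 1) / 2 + j) ^ 2 := by
      rw [mul_sum]
      refine sum_congr rfl fun j _ ↦ ?_
      rw [show x + (2 * j + 1 : ℕ) = 2 * ((x + 1) / 2 + j) by push_cast; ring, mul_pow, one_div,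
        mul_inv]
      norm_num
    have hcos : Real.sin (Real.pi * ((x + 1) / 2)) = Real.cos (Real.pi * (x / 2)) := by
      rw [← Real.sin_add_pi_div_two]
      ring_nf
    have hsin : Real.sin (Real.pi * x) =
        2 * Real.sin (Real.pi * (x / 2)) * Real.cos (Real.pi * (x / 2)) := by
      rw [← Real.sin_two_mul]
      ring_nf
    have h1 := mul_le_mul_of_nonneg_left (ih (x / 2)) (sq_nonneg (Real.cos (Real.pi * (x / 2))))
    have h2 := mul_le_mul_of_nonneg_left (ih ((x + 1) / 2))
      (sq_nonneg (Real.sin (Real.pi * (x / 2))))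
    rw [hcos] at h2
    rw [pow_succ 2 N, pairs, even, odd, hsin]
    linear_combination h1 + h2 + Real.pi ^ 2 * Real.sin_sq_add_cos_sq (Real.pi * (x / 2))

open Finset in
lemma sin_sq_mul_sum_range_le (n : ℕ) (x : ℝ) :
    Real.sin (Real.pi * x) ^ 2 * ∑ k ∈ range n, 1 / (x + k) ^ 2 ≤ Real.pi ^ 2 := by
  refine le_trans ?_ (sin_sq_mul_sum_two_pow_le n x)
  gcongr
  exact Nat.lt_two_pow_self.le

open Finset in
lemma sum_range_one_div_add_succ_sq_le {y : ℝ} (hy : 0 < y) (n : ℕ) :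
    ∑ k ∈ range n, 1 / (((k : ℝ) + 1) + y) ^ 2 ≤ 1 / y - 1 / (y + n) := by
  induction n with
  | zero => simp
  | succ n ih =>
    have h : 1 / (((n : ℝ) + 1) + y) ^ 2 ≤ 1 / (y + n) - 1 / (y + (n + 1)) := by
      rw [div_sub_div _ _ (by positivity) (by positivity),
        div_le_div_iff₀ (by positivity) (by positivity)]
      nlinarith [show (0 : ℝ) < y + n by positivity]
    rw [sum_range_succ]
    push_cast
    linarith

open Finset in
lemma le_sum_range_one_div_add_sq {y : ℝ} (hy : 0 < y) (n : ℕ) :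
    1 / y - 1 / (y + n) ≤ ∑ k ∈ range n, 1 / (y + k) ^ 2 := by
  induction n with
  | zero => simp
  | succ n ih =>
    have h : 1 / (y + n) - 1 / (y + (n + 1)) ≤ 1 / (y + n) ^ 2 := by
      rw [div_sub_div _ _ (by positivity) (by positivity),
        div_le_div_iff₀ (by positivity) (by positivity)]
      nlinarith [show (0 : ℝ) < y + n by positivity]
    rw [sum_range_succ]
    push_cast
    linarith

lemma one_le_beurlingB {y : ℝ} (hy : 0 ≤ y) : 1 ≤ beurlingB y := by
  have hne : ¬ ∃ m : ℕ, y = -((m : ℝ) + 1) := by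
    rintro ⟨m, rfl⟩
    linarith [Nat.cast_nonneg (α := ℝ) m]
  rw [beurlingB, if_neg hne]
  rcases hy.eq_or_lt with rfl | hy
  · simp
  have h : ∑' n : ℕ, 1 / (((n : ℝ) + 1) + y) ^ 2 ≤ 1 / y := by
    refine Real.tsum_le_of_sum_range_le (fun n ↦ by positivity) fun n ↦ ?_
    have : 0 ≤ 1 / (y + n) := by positivity
    linarith [sum_range_one_div_add_succ_sq_le hy n]
  have := mul_nonneg (sq_nonneg (Real.sin (Real.pi * y) / Real.pi)) (sub_nonneg.mpr h)
  linarith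

open Finset in
lemma sin_sq_mul_add_sum_range_le {t : ℝ} (ht : 0 < t) (K : ℕ) :
    Real.sin (Real.pi * t) ^ 2 *
      (1 / t - 1 / (t + K) + ∑ k ∈ range K, 1 / (((k : ℝ) + 1) + -t) ^ 2) ≤ Real.pi ^ 2 := by
  have hsin : Real.sin (Real.pi * (-t - K)) ^ 2 = Real.sin (Real.pi * t) ^ 2 := by
    rw [show Real.pi * (-t - K) = -(Real.pi * t + K * Real.pi) by ring, Real.sin_neg,
      Real.sin_add_nat_mul_pi, neg_sq, mul_pow, ← pow_mul, mul_comm K 2, pow_mul]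
    simp
  refine le_trans ?_ (hsin ▸ sin_sq_mul_sum_range_le (K + 1 + K) (-t - K))
  refine mul_le_mul_of_nonneg_left ?_ (sq_nonneg _)
  rw [sum_range_add]
  refine add_le_add ?_ (sum_le_sum fun k _ ↦ le_of_eq ?_)
  · rw [← sum_range_reflect]
    calc 1 / t - 1 / (t + K) ≤ ∑ k ∈ range K, 1 / (t + k) ^ 2 := le_sum_range_one_div_add_sq ht K
      _ ≤ ∑ k ∈ range (K + 1), 1 / (t + k) ^ 2 :=
        sum_le_sum_of_subset_of_nonneg (range_mono K.le_succ) fun _ _ _ ↦ by positivity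
      _ ≤ _ := sum_le_sum fun k hk ↦ le_of_eq ?_
    have hk : k ≤ K := Nat.lt_succ_iff.mp (mem_range.mp hk)
    rw [show K + 1 - 1 - k = K - k by omega, Nat.cast_sub hk]
    congr 1
    ring
  · push_cast
    congr 2
    ring

lemma summable_one_div_add_succ_sq (y : ℝ) :
    Summable fun n : ℕ ↦ 1 / (((n : ℝ) + 1) + y) ^ 2 := by
  refine ((Real.summable_one_div_nat_add_rpow (1 + y) 2).mpr one_lt_two).congr fun n ↦ ?_
  rw [Real.rpow_ofNat, sq_abs, add_assoc]

open Filter Topology in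
lemma neg_one_le_beurlingB (y : ℝ) : -1 ≤ beurlingB y := by
  rcases le_or_gt 0 y with hy | hy
  · linarith [one_le_beurlingB hy]
  obtain ⟨t, rfl⟩ : ∃ t, y = -t := ⟨-y, by ring⟩
  have ht : 0 < t := by linarith
  rw [beurlingB]
  split_ifs with h
  · rfl
  have hinv : Tendsto (fun K : ℕ ↦ 1 / (t + K)) atTop (𝓝 0) := by
    simp only [one_div]
    exact (tendsto_atTop_add_const_left _ t tendsto_natCast_atTop_atTop).inv_tendsto_atTop
  have hlim := ((tendsto_const_nhds (x := 1 / t)).sub hinv).add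
    (summable_one_div_add_succ_sq (-t)).hasSum.tendsto_sum_nat
  have key := le_of_tendsto (hlim.const_mul (Real.sin (Real.pi * t) ^ 2))
    (Eventually.of_forall (sin_sq_mul_add_sum_range_le ht))
  have key' := div_le_one_of_le₀ key (sq_nonneg _)
  rw [mul_neg, Real.sin_neg, neg_div, neg_sq, div_pow, div_neg]
  linear_combination 2 * key'

/-- the Selberg minorant satisfies `S₋(x) ≤ χ_{(α,β)}(x)` for all
real `x`, where `χ_{(α,β)}` is the characteristic function of `(α, β)`. -/
theorem selbergMinus_le_indicator (α β δ : ℝ) (hαβ : α < β) (hδ : 0 < δ) :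
    ∀ x : ℝ, selbergMinus α β δ x ≤ Set.indicator (Set.Ioo α β) (fun _ => (1 : ℝ)) x := by
  intro x
  have h1 := neg_one_le_beurlingB (δ * (α - x))
  have h2 := neg_one_le_beurlingB (δ * (x - β))
  rw [selbergMinus]
  by_cases hx : x ∈ Set.Ioo α β
  · rw [Set.indicator_of_mem hx]
    linarith
  · rw [Set.indicator_of_notMem hx]
    rcases le_or_gt x α with hα | hα
    · have := one_le_beurlingB (mul_nonneg hδ.le (sub_nonneg.mpr hα))
      linarith
    · have hβ : β ≤ x := not_lt.mp fun h ↦ hx ⟨hα, h⟩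
      have := one_le_beurlingB (mul_nonneg hδ.le (sub_nonneg.mpr hβ))
      linarith
end

section
/- Let α < β be real numbers and δ > 0, and let S_− be the Selberg minorant for the interval [α, β] with parameter δ. Then S_− is integrable on ℝ and ∫_{−∞}^∞ S_−(x) dx = β − α − 1/δ. -/
open Real MeasureTheory
open scoped Classical

theorem sin_pi_mul_int_add_sq (n : ℤ) (x : ℝ) : sin (π * (n + x)) ^ 2 = sin (π * x) ^ 2 := by
  rw [mul_add, add_comm, mul_comm π (n : ℝ), sin_add_int_mul_pi, mul_pow]
  rcases Int.even_or_odd n with hn | hn <;> simp [hn.neg_one_zpow]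

theorem hasSum_sin_sq_div_int_add_sq {t : ℝ} (ht : ∀ n : ℤ, t ≠ n) :
    HasSum (fun n : ℤ ↦ (sin (π * t) / π) ^ 2 * (1 / ((n : ℝ) + t) ^ 2)) 1 := by
  set f : ℝ → ℂ := fun x ↦ Complex.exp (2 * π * Complex.I * t * x) with hf
  have hfc : Continuous f := by fun_prop
  have hnorm (x : ℝ) : ‖f x‖ = 1 := by
    rw [hf, ← Complex.norm_exp_ofReal_mul_I (2 * π * t * x)]
    push_cast
    ring_nf
  have hL2 : MemLp f 2 (volume.restrict (Set.Ioc 0 1)) :=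
    MemLp.of_bound hfc.aestronglyMeasurable 1 (ae_of_all _ fun x ↦ (hnorm x).le)
  have h := hasSum_sq_fourierCoeffOn zero_lt_one hL2
  simp only [hnorm, one_pow, sub_zero, inv_one, intervalIntegral.integral_const, smul_eq_mul,
    mul_one] at h
  rw [← (Equiv.neg ℤ).hasSum_iff] at h
  refine h.congr_fun fun n ↦ ?_
  have hnt : (n : ℝ) + t ≠ 0 := fun h0 ↦ ht (-n) (by push_cast; linarith)
  have hc : 2 * π * Complex.I * ((n + t : ℝ) : ℂ) ≠ 0 := by
    have : ((n + t : ℝ) : ℂ) ≠ 0 := by exact_mod_cast hnt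
    simpa [pi_ne_zero] using this
  have hcoeff : fourierCoeffOn zero_lt_one f (-n) =
      (Complex.exp (Complex.I * ((2 * π * (n + t) : ℝ) : ℂ)) - 1) /
        (2 * π * Complex.I * ((n + t : ℝ) : ℂ)) := by
    rw [fourierCoeffOn_eq_integral]
    have (x : ℝ) : fourier (-(-n)) (x : AddCircle ((1 : ℝ) - 0)) • f x =
        Complex.exp (2 * π * Complex.I * ((n + t : ℝ) : ℂ) * x) := by
      rw [fourier_coe_apply, hf, smul_eq_mul, ← Complex.exp_add]
      push_cast
      ring_nf
    simp_rw [this]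
    rw [integral_exp_mul_complex hc]
    push_cast
    simp
    ring_nf
  simp only [Function.comp_apply, Equiv.neg_apply]
  rw [hcoeff, norm_div, Complex.norm_exp_I_mul_ofReal_sub_one,
    show 2 * π * ((n : ℝ) + t) / 2 = π * (n + t) by ring]
  simp only [norm_mul, Complex.norm_real, Complex.norm_I, RCLike.norm_ofNat, mul_one, div_pow, mul_pow,
    norm_eq_abs, sq_abs, sin_pi_mul_int_add_sq]
  field_simp

theorem summable_one_div_nat_succ_add_sq (x : ℝ) :
    Summable fun n : ℕ ↦ 1 / (((n : ℝ) + 1) + x) ^ 2 := by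
  have := (summable_one_div_nat_add_rpow (1 + x) 2).2 one_lt_two
  refine this.congr fun n ↦ ?_
  rw [rpow_two, sq_abs, add_assoc]

theorem sin_sq_mul_partial_fraction {x : ℝ} (hx : ∀ n : ℤ, x ≠ n) :
    (sin (π * x) / π) ^ 2 * (1 / x ^ 2 + (∑' n : ℕ, 1 / (((n : ℝ) + 1) + x) ^ 2) +
      ∑' n : ℕ, 1 / (((n : ℝ) + 1) + -x) ^ 2) = 1 := by
  have h := (hasSum_sin_sq_div_int_add_sq hx).tsum_eq
  rw [tsum_mul_left, tsum_of_add_one_of_neg_add_one] at h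
  · refine Eq.trans ?_ h
    congr 1
    have (n : ℕ) : 1 / (((-((n : ℤ) + 1) : ℤ) : ℝ) + x) ^ 2 = 1 / (((n : ℝ) + 1) + -x) ^ 2 := by
      rw [← neg_sq]
      push_cast
      ring_nf
    simp_rw [this]
    push_cast
    rw [zero_add]
    ring
  · exact_mod_cast summable_one_div_nat_succ_add_sq x
  · refine (summable_one_div_nat_succ_add_sq (-x)).congr fun n ↦ ?_
    rw [← neg_sq]
    push_cast
    ring_nf

theorem hasSum_one_div_nat_add_sub {x : ℝ} (hx : 0 < x) :
    HasSum (fun n : ℕ ↦ 1 / ((n : ℝ) + x) - 1 / ((n : ℝ) + 1 + x)) (1 / x) := by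
  rw [hasSum_iff_tendsto_nat_of_nonneg]
  · have (n : ℕ) : ∑ i ∈ Finset.range n, (1 / ((i : ℝ) + x) - 1 / ((i : ℝ) + 1 + x)) =
        1 / x - 1 / ((n : ℝ) + x) := by
      have := Finset.sum_range_sub' (fun i : ℕ ↦ 1 / ((i : ℝ) + x)) n
      push_cast at this
      simpa using this
    simp_rw [this]
    have h : Filter.Tendsto (fun n : ℕ ↦ 1 / ((n : ℝ) + x)) Filter.atTop (nhds 0) := by
      simp_rw [one_div]
      exact (Filter.tendsto_atTop_add_const_right _ x tendsto_natCast_atTop_atTop).inv_tendsto_atTop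
    simpa using h.const_sub (1 / x)
  · intro n
    rw [sub_nonneg]
    gcongr
    linarith

theorem tsum_one_div_nat_succ_add_sq_le {x : ℝ} (hx : 0 < x) :
    ∑' n : ℕ, 1 / (((n : ℝ) + 1) + x) ^ 2 ≤ 1 / x := by
  refine hasSum_le (fun n ↦ ?_) (summable_one_div_nat_succ_add_sq x).hasSum
    (hasSum_one_div_nat_add_sub hx)
  rw [div_sub_div _ _ (by positivity) (by positivity), div_le_div_iff₀ (by positivity)
    (by positivity)]
  have : 0 < (n : ℝ) + x := by positivity
  nlinarith

theorem one_div_le_tsum_one_div_nat_add_sq {x : ℝ} (hx : 0 < x) :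
    1 / x ≤ 1 / x ^ 2 + ∑' n : ℕ, 1 / (((n : ℝ) + 1) + x) ^ 2 := by
  have h : HasSum (fun n : ℕ ↦ 1 / ((n : ℝ) + x) ^ 2)
      (1 / x ^ 2 + ∑' n : ℕ, 1 / (((n : ℝ) + 1) + x) ^ 2) := by
    rw [add_comm, ← hasSum_nat_add_iff' 1]
    simpa using (summable_one_div_nat_succ_add_sq x).hasSum
  refine hasSum_le (fun n ↦ ?_) (hasSum_one_div_nat_add_sub hx) h
  rw [div_sub_div _ _ (by positivity) (by positivity), div_le_div_iff₀ (by positivity)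
    (by positivity)]
  have : 0 < (n : ℝ) + x := by positivity
  nlinarith

theorem lintegral_sin_sq_div_sq :
    ∫⁻ x : ℝ, ENNReal.ofReal ((sin (π * x) / π) ^ 2 * (1 / x ^ 2)) = 1 := by
  set f : ℝ → ENNReal := fun x ↦ ENNReal.ofReal ((sin (π * x) / π) ^ 2 * (1 / x ^ 2)) with hf
  have hfm : Measurable f := by fun_prop
  change ∫⁻ x, f x = 1
  rw [← setLIntegral_univ, ← iUnion_Ioc_intCast ℝ,
    lintegral_iUnion (fun _ ↦ measurableSet_Ioc) (Set.pairwise_disjoint_Ioc_intCast ℝ)]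
  have hshift (n : ℤ) : ∫⁻ x in Set.Ioc (n : ℝ) (n + 1), f x =
      ∫⁻ x in Set.Ioc (0 : ℝ) 1, f (n + x) := by
    have := (measurePreserving_add_left (volume : Measure ℝ) (n : ℝ)).setLIntegral_comp_preimage
      (s := Set.Ioc (n : ℝ) (n + 1)) measurableSet_Ioc hfm
    rw [← this]
    simp
  simp_rw [hshift]
  rw [← lintegral_tsum fun n ↦ by fun_prop]
  have hae : ∀ᵐ x : ℝ, ∀ n : ℤ, x ≠ n := ae_all_iff.2 fun n ↦ Measure.ae_ne volume _
  rw [lintegral_congr_ae (g := fun _ ↦ 1)]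
  · simp
  filter_upwards [ae_restrict_of_ae hae] with x hx
  have h := hasSum_sin_sq_div_int_add_sq hx
  simp_rw [hf, div_pow, sin_pi_mul_int_add_sq, ← div_pow]
  rw [← ENNReal.ofReal_tsum_of_nonneg (fun n ↦ by positivity) h.summable, h.tsum_eq,
    ENNReal.ofReal_one]

theorem integrable_sin_sq_div_sq :
    Integrable fun x : ℝ ↦ (sin (π * x) / π) ^ 2 * (1 / x ^ 2) := by
  refine ⟨by fun_prop, ?_⟩
  rw [hasFiniteIntegral_iff_ofReal (ae_of_all _ fun x ↦ by positivity), lintegral_sin_sq_div_sq]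
  exact ENNReal.one_lt_top

theorem integral_sin_sq_div_sq :
    ∫ x : ℝ, (sin (π * x) / π) ^ 2 * (1 / x ^ 2) = 1 := by
  rw [integral_eq_lintegral_of_nonneg_ae (ae_of_all _ fun x ↦ by positivity) (by fun_prop),
    lintegral_sin_sq_div_sq, ENNReal.toReal_one]

/-- The difference between Beurling's function and the sign function. -/
noncomputable def beurlingDefect (x : ℝ) : ℝ := beurlingB x - sign x

theorem measurable_beurlingDefect : Measurable beurlingDefect := by
  have hs : Measurable sign := by
    unfold sign
    exact Measurable.ite measurableSet_Iio measurable_const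
      (Measurable.ite measurableSet_Ioi measurable_const measurable_const)
  refine Measurable.sub ?_ hs
  have hS : Measurable fun x : ℝ ↦ ∑' n : ℕ, 1 / (((n : ℝ) + 1) + x) ^ 2 :=
    Measurable.tsum fun n ↦ by fun_prop
  unfold beurlingB
  refine Measurable.ite ?_ measurable_const (by fun_prop)
  rw [Set.ofPred_exists]
  exact MeasurableSet.iUnion fun m ↦ measurableSet_eq

theorem beurlingB_of_ne_int {x : ℝ} (hx : ∀ n : ℤ, x ≠ n) :
    beurlingB x = 1 + 2 * (sin (π * x) / π) ^ 2 *
      (1 / x - ∑' n : ℕ, 1 / (((n : ℝ) + 1) + x) ^ 2) := by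
  refine if_neg ?_
  rintro ⟨m, hm⟩
  exact hx (-(m + 1)) (by push_cast; exact hm)

theorem beurlingDefect_of_pos {x : ℝ} (hx : ∀ n : ℤ, x ≠ n) (h0 : 0 < x) :
    beurlingDefect x = 2 * (sin (π * x) / π) ^ 2 *
      (1 / x - ∑' n : ℕ, 1 / (((n : ℝ) + 1) + x) ^ 2) := by
  rw [beurlingDefect, beurlingB_of_ne_int hx, sign_of_pos h0]
  ring

theorem beurlingDefect_neg_of_pos {x : ℝ} (hx : ∀ n : ℤ, x ≠ n) (h0 : 0 < x) :
    beurlingDefect (-x) = 2 * (sin (π * x) / π) ^ 2 *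
      (1 / x ^ 2 + (∑' n : ℕ, 1 / (((n : ℝ) + 1) + x) ^ 2) - 1 / x) := by
  have hx' (n : ℤ) : -x ≠ n := fun h ↦ hx (-n) (by push_cast; linarith)
  rw [beurlingDefect, beurlingB_of_ne_int hx', sign_of_neg (neg_lt_zero.2 h0), mul_neg, sin_neg,
    neg_div, neg_sq, one_div_neg_eq_neg_one_div]
  linear_combination -2 * sin_sq_mul_partial_fraction hx

theorem beurlingDefect_nonneg {x : ℝ} (hx : ∀ n : ℤ, x ≠ n) : 0 ≤ beurlingDefect x := by
  rcases lt_trichotomy x 0 with h | h | h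
  · have hx' (n : ℤ) : -x ≠ n := fun h ↦ hx (-n) (by push_cast; linarith)
    have h' := neg_pos.2 h
    rw [← neg_neg x, beurlingDefect_neg_of_pos hx' h']
    exact mul_nonneg (by positivity) (sub_nonneg.2 (one_div_le_tsum_one_div_nat_add_sq h'))
  · exact absurd h (by exact_mod_cast hx 0)
  · rw [beurlingDefect_of_pos hx h]
    exact mul_nonneg (by positivity) (sub_nonneg.2 (tsum_one_div_nat_succ_add_sq_le h))

theorem beurlingDefect_add_neg {x : ℝ} (hx : ∀ n : ℤ, x ≠ n) :
    beurlingDefect x + beurlingDefect (-x) = 2 * ((sin (π * x) / π) ^ 2 * (1 / x ^ 2)) := by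
  rcases lt_trichotomy x 0 with h | h | h
  · have hx' (n : ℤ) : -x ≠ n := fun h ↦ hx (-n) (by push_cast; linarith)
    have h' := neg_pos.2 h
    have h1 := beurlingDefect_neg_of_pos hx' h'
    rw [neg_neg] at h1
    rw [h1, beurlingDefect_of_pos hx' h', mul_neg, sin_neg, neg_div, neg_sq, neg_sq]
    ring
  · exact absurd h (by exact_mod_cast hx 0)
  · rw [beurlingDefect_of_pos hx h, beurlingDefect_neg_of_pos hx h]
    ring

theorem integrable_beurlingDefect : Integrable beurlingDefect := by
  refine (integrable_sin_sq_div_sq.const_mul 2).mono'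
    measurable_beurlingDefect.aestronglyMeasurable ?_
  have hae : ∀ᵐ x : ℝ, ∀ n : ℤ, x ≠ n := ae_all_iff.2 fun n ↦ Measure.ae_ne volume _
  filter_upwards [hae] with x hx
  have hx' (n : ℤ) : -x ≠ n := fun h ↦ hx (-n) (by push_cast; linarith)
  rw [norm_of_nonneg (beurlingDefect_nonneg hx), ← beurlingDefect_add_neg hx]
  exact le_add_of_nonneg_right (beurlingDefect_nonneg hx')

theorem integral_beurlingDefect : ∫ x : ℝ, beurlingDefect x = 1 := by
  have hae : ∀ᵐ x : ℝ, ∀ n : ℤ, x ≠ n := ae_all_iff.2 fun n ↦ Measure.ae_ne volume _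
  have h : ∫ x : ℝ, (beurlingDefect x + beurlingDefect (-x)) = 2 := by
    rw [integral_congr_ae (hae.mono fun x hx ↦ beurlingDefect_add_neg hx), integral_const_mul,
      integral_sin_sq_div_sq, mul_one]
  rw [integral_add integrable_beurlingDefect integrable_beurlingDefect.comp_neg,
    integral_neg_eq_self] at h
  linarith

theorem selbergMinus_eq {α β δ x : ℝ} (hαβ : α < β) (hδ : 0 < δ) (hα : x ≠ α) (hβ : x ≠ β) :
    selbergMinus α β δ x = (Set.Ioc α β).indicator 1 x -
      (1 / 2) * (beurlingDefect (δ * (α - x)) + beurlingDefect (δ * (x - β))) := by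
  simp only [selbergMinus, beurlingDefect]
  rcases lt_or_gt_of_ne hα with h1 | h1
  · rw [sign_of_pos (mul_pos hδ (by linarith)),
      sign_of_neg (mul_neg_of_pos_of_neg hδ (by linarith)),
      Set.indicator_of_notMem fun h ↦ h1.not_gt h.1]
    ring
  rcases lt_or_gt_of_ne hβ with h2 | h2
  · rw [sign_of_neg (mul_neg_of_pos_of_neg hδ (by linarith)),
      sign_of_neg (mul_neg_of_pos_of_neg hδ (by linarith)),
      Set.indicator_of_mem (Set.mem_Ioc.2 ⟨h1, h2.le⟩), Pi.one_apply]
    ring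
  · rw [sign_of_neg (mul_neg_of_pos_of_neg hδ (by linarith)),
      sign_of_pos (mul_pos hδ (by linarith)),
      Set.indicator_of_notMem fun h ↦ h2.not_ge h.2]
    ring

/-- the Selberg minorant is integrable on `ℝ` with
`∫_{−∞}^∞ S₋(x) dx = β − α − 1/δ`. -/
theorem selbergMinus_integral (α β δ : ℝ) (hαβ : α < β) (hδ : 0 < δ) :
    Integrable (selbergMinus α β δ) ∧
      ∫ x : ℝ, selbergMinus α β δ x = β - α - 1 / δ := by
  have hae : selbergMinus α β δ =ᵐ[volume] fun x ↦ (Set.Ioc α β).indicator 1 x -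
      (1 / 2) * (beurlingDefect (δ * (α - x)) + beurlingDefect (δ * (x - β))) := by
    filter_upwards [Measure.ae_ne volume α, Measure.ae_ne volume β] with x h1 h2
    exact selbergMinus_eq hαβ hδ h1 h2
  have hscale : Integrable fun x ↦ beurlingDefect (δ * x) :=
    integrable_beurlingDefect.comp_mul_left' hδ.ne'
  have hscale_integral : ∫ x, beurlingDefect (δ * x) = 1 / δ := by
    rw [Measure.integral_comp_mul_left, integral_beurlingDefect, abs_of_pos (by positivity)]
    simp
  have hl : Integrable fun x ↦ beurlingDefect (δ * (α - x)) := hscale.comp_sub_left α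
  have hr : Integrable fun x ↦ beurlingDefect (δ * (x - β)) := hscale.comp_sub_right β
  have hi : Integrable ((Set.Ioc α β).indicator (1 : ℝ → ℝ)) :=
    (integrable_indicator_iff measurableSet_Ioc).2 (integrableOn_const (by simp))
  have hlr : Integrable fun x ↦
      1 / 2 * (beurlingDefect (δ * (α - x)) + beurlingDefect (δ * (x - β))) :=
    (hl.add hr).const_mul _
  refine ⟨(integrable_congr hae).2 (hi.sub hlr), ?_⟩
  rw [integral_congr_ae hae, integral_sub hi hlr, integral_const_mul,
    integral_add hl hr, integral_sub_left_eq_self (fun x ↦ beurlingDefect (δ * x)),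
    integral_sub_right_eq_self (fun x ↦ beurlingDefect (δ * x)), hscale_integral,
    integral_indicator_one measurableSet_Ioc, volume_real_Ioc_of_le hαβ.le]
  ring
end

section
/- Let α < β be real numbers and δ > 0, and let S_− be the Selberg minorant for the interval [α, β] with parameter δ. Then the Fourier transform Ŝ_−(x) = ∫_{−∞}^∞ S_−(u) e^{−2πiux} du vanishes for all real x with |x| > δ; that is, Ŝ_− is supported in [−δ, δ]. -/
open Real MeasureTheory
open scoped Classical

/-- The Fourier transform `f̂(x) = ∫_{−∞}^∞ f(u) e^{−2πiux} du` of a real-valued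
function on `ℝ`. -/
noncomputable def fourierT (f : ℝ → ℝ) (x : ℝ) : ℂ :=
  ∫ u : ℝ, (f u : ℂ) * Complex.exp (-(2 * Real.pi * u * x) * Complex.I)

open Complex FourierTransform in
/-- The function supported in `[-1, 1]` whose inverse Fourier transform is
`y ↦ sin² (π y) / (π² y² (y - 1))`. -/
noncomputable def beurlingKernelHat (t : ℝ) : ℂ :=
  if t ≤ 0 then
    -(1 + (max t (-1) : ℝ)) + (1 - cexp (-(2 * Real.pi * I) * (max t (-1) : ℝ))) / (2 * Real.pi * I)
  else
    -(1 - (min t 1 : ℝ)) - (1 - cexp (-(2 * Real.pi * I) * (min t 1 : ℝ))) / (2 * Real.pi * I)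

lemma beurlingKernelHat_of_one_le_abs {t : ℝ} (ht : 1 ≤ |t|) : beurlingKernelHat t = 0 := by
  have h1 : Complex.exp (2 * Real.pi * Complex.I) = 1 := Complex.exp_two_pi_mul_I
  rcases le_abs.1 ht with h | h
  · have h0 : ¬ t ≤ 0 := by linarith
    simp [beurlingKernelHat, h0, min_eq_right h, Complex.exp_neg, h1]
  · have h0 : t ≤ 0 := by linarith
    have h2 : t ≤ -1 := by linarith
    simp [beurlingKernelHat, h0, max_eq_right h2, h1]

lemma continuous_beurlingKernelHat : Continuous beurlingKernelHat := by
  unfold beurlingKernelHat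
  refine Continuous.if_le (by fun_prop) (by fun_prop) continuous_id continuous_const ?_
  rintro t rfl
  simp

lemma integrable_beurlingKernelHat : Integrable beurlingKernelHat :=
  continuous_beurlingKernelHat.integrable_of_hasCompactSupport <|
    HasCompactSupport.of_support_subset_isCompact (isCompact_Icc (a := -1) (b := 1)) fun t ht => by
      by_contra h
      refine ht (beurlingKernelHat_of_one_le_abs ?_)
      by_contra! h'
      exact h ⟨(abs_lt.1 h').1.le, (abs_lt.1 h').2.le⟩

lemma hasDerivAt_exp_const_mul {c : ℂ} (t : ℝ) :
    HasDerivAt (fun s : ℝ => Complex.exp (c * s)) (Complex.exp (c * t) * c) t := by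
  simpa using (((hasDerivAt_id (t : ℂ)).const_mul c).cexp).comp_ofReal

open Complex in
lemma integral_affine_add_exp_mul_exp {E w p q r : ℂ} (hE : E ≠ 0) (hEw : E - w ≠ 0) (a b : ℝ) :
    ∫ t in a..b, (p + q * t + r * cexp (-w * t)) * cexp (E * t) =
      ((p + q * b) / E - q / E ^ 2) * cexp (E * b) + r / (E - w) * cexp ((E - w) * b) -
      (((p + q * a) / E - q / E ^ 2) * cexp (E * a) + r / (E - w) * cexp ((E - w) * a)) := by
  refine intervalIntegral.integral_eq_sub_of_hasDerivAt
    (f := fun t : ℝ => ((p + q * t) / E - q / E ^ 2) * cexp (E * t) +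
      r / (E - w) * cexp ((E - w) * t)) (fun t _ => ?_)
    (Continuous.intervalIntegrable (by fun_prop) _ _)
  have h1 : HasDerivAt (fun s : ℝ => (p + q * s) / E - q / E ^ 2) (q / E) t := by
    have := ((((hasDerivAt_id (t : ℂ)).const_mul q).const_add p).div_const E).sub_const (q / E ^ 2)
    simpa using this.comp_ofReal
  refine ((h1.mul (hasDerivAt_exp_const_mul (c := E) t)).add
    ((hasDerivAt_exp_const_mul (c := E - w) t).const_mul (r / (E - w)))).congr_deriv ?_
  rw [show (E - w) * (t : ℂ) = -w * t + E * t by ring, Complex.exp_add]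
  field_simp
  ring

open Complex FourierTransform in
lemma fourierInv_beurlingKernelHat {y : ℝ} (h0 : y ≠ 0) (h1 : y ≠ 1) :
    𝓕⁻ beurlingKernelHat y =
      ((Real.sin (Real.pi * y) ^ 2 / (Real.pi ^ 2 * (y ^ 2 * (y - 1))) : ℝ) : ℂ) := by
  have hpi : (Real.pi : ℂ) ≠ 0 := by exact_mod_cast Real.pi_ne_zero
  have hy0 : (y : ℂ) ≠ 0 := by exact_mod_cast h0
  have hy1 : (y : ℂ) - 1 ≠ 0 := by exact_mod_cast sub_ne_zero.2 h1
  set w : ℂ := 2 * Real.pi * I with hw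
  set E : ℂ := w * y with hE
  have hw0 : w ≠ 0 := by simp [hw, hpi]
  have hE0 : E ≠ 0 := mul_ne_zero hw0 hy0
  have hEw : E - w ≠ 0 := by
    rw [hE, show w * y - w = w * (y - 1) by ring]; exact mul_ne_zero hw0 hy1
  have hw1 : cexp w = 1 := Complex.exp_two_pi_mul_I
  have hinv : 𝓕⁻ beurlingKernelHat y = ∫ t : ℝ, beurlingKernelHat t * cexp (E * t) := by
    rw [Real.fourierInv_eq']
    congr with t
    rw [smul_eq_mul, mul_comm]
    congr 2
    simp [hE, hw]
    ring
  have hsupp : Function.support (fun t : ℝ => beurlingKernelHat t * cexp (E * t)) ⊆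
      Set.Ioc (-1) 1 := by
    intro t ht
    by_contra h
    refine ht ?_
    have : beurlingKernelHat t = 0 := by
      refine beurlingKernelHat_of_one_le_abs ?_
      by_contra! h'
      exact h ⟨(abs_lt.1 h').1, (abs_lt.1 h').2.le⟩
    simp [this]
  have hcont : Continuous fun t : ℝ => beurlingKernelHat t * cexp (E * t) :=
    continuous_beurlingKernelHat.mul (by fun_prop)
  have hL : ∫ t in (-1 : ℝ)..0, beurlingKernelHat t * cexp (E * t) =
      ∫ t in (-1 : ℝ)..0, ((-1 + 1 / w) + (-1) * t + (-1 / w) * cexp (-w * t)) * cexp (E * t) := by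
    refine intervalIntegral.integral_congr fun t ht => ?_
    rw [Set.uIcc_of_le (by norm_num)] at ht
    simp only [beurlingKernelHat, if_pos ht.2, max_eq_left ht.1, ← hw]
    ring
  have hR : ∫ t in (0 : ℝ)..1, beurlingKernelHat t * cexp (E * t) =
      ∫ t in (0 : ℝ)..1, ((-1 - 1 / w) + 1 * t + (1 / w) * cexp (-w * t)) * cexp (E * t) := by
    refine intervalIntegral.integral_congr fun t ht => ?_
    rw [Set.uIcc_of_le (by norm_num)] at ht
    rcases ht.1.eq_or_lt with rfl | h
    · simp [beurlingKernelHat]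
    · simp only [beurlingKernelHat, if_neg (not_le.2 h), min_eq_left ht.2, ← hw]
      ring
  have hsin : (Real.sin (Real.pi * y) : ℂ) ^ 2 = (2 - cexp E - (cexp E)⁻¹) / 4 := by
    have e1 : cexp E = cexp (Real.pi * y * I) ^ 2 := by
      rw [← Complex.exp_nat_mul]; congr 1; rw [hE, hw]; push_cast; ring
    have e2 := Complex.exp_ne_zero (Real.pi * y * I)
    rw [e1, Complex.ofReal_sin, Complex.sin, Complex.ofReal_mul, neg_mul, Complex.exp_neg]
    field_simp
    rw [I_sq]
    ring
  rw [hinv, ← intervalIntegral.integral_eq_integral_of_support_subset hsupp,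
    ← intervalIntegral.integral_add_adjacent_intervals (hcont.intervalIntegrable (-1) 0)
      (hcont.intervalIntegrable 0 1), hL, hR, integral_affine_add_exp_mul_exp hE0 hEw,
    integral_affine_add_exp_mul_exp hE0 hEw]
  have hq := Complex.exp_ne_zero E
  push_cast [hsin]
  simp only [mul_one, mul_zero, Complex.exp_zero, mul_neg, neg_sub, Complex.exp_sub, hw1,
    Complex.exp_neg]
  rw [← Complex.ofReal_mul, ← Complex.ofReal_sin, hsin]
  generalize cexp E = q at hq ⊢
  have hw2 : w ^ 2 = -4 * (Real.pi : ℂ) ^ 2 := by rw [hw]; ring_nf; rw [I_sq]; ring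
  have hpi2 : (Real.pi : ℂ) ^ 2 = -w ^ 2 / 4 := by rw [hw2]; ring
  rw [hpi2, hE, show w * (y : ℂ) - w = w * (y - 1) by ring]
  clear_value w
  field_simp
  ring

open FourierTransform in
lemma integrable_fourierInv_beurlingKernelHat : Integrable (𝓕⁻ beurlingKernelHat) := by
  have hcont : Continuous (𝓕⁻ beurlingKernelHat) :=
    VectorFourier.fourierIntegral_continuous Real.continuous_fourierChar
      (L := -innerₗ ℝ) (by exact continuous_inner.neg) integrable_beurlingKernelHat
  set M : ℝ := ∫ t, ‖beurlingKernelHat t‖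
  have hM : 0 ≤ M := integral_nonneg fun _ => norm_nonneg _
  refine (integrable_inv_one_add_sq.const_mul (5 * M + 2)).mono' hcont.aestronglyMeasurable
    (.of_forall fun y => ?_)
  rw [← div_eq_mul_inv, le_div_iff₀ (by positivity)]
  have hb : ‖𝓕⁻ beurlingKernelHat y‖ ≤ M :=
    VectorFourier.norm_fourierIntegral_le_integral_norm _ _ _ _ _
  by_cases hy : |y| ≤ 2
  · have : y ^ 2 ≤ 4 := by nlinarith [sq_abs y, abs_nonneg y]
    nlinarith [norm_nonneg (𝓕⁻ beurlingKernelHat y)]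
  · push Not at hy
    have h4 : 4 ≤ y ^ 2 := by nlinarith [sq_abs y]
    have h1 : 1 ≤ |y - 1| := by
      rcases lt_abs.1 hy with h | h
      · exact le_abs.2 (Or.inl (by linarith))
      · exact le_abs.2 (Or.inr (by linarith))
    have hy0 : y ≠ 0 := by rintro rfl; norm_num at h4
    have hy1 : y ≠ 1 := by rintro rfl; norm_num at h4
    have hle : ‖𝓕⁻ beurlingKernelHat y‖ ≤ 1 / y ^ 2 := by
      rw [fourierInv_beurlingKernelHat hy0 hy1, Complex.norm_real, Real.norm_eq_abs, abs_div,
        abs_mul, abs_mul, abs_of_nonneg (sq_nonneg (Real.sin _)), abs_of_nonneg (sq_nonneg y),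
        abs_of_nonneg (sq_nonneg Real.pi)]
      refine div_le_div₀ zero_le_one (Real.sin_sq_le_one _) (by positivity) ?_
      have : 1 ≤ Real.pi ^ 2 := by nlinarith [Real.pi_gt_three]
      nlinarith [mul_le_mul this h1 zero_le_one (by positivity), sq_nonneg y]
    calc _ ≤ 1 / y ^ 2 * (1 + y ^ 2) := by gcongr
      _ ≤ 2 := by rw [one_div_mul_eq_div, div_le_iff₀ (by positivity)]; linarith
      _ ≤ _ := by linarith

open FourierTransform in
lemma fourier_fourierInv_beurlingKernelHat :
    𝓕 (𝓕⁻ beurlingKernelHat) = beurlingKernelHat := by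
  refine continuous_beurlingKernelHat.fourier_fourierInv_eq integrable_beurlingKernelHat ?_
  convert integrable_fourierInv_beurlingKernelHat.comp_neg using 2 with y
  rw [Real.fourierInv_eq_fourier_neg, neg_neg]

open FourierTransform in
lemma integral_fourierInv_beurlingKernelHat_comp_affine {c x : ℝ} (d : ℝ) (hc : c ≠ 0)
    (hx : |c| ≤ |x|) :
    ∫ u : ℝ, 𝓕⁻ beurlingKernelHat (c * u + d) *
      Complex.exp (-(2 * Real.pi * u * x) * Complex.I) = 0 := by
  have hc' : (c : ℂ) ≠ 0 := by exact_mod_cast hc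
  let G : ℝ → ℂ := fun v => Complex.exp (2 * Real.pi * d * x / c * Complex.I) *
    (𝓕⁻ beurlingKernelHat v * Complex.exp (-(2 * Real.pi * v * (x / c)) * Complex.I))
  have key : ∀ u : ℝ, 𝓕⁻ beurlingKernelHat (c * u + d) *
      Complex.exp (-(2 * Real.pi * u * x) * Complex.I) = G (c * u + d) := by
    intro u
    simp only [G]
    rw [mul_left_comm, ← Complex.exp_add]
    congr 2
    push_cast
    field_simp
    ring
  rw [integral_congr_ae (.of_forall key), Measure.integral_comp_mul_left (fun s => G (s + d)) c,
    integral_add_right_eq_self, integral_const_mul]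
  have h : 𝓕 (𝓕⁻ beurlingKernelHat) (x / c) = 0 := by
    rw [fourier_fourierInv_beurlingKernelHat]
    refine beurlingKernelHat_of_one_le_abs ?_
    rwa [abs_div, one_le_div (abs_pos.2 hc)]
  rw [Real.fourier_real_eq_integral_exp_smul] at h
  have h' : ∫ v : ℝ, 𝓕⁻ beurlingKernelHat v *
      Complex.exp (-(2 * Real.pi * v * (x / c)) * Complex.I) = 0 := by
    rw [← h]
    congr with v
    rw [smul_eq_mul, mul_comm]
    congr 2
    push_cast
    ring
  rw [h']
  simp

lemma beurlingB_sub_beurlingB_add_one {y : ℝ} (hy : ∀ n : ℤ, y ≠ n) :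
    beurlingB y - beurlingB (y + 1) =
      2 * (Real.sin (Real.pi * (y + 1)) ^ 2 / (Real.pi ^ 2 * ((y + 1) ^ 2 * (y + 1 - 1)))) := by
  have h1 : ¬ ∃ m : ℕ, y = -((m : ℝ) + 1) := by
    rintro ⟨m, hm⟩
    exact hy (-(m + 1)) (by push_cast; exact hm)
  have h2 : ¬ ∃ m : ℕ, y + 1 = -((m : ℝ) + 1) := by
    rintro ⟨m, hm⟩
    exact hy (-(m + 1) - 1) (by push_cast; linarith)
  have hy0 : y ≠ 0 := by simpa using hy 0
  have hy1 : y + 1 ≠ 0 := fun h => hy (-1) (by push_cast; linarith)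
  have hsum : Summable fun n : ℕ => 1 / (((n : ℝ) + 1) + y) ^ 2 := by
    have := (Real.summable_one_div_nat_add_rpow (1 + y) 2).2 one_lt_two
    simpa [add_assoc] using this
  have hsin : Real.sin (Real.pi * (y + 1)) = -Real.sin (Real.pi * y) := by
    rw [mul_add, mul_one, Real.sin_add_pi]
  rw [beurlingB, beurlingB, if_neg h1, if_neg h2, hsum.tsum_eq_zero_add, hsin]
  have hshift : ∀ n : ℕ, 1 / (((n : ℝ) + 1) + (y + 1)) ^ 2 =
      1 / ((((n + 1 : ℕ) : ℝ) + 1) + y) ^ 2 := by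
    intro n; push_cast; congr 2; ring
  simp_rw [hshift]
  have hpi := Real.pi_ne_zero
  rw [add_sub_cancel_right, Nat.cast_zero, zero_add, add_comm 1 y]
  field_simp
  ring

open FourierTransform in
lemma selbergMinus_sub_selbergMinus_add_ae (α β : ℝ) {δ : ℝ} (hδ : 0 < δ) :
    ∀ᵐ u : ℝ, (selbergMinus α β δ u : ℂ) - selbergMinus α β δ (u + 1 / δ) =
      𝓕⁻ beurlingKernelHat (-δ * u + δ * α) -
        𝓕⁻ beurlingKernelHat (δ * u + (1 - δ * β)) := by
  have hcount : (Set.range (fun n : ℤ => α - n / δ) ∪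
      Set.range (fun n : ℤ => β + n / δ)).Countable :=
    (Set.countable_range _).union (Set.countable_range _)
  filter_upwards [hcount.ae_notMem volume] with u hu
  have ha : ∀ n : ℤ, δ * (α - u) ≠ n := fun n hn =>
    hu (Or.inl ⟨n, by simp only [← hn]; field_simp; ring⟩)
  have hb : ∀ n : ℤ, δ * (u - β) ≠ n := fun n hn =>
    hu (Or.inr ⟨n, by simp only [← hn]; field_simp; ring⟩)
  have ha' : ∀ n : ℤ, δ * (α - u) - 1 ≠ n := fun n hn =>
    ha (n + 1) (by push_cast; linarith)
  have A := beurlingB_sub_beurlingB_add_one ha'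
  have B := beurlingB_sub_beurlingB_add_one hb
  rw [sub_add_cancel] at A
  have e1 : -δ * u + δ * α = δ * (α - u) := by ring
  have e2 : δ * u + (1 - δ * β) = δ * (u - β) + 1 := by ring
  rw [e1, e2, fourierInv_beurlingKernelHat (by simpa using ha 0) (by simpa using ha 1),
    fourierInv_beurlingKernelHat (fun h => hb (-1) (by push_cast; linarith))
      (fun h => hb 0 (by push_cast; linarith))]
  have e3 : δ * (α - (u + 1 / δ)) = δ * (α - u) - 1 := by field_simp; ring
  have e4 : δ * (u + 1 / δ - β) = δ * (u - β) + 1 := by field_simp; ring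
  rw [selbergMinus, selbergMinus, e3, e4]
  norm_cast
  linarith

lemma integrable_mul_exp {f : ℝ → ℂ} (hf : Integrable f) (x : ℝ) :
    Integrable fun u : ℝ => f u * Complex.exp (-(2 * Real.pi * u * x) * Complex.I) := by
  refine hf.mul_bdd (c := 1) (Continuous.aestronglyMeasurable (by fun_prop))
    (.of_forall fun u => le_of_eq ?_)
  exact_mod_cast Complex.norm_exp_ofReal_mul_I (-(2 * Real.pi * u * x))

lemma continuous_fourierT {f : ℝ → ℝ} (hf : Integrable f) : Continuous (fourierT f) := by
  refine continuous_of_dominated (bound := fun u => ‖f u‖)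
    (fun x => (integrable_mul_exp hf.ofReal x).aestronglyMeasurable)
    (fun x => .of_forall fun u => le_of_eq ?_) hf.norm (.of_forall fun u => by fun_prop)
  have : ‖Complex.exp (-(2 * Real.pi * u * x) * Complex.I)‖ = 1 :=
    mod_cast Complex.norm_exp_ofReal_mul_I (-(2 * Real.pi * u * x))
  rw [norm_mul, this, mul_one, Complex.norm_real]

lemma integral_comp_add_mul_exp (f : ℝ → ℝ) (h x : ℝ) :
    ∫ u : ℝ, (f (u + h) : ℂ) * Complex.exp (-(2 * Real.pi * u * x) * Complex.I) =
      Complex.exp (2 * Real.pi * h * x * Complex.I) * fourierT f x := by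
  rw [fourierT, ← integral_const_mul]
  conv_rhs => rw [← integral_add_right_eq_self _ h]
  congr with u
  rw [mul_left_comm, ← Complex.exp_add]
  congr 2
  push_cast
  ring

open FourierTransform in
lemma one_sub_exp_mul_fourierT_selbergMinus (α β : ℝ) {δ x : ℝ} (hδ : 0 < δ)
    (hint : Integrable (selbergMinus α β δ)) (hx : δ ≤ |x|) :
    (1 - Complex.exp (2 * Real.pi * (1 / δ : ℝ) * x * Complex.I)) *
      fourierT (selbergMinus α β δ) x = 0 := by
  have hP := integrable_fourierInv_beurlingKernelHat
  have i1 := integrable_mul_exp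
    ((hP.comp_add_right (δ * α)).comp_mul_left' (neg_ne_zero.2 hδ.ne')) x
  have i2 := integrable_mul_exp ((hP.comp_add_right (1 - δ * β)).comp_mul_left' hδ.ne') x
  have j1 : Integrable fun u : ℝ => (selbergMinus α β δ u : ℂ) *
      Complex.exp (-(2 * Real.pi * u * x) * Complex.I) := integrable_mul_exp hint.ofReal x
  have j2 : Integrable fun u : ℝ => (selbergMinus α β δ (u + 1 / δ) : ℂ) *
      Complex.exp (-(2 * Real.pi * u * x) * Complex.I) :=
    integrable_mul_exp (hint.comp_add_right (1 / δ)).ofReal x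
  rw [sub_mul, one_mul, ← integral_comp_add_mul_exp, fourierT, ← integral_sub j1 j2]
  trans ∫ u : ℝ, (𝓕⁻ beurlingKernelHat (-δ * u + δ * α) *
      Complex.exp (-(2 * Real.pi * u * x) * Complex.I) -
      𝓕⁻ beurlingKernelHat (δ * u + (1 - δ * β)) *
      Complex.exp (-(2 * Real.pi * u * x) * Complex.I))
  · refine integral_congr_ae ?_
    filter_upwards [selbergMinus_sub_selbergMinus_add_ae α β hδ] with u hu
    rw [← sub_mul, ← sub_mul, hu]
  · rw [integral_sub i1 i2,
      integral_fourierInv_beurlingKernelHat_comp_affine _ (neg_ne_zero.2 hδ.ne')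
        (by rwa [abs_neg, abs_of_pos hδ]),
      integral_fourierInv_beurlingKernelHat_comp_affine _ hδ.ne' (by rwa [abs_of_pos hδ]),
      sub_zero]

/-- the Fourier transform of the Selberg minorant vanishes for all
real `x` with `|x| > δ`; it is supported in `[−δ, δ]`. -/
theorem selbergMinus_fourier_support (α β δ : ℝ) (hαβ : α < β) (hδ : 0 < δ) :
    ∀ x : ℝ, δ < |x| → fourierT (selbergMinus α β δ) x = 0 := by
  intro x hx
  by_cases hint : Integrable (selbergMinus α β δ)
  swap
  · refine integral_undef fun h => hint ?_
    convert (integrable_mul_exp h (-x)).re using 2 with u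
    rw [mul_assoc, ← Complex.exp_add]
    simp
  have hdense : Dense (Set.range fun n : ℤ => δ * n)ᶜ :=
    (Set.countable_range _).dense_compl ℝ
  have hopen : IsOpen {t : ℝ | δ < |t|} := isOpen_lt continuous_const continuous_abs
  have hclosed : IsClosed {t : ℝ | fourierT (selbergMinus α β δ) t = 0} :=
    isClosed_eq (continuous_fourierT hint) continuous_const
  refine closure_minimal ?_ hclosed (hdense.open_subset_closure_inter hopen hx)
  rintro t ⟨ht, htn⟩
  refine (mul_eq_zero.1 (one_sub_exp_mul_fourierT_selbergMinus α β hδ hint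
    (le_of_lt ht))).resolve_left fun h => htn ?_
  obtain ⟨n, hn⟩ := Complex.exp_eq_one_iff.1 (sub_eq_zero.1 h).symm
  refine ⟨n, ?_⟩
  have h2 : (((1 / δ) * t : ℝ) : ℂ) = ((n : ℝ) : ℂ) := by
    have : (2 * Real.pi * Complex.I : ℂ) ≠ 0 := Complex.two_pi_I_ne_zero
    refine mul_right_cancel₀ this ?_
    push_cast at hn ⊢
    rw [← hn]
    ring
  have h3 : 1 / δ * t = n := by exact_mod_cast h2
  simp only [← h3]
  field_simp
end

section
/- Let δ = (log 2)/(2π), α = −2.5/δ, β = 2.5/δ, and let S_− be the Selberg minorant for the interval [α, β] with parameter δ. Then for every complex number μ with Re(μ) ≥ 0, Re{ ∫_{−∞}^∞ (Γ'/Γ)(1/4 + it/2 + μ) · S_−(t) dt } > Ŝ_−(0) · log π, where Γ is the Euler Gamma function and Ŝ_−(0) = ∫_{−∞}^∞ S_−(t) dt = 4/δ. -/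
open Real MeasureTheory
open scoped Classical

/-- Value at a real point of the polynomial with the given list of rational coefficients. -/
def evalCoeffs : List ℚ → ℝ → ℝ
  | [], _ => 0
  | a :: l, x => a + x * evalCoeffs l x

/-- Coefficientwise sum of coefficient lists. -/
def addCoeffs : List ℚ → List ℚ → List ℚ
  | [], m => m
  | a :: l, [] => a :: l
  | a :: l, b :: m => (a + b) :: addCoeffs l m

/-- Scalar multiple of a coefficient list. -/
def smulCoeffs (c : ℚ) : List ℚ → List ℚ
  | [] => []
  | a :: l => (c * a) :: smulCoeffs c l

/-- Coefficient list of a product of polynomials. -/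
def mulCoeffs : List ℚ → List ℚ → List ℚ
  | [], _ => []
  | a :: l, m => addCoeffs (smulCoeffs a m) (0 :: mulCoeffs l m)

/-- Coefficient list of `h ↦ f (a + h)`. -/
def shiftCoeffs (a : ℚ) : List ℚ → List ℚ
  | [] => []
  | c :: l => addCoeffs [c] (mulCoeffs [a, 1] (shiftCoeffs a l))

/-- A lower bound, by interval Horner evaluation, of a polynomial on `[0, w]`. -/
def lowerCoeffs (w : ℚ) : List ℚ → ℚ
  | [] => 0
  | a :: l => a + min 0 (w * lowerCoeffs w l)

/-- The value of `∫ x in 0..b, x ^ (k - 1) * f x`. -/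
def momentCoeffs (b : ℚ) : ℕ → List ℚ → ℚ
  | _, [] => 0
  | k, a :: l => a * b ^ k / k + momentCoeffs b (k + 1) l

/-- Coefficient list of the truncated power series `∑ j < n, f j x ^ j`. -/
def seriesCoeffs (f : ℕ → ℚ) : ℕ → ℕ → List ℚ
  | _, 0 => []
  | k, n + 1 => f k :: seriesCoeffs f (k + 1) n

theorem evalCoeffs_addCoeffs (l m : List ℚ) (x : ℝ) :
    evalCoeffs (addCoeffs l m) x = evalCoeffs l x + evalCoeffs m x := by
  induction l generalizing m with
  | nil => simp [addCoeffs, evalCoeffs]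
  | cons a l ih =>
    cases m with
    | nil => simp [addCoeffs, evalCoeffs]
    | cons b m => simp [addCoeffs, evalCoeffs, ih]; ring

theorem evalCoeffs_smulCoeffs (c : ℚ) (l : List ℚ) (x : ℝ) :
    evalCoeffs (smulCoeffs c l) x = c * evalCoeffs l x := by
  induction l with
  | nil => simp [smulCoeffs, evalCoeffs]
  | cons a l ih => simp [smulCoeffs, evalCoeffs, ih]; ring

theorem evalCoeffs_mulCoeffs (l m : List ℚ) (x : ℝ) :
    evalCoeffs (mulCoeffs l m) x = evalCoeffs l x * evalCoeffs m x := by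
  induction l with
  | nil => simp [mulCoeffs, evalCoeffs]
  | cons a l ih =>
    simp [mulCoeffs, evalCoeffs, ih, evalCoeffs_addCoeffs, evalCoeffs_smulCoeffs]; ring

theorem evalCoeffs_shiftCoeffs (a : ℚ) (l : List ℚ) (h : ℝ) :
    evalCoeffs (shiftCoeffs a l) h = evalCoeffs l (a + h) := by
  induction l with
  | nil => simp [shiftCoeffs, evalCoeffs]
  | cons c l ih =>
    simp [shiftCoeffs, evalCoeffs, ih, evalCoeffs_addCoeffs, evalCoeffs_mulCoeffs]

theorem lowerCoeffs_le (w : ℚ) (l : List ℚ) {h : ℝ} (h0 : 0 ≤ h) (hw : h ≤ w) :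
    (lowerCoeffs w l : ℝ) ≤ evalCoeffs l h := by
  induction l with
  | nil => simp [lowerCoeffs, evalCoeffs]
  | cons a l ih =>
    have hw0 : (0 : ℝ) ≤ w := h0.trans hw
    simp only [lowerCoeffs, evalCoeffs]
    push_cast
    gcongr
    rcases le_total 0 (lowerCoeffs w l : ℝ) with hl | hl
    · exact (min_le_left _ _).trans (mul_nonneg h0 (hl.trans ih))
    · refine (min_le_right _ _).trans ?_
      calc (w : ℝ) * lowerCoeffs w l ≤ h * lowerCoeffs w l :=
            mul_le_mul_of_nonpos_right hw hl
        _ ≤ _ := by gcongr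

/-- Interval bound on `[a, a + w]` after recentering at `a`. -/
theorem lowerCoeffs_shiftCoeffs_le (a w : ℚ) (l : List ℚ) {x : ℝ} (h0 : a ≤ x)
    (hw : x ≤ a + w) : (lowerCoeffs w (shiftCoeffs a l) : ℝ) ≤ evalCoeffs l x := by
  have := lowerCoeffs_le w (shiftCoeffs a l) (h := x - a) (by linarith) (by linarith)
  simpa [evalCoeffs_shiftCoeffs] using this

theorem continuous_evalCoeffs (l : List ℚ) : Continuous (evalCoeffs l) := by
  induction l with
  | nil => exact continuous_const
  | cons a l ih =>
    change Continuous fun x => (a : ℝ) + x * evalCoeffs l x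
    fun_prop

theorem integral_pow_mul_evalCoeffs (b : ℚ) (k : ℕ) (l : List ℚ) :
    ∫ x in (0 : ℝ)..b, x ^ k * evalCoeffs l x = momentCoeffs b (k + 1) l := by
  induction l generalizing k with
  | nil => simp [evalCoeffs, momentCoeffs]
  | cons a l ih =>
    have hc := continuous_evalCoeffs l
    have h1 : ∀ x : ℝ, x ^ k * evalCoeffs (a :: l) x
        = x ^ k * a + x ^ (k + 1) * evalCoeffs l x := by
      intro x; simp only [evalCoeffs]; ring
    simp only [h1, momentCoeffs]
    rw [intervalIntegral.integral_add (Continuous.intervalIntegrable (by fun_prop) _ _)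
      (Continuous.intervalIntegrable (by fun_prop) _ _), ih, intervalIntegral.integral_mul_const,
      integral_pow]
    push_cast
    simp
    ring

theorem evalCoeffs_seriesCoeffs (f : ℕ → ℚ) (k n : ℕ) (x : ℝ) :
    evalCoeffs (seriesCoeffs f k n) x = ∑ j ∈ Finset.range n, (f (k + j) : ℝ) * x ^ j := by
  induction n generalizing k with
  | zero => simp [seriesCoeffs, evalCoeffs]
  | succ n ih =>
    rw [Finset.sum_range_succ', seriesCoeffs, evalCoeffs, ih, Finset.mul_sum]
    simp only [add_zero, pow_zero, mul_one]
    rw [add_comm]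
    congr 1
    refine Finset.sum_congr rfl fun j _ => ?_
    rw [show k + 1 + j = k + (j + 1) by ring]; ring

/-- Coefficients of the Taylor polynomial of `cos (a x)`. -/
def cosCoeffs (a : ℚ) (n : ℕ) : List ℚ :=
  seriesCoeffs (fun j => if j % 2 = 0 then (-1) ^ (j / 2) * a ^ j / (j.factorial : ℚ) else 0) 0
    (2 * n)

/-- Coefficients of the Taylor polynomial of `sin (a x)`. -/
def sinCoeffs (a : ℚ) (n : ℕ) : List ℚ :=
  seriesCoeffs (fun j => if j % 2 = 0 then 0 else (-1) ^ (j / 2) * a ^ j / (j.factorial : ℚ)) 0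
    (2 * n)

theorem evalCoeffs_cosCoeffs (a : ℚ) (n : ℕ) (x : ℝ) :
    evalCoeffs (cosCoeffs a n) x =
      ∑ j ∈ Finset.range n, (-1) ^ j * (a * x) ^ (2 * j) / ((2 * j).factorial : ℝ) := by
  rw [cosCoeffs, evalCoeffs_seriesCoeffs]
  induction n with
  | zero => simp
  | succ n ih =>
    rw [show 2 * (n + 1) = 2 * n + 1 + 1 by ring, Finset.sum_range_succ, Finset.sum_range_succ, ih,
      Finset.sum_range_succ]
    have h1 : (2 * n + 1) % 2 = 1 := by omega
    simp [h1]
    ring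

theorem evalCoeffs_sinCoeffs (a : ℚ) (n : ℕ) (x : ℝ) :
    evalCoeffs (sinCoeffs a n) x =
      ∑ j ∈ Finset.range n, (-1) ^ j * (a * x) ^ (2 * j + 1) / ((2 * j + 1).factorial : ℝ) := by
  rw [sinCoeffs, evalCoeffs_seriesCoeffs]
  induction n with
  | zero => simp
  | succ n ih =>
    rw [show 2 * (n + 1) = 2 * n + 1 + 1 by ring, Finset.sum_range_succ, Finset.sum_range_succ, ih,
      Finset.sum_range_succ]
    have h1 : (2 * n + 1) % 2 = 1 := by omega
    have h2 : (2 * n + 1) / 2 = n := by omega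
    simp [h1, h2]
    ring

/-- Taylor remainders of sine and cosine at the origin. -/
theorem abs_cos_sin_sub_taylor_le (n : ℕ) : ∀ x : ℝ, 0 ≤ x →
    |cos x - ∑ j ∈ Finset.range n, (-1) ^ j * x ^ (2 * j) / ((2 * j).factorial : ℝ)|
        ≤ x ^ (2 * n) / ((2 * n).factorial : ℝ) ∧
      |sin x - ∑ j ∈ Finset.range n, (-1) ^ j * x ^ (2 * j + 1) / ((2 * j + 1).factorial : ℝ)|
        ≤ x ^ (2 * n + 1) / ((2 * n + 1).factorial : ℝ) := by
  have key : ∀ (f f' : ℝ → ℝ) (k : ℕ), f 0 = 0 → (∀ x, HasDerivAt f (f' x) x) →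
      (∀ x, 0 ≤ x → |f' x| ≤ x ^ k / (k.factorial : ℝ)) →
      ∀ x, 0 ≤ x → |f x| ≤ x ^ (k + 1) / ((k + 1).factorial : ℝ) := by
    intro f f' k h0 hf hf' x hx
    have hB : ∀ t : ℝ, HasDerivAt (fun t : ℝ => t ^ (k + 1) / ((k + 1).factorial : ℝ))
        (t ^ k / (k.factorial : ℝ)) t := by
      intro t
      refine ((hasDerivAt_pow (k + 1) t).div_const ((k + 1).factorial : ℝ)).congr_deriv ?_
      rw [Nat.factorial_succ]
      push_cast
      field_simp
    have := image_norm_le_of_norm_deriv_right_le_deriv_boundary (a := 0) (b := x) (f := f)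
      (f' := f') (B := fun t : ℝ => t ^ (k + 1) / ((k + 1).factorial : ℝ))
      (B' := fun t => t ^ k / (k.factorial : ℝ))
      (fun t _ => (hf t).continuousAt.continuousWithinAt)
      (fun t _ => (hf t).hasDerivWithinAt) (by simp [h0]) hB
      (fun t ht => by simpa using hf' t ht.1) (x := x) ⟨hx, le_rfl⟩
    simpa using this
  have hC : ∀ (n : ℕ) (x : ℝ), HasDerivAt
      (fun x : ℝ => ∑ j ∈ Finset.range n, (-1) ^ j * x ^ (2 * j + 1) / ((2 * j + 1).factorial : ℝ))
      (∑ j ∈ Finset.range n, (-1) ^ j * x ^ (2 * j) / ((2 * j).factorial : ℝ)) x := by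
    intro n x
    refine HasDerivAt.fun_sum fun j _ => ?_
    refine (((hasDerivAt_pow (2 * j + 1) x).const_mul ((-1 : ℝ) ^ j)).div_const
      ((2 * j + 1).factorial : ℝ)).congr_deriv ?_
    rw [Nat.factorial_succ]
    push_cast
    field_simp
  have hS : ∀ (n : ℕ) (x : ℝ), HasDerivAt
      (fun x : ℝ => ∑ j ∈ Finset.range (n + 1), (-1) ^ j * x ^ (2 * j) / ((2 * j).factorial : ℝ))
      (-∑ j ∈ Finset.range n, (-1) ^ j * x ^ (2 * j + 1) / ((2 * j + 1).factorial : ℝ)) x := by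
    intro n x
    simp only [Finset.sum_range_succ', mul_zero, pow_zero]
    rw [← Finset.sum_neg_distrib]
    refine HasDerivAt.add_const _ (HasDerivAt.fun_sum fun j _ => ?_)
    refine (((hasDerivAt_pow (2 * (j + 1)) x).const_mul ((-1 : ℝ) ^ (j + 1))).div_const
      ((2 * (j + 1)).factorial : ℝ)).congr_deriv ?_
    rw [show 2 * (j + 1) = 2 * j + 1 + 1 by ring, Nat.factorial_succ (2 * j + 1)]
    push_cast
    field_simp
    ring_nf
  have step : ∀ n : ℕ, (∀ x : ℝ, 0 ≤ x →
      |cos x - ∑ j ∈ Finset.range n, (-1) ^ j * x ^ (2 * j) / ((2 * j).factorial : ℝ)|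
        ≤ x ^ (2 * n) / ((2 * n).factorial : ℝ)) → ∀ x : ℝ, 0 ≤ x →
      |sin x - ∑ j ∈ Finset.range n, (-1) ^ j * x ^ (2 * j + 1) / ((2 * j + 1).factorial : ℝ)|
        ≤ x ^ (2 * n + 1) / ((2 * n + 1).factorial : ℝ) := by
    intro n h
    exact key _ _ (2 * n) (by simp) (fun x => (hasDerivAt_sin x).sub (hC n x)) h
  induction n with
  | zero =>
    have h0 : ∀ x : ℝ, 0 ≤ x → |cos x - ∑ j ∈ Finset.range 0,
        (-1) ^ j * x ^ (2 * j) / ((2 * j).factorial : ℝ)|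
        ≤ x ^ (2 * 0) / ((2 * 0).factorial : ℝ) := by
      intro x _; simpa using abs_cos_le_one x
    exact fun x hx => ⟨h0 x hx, step 0 h0 x hx⟩
  | succ n ih =>
    have h1 : ∀ x : ℝ, 0 ≤ x → |cos x - ∑ j ∈ Finset.range (n + 1),
        (-1) ^ j * x ^ (2 * j) / ((2 * j).factorial : ℝ)|
        ≤ x ^ (2 * (n + 1)) / ((2 * (n + 1)).factorial : ℝ) := by
      refine key _ (fun x => -sin x - -∑ j ∈ Finset.range n,
        (-1) ^ j * x ^ (2 * j + 1) / ((2 * j + 1).factorial : ℝ)) (2 * n + 1) ?_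
        (fun x => (hasDerivAt_cos x).sub (hS n x)) ?_
      · simp [Finset.sum_range_succ']
      · intro x hx
        rw [show -sin x - -∑ j ∈ Finset.range n,
          (-1) ^ j * x ^ (2 * j + 1) / ((2 * j + 1).factorial : ℝ) = -(sin x -
          ∑ j ∈ Finset.range n, (-1) ^ j * x ^ (2 * j + 1) / ((2 * j + 1).factorial : ℝ)) by ring,
          abs_neg]
        exact (ih x hx).2
    exact fun x hx => ⟨h1 x hx, step (n + 1) h1 x hx⟩

/-- Coefficients of the Taylor polynomial of `exp (a x)`. -/
def expCoeffs (a : ℚ) (n : ℕ) : List ℚ :=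
  seriesCoeffs (fun j => a ^ j / (j.factorial : ℚ)) 0 n

theorem evalCoeffs_expCoeffs (a : ℚ) (n : ℕ) (x : ℝ) :
    evalCoeffs (expCoeffs a n) x = ∑ j ∈ Finset.range n, (a * x) ^ j / (j.factorial : ℝ) := by
  rw [expCoeffs, evalCoeffs_seriesCoeffs]
  refine Finset.sum_congr rfl fun j _ => ?_
  simp
  ring

theorem evalCoeffs_expCoeffs_le (a : ℚ) (n : ℕ) {x : ℝ} (h : 0 ≤ a * x) :
    evalCoeffs (expCoeffs a n) x ≤ exp (a * x) := by
  rw [evalCoeffs_expCoeffs]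
  exact Real.sum_le_exp_of_nonneg h n

theorem exp_le_evalCoeffs_expCoeffs (a : ℚ) (n : ℕ) {x : ℝ} (h : 0 ≤ a * x)
    (hn : a * x / (n + 1) ≤ 1 / 2) :
    exp (a * x) ≤ evalCoeffs (expCoeffs a n) x + 2 * (a * x) ^ n / (n.factorial : ℝ) := by
  have h1 : ‖((a * x : ℝ) : ℂ)‖ = a * x := by rw [Complex.norm_real, Real.norm_of_nonneg h]
  have h2 := Complex.exp_bound' (x := ((a * x : ℝ) : ℂ)) (n := n)
    (by rw [h1]; push_cast; exact hn)
  rw [h1] at h2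
  have h3 : ‖Complex.exp ((a * x : ℝ) : ℂ) - ∑ m ∈ Finset.range n,
      ((a * x : ℝ) : ℂ) ^ m / (m.factorial : ℂ)‖ =
      |exp (a * x) - ∑ m ∈ Finset.range n, (a * x) ^ m / (m.factorial : ℝ)| := by
    rw [← Real.norm_eq_abs, ← Complex.norm_real]
    push_cast
    rfl
  rw [h3] at h2
  rw [evalCoeffs_expCoeffs]
  have := (abs_le.1 h2).2
  have h4 : (a * x) ^ n / (n.factorial : ℝ) * 2 = 2 * (a * x) ^ n / (n.factorial : ℝ) := by ring
  linarith

/-- Coefficients of a Taylor polynomial of `u * exp (3 * u / 4) / (exp u - 1)`. -/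
def kernelCoeffs : List ℚ := [1, 1 / 4, -1 / 96, -1 / 128]

/-- Coefficients of an upper bound for `exp (a x)`. -/
def expUpperCoeffs (a : ℚ) (n : ℕ) : List ℚ :=
  addCoeffs (expCoeffs a n) (seriesCoeffs (fun j => if j = n then 2 * a ^ n / (n.factorial : ℚ)
    else 0) 0 (n + 1))

theorem exp_le_evalCoeffs_expUpperCoeffs (a : ℚ) (n : ℕ) {x : ℝ} (h : 0 ≤ a * x)
    (hn : a * x / (n + 1) ≤ 1 / 2) : exp (a * x) ≤ evalCoeffs (expUpperCoeffs a n) x := by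
  refine (exp_le_evalCoeffs_expCoeffs a n h hn).trans (le_of_eq ?_)
  rw [expUpperCoeffs, evalCoeffs_addCoeffs, evalCoeffs_seriesCoeffs]
  congr 1
  rw [Finset.sum_eq_single n]
  · simp
    ring
  · intro j _ hj
    simp [hj]
  · simp

/-- Nonnegativity on `[0, w]` certified by interval Horner evaluation. -/
theorem evalCoeffs_nonneg {w : ℚ} {l : List ℚ} (h : 0 ≤ lowerCoeffs w l) {x : ℝ} (h0 : 0 ≤ x)
    (hw : x ≤ w) : 0 ≤ evalCoeffs l x :=
  le_trans (by exact_mod_cast h) (lowerCoeffs_le w l h0 hw)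

theorem mul_exp_kernel_lower {u : ℝ} (h0 : 0 ≤ u) (h1 : u ≤ 7 / 5) :
    (evalCoeffs kernelCoeffs u - 3 / 5000 * u ^ 4) * (exp u - 1) ≤ u * exp (3 / 4 * u) := by
  have hA := evalCoeffs_expCoeffs_le (3 / 4) 12 (x := u) (by push_cast; positivity)
  have hU := exp_le_evalCoeffs_expUpperCoeffs 1 12 (x := u) (by push_cast; linarith)
    (by push_cast; linarith)
  have hw : u ≤ ((7 / 5 : ℚ) : ℝ) := by push_cast; exact h1
  have hk := evalCoeffs_nonneg (w := 7 / 5) (l := addCoeffs kernelCoeffs [0, 0, 0, 0, -3 / 5000])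
    (by decide +kernel) h0 hw
  have hm := evalCoeffs_nonneg (w := 7 / 5) (l := addCoeffs (0 :: expCoeffs (3 / 4) 12)
    (smulCoeffs (-1) (mulCoeffs (addCoeffs kernelCoeffs [0, 0, 0, 0, -3 / 5000])
      (addCoeffs [-1] (expUpperCoeffs 1 12))))) (by decide +kernel) h0 hw
  have hq : evalCoeffs (addCoeffs kernelCoeffs [0, 0, 0, 0, -3 / 5000]) u =
      evalCoeffs kernelCoeffs u - 3 / 5000 * u ^ 4 := by
    rw [evalCoeffs_addCoeffs]; simp [evalCoeffs]; ring
  rw [evalCoeffs_addCoeffs, evalCoeffs_smulCoeffs, evalCoeffs_mulCoeffs, hq, evalCoeffs_addCoeffs]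
    at hm
  rw [hq] at hk
  simp only [evalCoeffs] at hm
  push_cast at hm hA hU
  rw [one_mul] at hU
  have h2 := mul_le_mul_of_nonneg_left (sub_le_sub_right hU 1) hk
  have h3 := mul_le_mul_of_nonneg_left hA h0
  linarith

theorem mul_exp_kernel_upper {u : ℝ} (h0 : 0 ≤ u) (h1 : u ≤ 7 / 5) :
    u * exp (3 / 4 * u) ≤ (evalCoeffs kernelCoeffs u + 3 / 5000 * u ^ 4) * (exp u - 1) := by
  have hA := exp_le_evalCoeffs_expUpperCoeffs (3 / 4) 12 (x := u) (by push_cast; positivity)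
    (by push_cast; linarith)
  have hU := evalCoeffs_expCoeffs_le 1 12 (x := u) (by push_cast; linarith)
  have hw : u ≤ ((7 / 5 : ℚ) : ℝ) := by push_cast; exact h1
  have hk := evalCoeffs_nonneg (w := 7 / 5) (l := addCoeffs kernelCoeffs [0, 0, 0, 0, 3 / 5000])
    (by decide +kernel) h0 hw
  have hm := evalCoeffs_nonneg (w := 7 / 5) (l := addCoeffs (smulCoeffs (-1) (0 ::
    expUpperCoeffs (3 / 4) 12)) (mulCoeffs (addCoeffs kernelCoeffs [0, 0, 0, 0, 3 / 5000])
      (addCoeffs [-1] (expCoeffs 1 12)))) (by decide +kernel) h0 hw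
  have hq : evalCoeffs (addCoeffs kernelCoeffs [0, 0, 0, 0, 3 / 5000]) u =
      evalCoeffs kernelCoeffs u + 3 / 5000 * u ^ 4 := by
    rw [evalCoeffs_addCoeffs]; simp [evalCoeffs]; ring
  rw [evalCoeffs_addCoeffs, evalCoeffs_smulCoeffs, evalCoeffs_mulCoeffs, hq, evalCoeffs_addCoeffs]
    at hm
  rw [hq] at hk
  simp only [evalCoeffs] at hm
  push_cast at hm hA hU
  rw [one_mul] at hU
  have h2 := mul_le_mul_of_nonneg_left (sub_le_sub_right hU 1) hk
  have h3 := mul_le_mul_of_nonneg_left hA h0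
  linarith

theorem abs_kernel_sub_le {u : ℝ} (h0 : 0 < u) (h1 : u ≤ 7 / 5) :
    |u * exp (-u / 4) / (1 - exp (-u)) - evalCoeffs kernelCoeffs u| ≤ 3 / 5000 * u ^ 4 := by
  have hE : 0 < exp u - 1 := by linarith [Real.add_one_lt_exp h0.ne']
  have h2 : u * exp (-u / 4) / (1 - exp (-u)) = u * exp (3 / 4 * u) / (exp u - 1) := by
    have : 0 < 1 - exp (-u) := by linarith [Real.exp_lt_one_iff.2 (show -u < 0 by linarith)]
    have e1 : exp (-u / 4) * exp u = exp (3 / 4 * u) := by rw [← exp_add]; ring_nf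
    have e2 : exp (3 / 4 * u) * exp (-u) = exp (-u / 4) := by rw [← exp_add]; ring_nf
    rw [div_eq_div_iff this.ne' hE.ne']
    linear_combination u * e1 + u * e2
  rw [h2, abs_le]
  constructor
  · rw [neg_le_sub_iff_le_add, ← sub_le_iff_le_add, le_div_iff₀ hE]
    exact mul_exp_kernel_lower h0.le h1
  · rw [sub_le_iff_le_add', div_le_iff₀ hE]
    exact mul_exp_kernel_upper h0.le h1

theorem inv_exp_sub_one_ge {u : ℝ} (h0 : 0 < u) (h1 : u ≤ 7 / 5) :
    1 / u - 1 / 2 + u / 12 - u ^ 3 / 720 ≤ 1 / (exp u - 1) := by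
  have hE : 0 < exp u - 1 := by linarith [Real.add_one_lt_exp h0.ne']
  have hU := exp_le_evalCoeffs_expUpperCoeffs 1 12 (x := u) (by push_cast; linarith)
    (by push_cast; linarith)
  have hw : u ≤ ((7 / 5 : ℚ) : ℝ) := by push_cast; exact h1
  have hk := evalCoeffs_nonneg (w := 7 / 5) (l := [1, -1 / 2, 1 / 12, 0, -1 / 720])
    (by decide +kernel) h0.le hw
  have hm := evalCoeffs_nonneg (w := 7 / 5) (l := addCoeffs [0, 1] (smulCoeffs (-1)
    (mulCoeffs [1, -1 / 2, 1 / 12, 0, -1 / 720] (addCoeffs [-1] (expUpperCoeffs 1 12)))))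
    (by decide +kernel) h0.le hw
  rw [evalCoeffs_addCoeffs, evalCoeffs_smulCoeffs, evalCoeffs_mulCoeffs, evalCoeffs_addCoeffs]
    at hm
  push_cast at hU
  rw [one_mul] at hU
  have h2 := mul_le_mul_of_nonneg_left (sub_le_sub_right hU 1) hk
  rw [le_div_iff₀ hE]
  have h3 : (1 / u - 1 / 2 + u / 12 - u ^ 3 / 720) * (exp u - 1) =
      (evalCoeffs [1, -1 / 2, 1 / 12, 0, -1 / 720] u * (exp u - 1)) / u := by
    simp only [evalCoeffs]
    push_cast
    field_simp
    ring
  rw [h3, div_le_one h0]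
  simp only [evalCoeffs] at hm h2 ⊢
  push_cast at hm h2 ⊢
  linarith

/-- One quarter of the Fourier transform, on `[0, 1]`, of the rescaled Selberg minorant. -/
noncomputable def minorantHat (x : ℝ) : ℝ :=
  (1 - x) * (cos (π * x) + cos (3 * π * x)) / 2 + sin (5 * π * x) / (4 * π)

/-- The smooth factor multiplying `exp (-μ L x) / x` in the integral formula, `L = 2 log 2`. -/
noncomputable def weight (x : ℝ) : ℝ :=
  2 * log 2 * x * exp (-(2 * log 2 * x) / 4) / (1 - exp (-(2 * log 2 * x))) * minorantHat x

/-- Coefficients of a polynomial approximating `minorantHat` on `[0, 1]`. -/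
def minorantHatCoeffs : List ℚ :=
  addCoeffs (mulCoeffs [1 / 2, -1 / 2] (addCoeffs (cosCoeffs (3927 / 1250) 5)
    (cosCoeffs (11781 / 1250) 13))) (smulCoeffs (625 / 7854) (sinCoeffs (3927 / 250) 21))

/-- Coefficients of a polynomial approximating `weight` on `[0, 1]`. -/
def weightCoeffs : List ℚ :=
  mulCoeffs [1, 13863 / 40000, -(13863 / 10000) ^ 2 / 96, -(13863 / 10000) ^ 3 / 128]
    minorantHatCoeffs

theorem pi_approx_bounds : 3927 / 1250 - 1 / 100000 ≤ π ∧ π ≤ 3927 / 1250 := by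
  constructor
  · have := pi_gt_d6; norm_num at this ⊢; linarith
  · have := pi_lt_d4; norm_num at this ⊢; linarith

theorem abs_cos_sub_coeffs_le {a : ℝ} {c : ℚ} {e : ℝ} (n : ℕ) (hc : 0 ≤ c) (he : |a - c| ≤ e)
    {x : ℝ} (hx : 0 ≤ x) : |cos (a * x) - evalCoeffs (cosCoeffs c n) x| ≤
      e * x + (c * x) ^ (2 * n) / ((2 * n).factorial : ℝ) := by
  have hc' : (0 : ℝ) ≤ c := by exact_mod_cast hc
  have h1 := (abs_cos_sin_sub_taylor_le n (c * x) (by positivity)).1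
  rw [← evalCoeffs_cosCoeffs] at h1
  have h2 := abs_cos_sub_cos_le (a * x) (c * x)
  rw [← sub_mul, abs_mul, abs_of_nonneg hx] at h2
  have h3 := mul_le_mul_of_nonneg_right he hx
  have h4 := abs_sub_le (cos (a * x)) (cos (c * x)) (evalCoeffs (cosCoeffs c n) x)
  linarith

theorem abs_sin_sub_coeffs_le {a : ℝ} {c : ℚ} {e : ℝ} (n : ℕ) (hc : 0 ≤ c) (he : |a - c| ≤ e)
    {x : ℝ} (hx : 0 ≤ x) : |sin (a * x) - evalCoeffs (sinCoeffs c n) x| ≤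
      e * x + (c * x) ^ (2 * n + 1) / ((2 * n + 1).factorial : ℝ) := by
  have hc' : (0 : ℝ) ≤ c := by exact_mod_cast hc
  have h1 := (abs_cos_sin_sub_taylor_le n (c * x) (by positivity)).2
  rw [← evalCoeffs_sinCoeffs] at h1
  have h2 := abs_sin_sub_sin_le (a * x) (c * x)
  rw [← sub_mul, abs_mul, abs_of_nonneg hx] at h2
  have h3 := mul_le_mul_of_nonneg_right he hx
  have h4 := abs_sub_le (sin (a * x)) (sin (c * x)) (evalCoeffs (sinCoeffs c n) x)
  linarith

theorem abs_minorantHat_sub_le {x : ℝ} (h0 : 0 ≤ x) (h1 : x ≤ 1) :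
    |minorantHat x - evalCoeffs minorantHatCoeffs x| ≤
      x * (4 / 100000 + 13 / 1000 * x ^ 9 * (1 - x) + 27 / 1000 * x ^ 25 * (1 - x) +
        9 / 2500 * x ^ 42) := by
  obtain ⟨hp1, hp2⟩ := pi_approx_bounds
  have hc1 := abs_cos_sub_coeffs_le (a := π) (c := 3927 / 1250) (e := 1 / 100000) 5 (by norm_num)
    (by push_cast; rw [abs_le]; constructor <;> linarith) h0
  have hc2 := abs_cos_sub_coeffs_le (a := 3 * π) (c := 11781 / 1250) (e := 3 / 100000) 13
    (by norm_num) (by push_cast; rw [abs_le]; constructor <;> linarith) h0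
  have hs := abs_sin_sub_coeffs_le (a := 5 * π) (c := 3927 / 250) (e := 5 / 100000) 21
    (by norm_num) (by push_cast; rw [abs_le]; constructor <;> linarith) h0
  have hsin : |sin (5 * π * x)| ≤ 5 * π * x := by
    have := abs_sin_le_abs (x := 5 * π * x)
    rwa [abs_of_nonneg (a := 5 * π * x) (by positivity)] at this
  have ex : minorantHat x - evalCoeffs minorantHatCoeffs x =
      (1 - x) / 2 * (cos (π * x) - evalCoeffs (cosCoeffs (3927 / 1250) 5) x) +
      (1 - x) / 2 * (cos (3 * π * x) - evalCoeffs (cosCoeffs (11781 / 1250) 13) x) +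
      (625 / 7854) * (sin (5 * π * x) - evalCoeffs (sinCoeffs (3927 / 250) 21) x) +
      (1 / (4 * π) - 625 / 7854) * sin (5 * π * x) := by
    rw [minorantHat, minorantHatCoeffs, evalCoeffs_addCoeffs, evalCoeffs_mulCoeffs,
      evalCoeffs_addCoeffs, evalCoeffs_smulCoeffs]
    simp only [evalCoeffs]
    push_cast
    ring
  rw [ex]
  set C1 := cos (π * x) - evalCoeffs (cosCoeffs (3927 / 1250) 5) x
  set C2 := cos (3 * π * x) - evalCoeffs (cosCoeffs (11781 / 1250) 13) x
  set S := sin (5 * π * x) - evalCoeffs (sinCoeffs (3927 / 250) 21) x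
  have b1 : |C1| ≤ 1 / 100000 * x + 26 / 1000 * x ^ 10 := by
    refine hc1.trans ?_
    rw [mul_pow]
    have : ((3927 / 1250 : ℚ) : ℝ) ^ (2 * 5) / ((2 * 5).factorial : ℝ) ≤ 26 / 1000 := by
      norm_num [Nat.factorial]
    have h := mul_le_mul_of_nonneg_right this (show 0 ≤ x ^ 10 by positivity)
    have e : ((3927 / 1250 : ℚ) : ℝ) ^ (2 * 5) * x ^ (2 * 5) / ((2 * 5).factorial : ℝ) =
      ((3927 / 1250 : ℚ) : ℝ) ^ (2 * 5) / ((2 * 5).factorial : ℝ) * x ^ 10 := by ring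
    rw [e]
    linarith
  have b2 : |C2| ≤ 3 / 100000 * x + 54 / 1000 * x ^ 26 := by
    refine hc2.trans ?_
    rw [mul_pow]
    have : ((11781 / 1250 : ℚ) : ℝ) ^ (2 * 13) / ((2 * 13).factorial : ℝ) ≤ 54 / 1000 := by
      norm_num [Nat.factorial]
    have h := mul_le_mul_of_nonneg_right this (show 0 ≤ x ^ 26 by positivity)
    have e : ((11781 / 1250 : ℚ) : ℝ) ^ (2 * 13) * x ^ (2 * 13) / ((2 * 13).factorial : ℝ) =
      ((11781 / 1250 : ℚ) : ℝ) ^ (2 * 13) / ((2 * 13).factorial : ℝ) * x ^ 26 := by ring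
    rw [e]
    linarith
  have b3 : |S| ≤ 5 / 100000 * x + 452 / 10000 * x ^ 43 := by
    refine hs.trans ?_
    rw [mul_pow]
    have : ((3927 / 250 : ℚ) : ℝ) ^ (2 * 21 + 1) / ((2 * 21 + 1).factorial : ℝ) ≤
        452 / 10000 := by
      norm_num [Nat.factorial]
    have h := mul_le_mul_of_nonneg_right this (show 0 ≤ x ^ 43 by positivity)
    have e : ((3927 / 250 : ℚ) : ℝ) ^ (2 * 21 + 1) * x ^ (2 * 21 + 1) /
        ((2 * 21 + 1).factorial : ℝ) =
      ((3927 / 250 : ℚ) : ℝ) ^ (2 * 21 + 1) / ((2 * 21 + 1).factorial : ℝ) * x ^ 43 := by ring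
    rw [e]
    linarith
  have b4 : |(1 / (4 * π) - 625 / 7854) * sin (5 * π * x)| ≤ 13 / 1000000 * x := by
    have hpi := pi_pos
    have hnn : 0 ≤ 1 / (4 * π) - 625 / 7854 := by
      rw [sub_nonneg, div_le_div_iff₀ (by norm_num) (by positivity)]
      linarith
    have e : (1 / (4 * π) - 625 / 7854) * (5 * π * x) = (5 / 4 - 3125 / 7854 * π) * x := by
      field_simp
      ring
    rw [abs_mul, abs_of_nonneg hnn]
    refine (mul_le_mul_of_nonneg_left hsin hnn).trans ?_
    rw [e]
    gcongr
    linarith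
  have hx1 : 0 ≤ (1 - x) / 2 := by linarith
  have t1 : |(1 - x) / 2 * C1| ≤ (1 - x) / 2 * (1 / 100000 * x + 26 / 1000 * x ^ 10) := by
    rw [abs_mul, abs_of_nonneg hx1]
    gcongr
  have t2 : |(1 - x) / 2 * C2| ≤ (1 - x) / 2 * (3 / 100000 * x + 54 / 1000 * x ^ 26) := by
    rw [abs_mul, abs_of_nonneg hx1]
    gcongr
  have t3 : |625 / 7854 * S| ≤ 625 / 7854 * (5 / 100000 * x + 452 / 10000 * x ^ 43) := by
    rw [abs_mul, abs_of_nonneg (by norm_num)]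
    gcongr
  have tot := abs_add_le ((1 - x) / 2 * C1 + (1 - x) / 2 * C2 + 625 / 7854 * S)
    ((1 / (4 * π) - 625 / 7854) * sin (5 * π * x))
  have tot2 := abs_add_le ((1 - x) / 2 * C1 + (1 - x) / 2 * C2) (625 / 7854 * S)
  have tot3 := abs_add_le ((1 - x) / 2 * C1) ((1 - x) / 2 * C2)
  have hx43 : 0 ≤ x ^ 43 := by positivity
  nlinarith [mul_nonneg h0 h0]

theorem abs_minorantHat_le {x : ℝ} (h0 : 0 ≤ x) (h1 : x ≤ 1) : |minorantHat x| ≤ 11 / 10 := by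
  have hp := pi_gt_three
  have a1 := abs_le.1 (abs_cos_le_one (π * x))
  have a2 := abs_le.1 (abs_cos_le_one (3 * π * x))
  have a3 : |sin (5 * π * x) / (4 * π)| ≤ 1 / 10 := by
    rw [abs_div, abs_of_pos (show 0 < 4 * π by positivity), div_le_iff₀ (by positivity)]
    have := abs_sin_le_one (5 * π * x)
    linarith
  have a4 : |(1 - x) * (cos (π * x) + cos (3 * π * x)) / 2| ≤ 1 := by
    rw [abs_le]; constructor <;> nlinarith
  have := abs_add_le ((1 - x) * (cos (π * x) + cos (3 * π * x)) / 2) (sin (5 * π * x) / (4 * π))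
  rw [minorantHat]
  linarith

/-- Coefficients of a bound for the approximation error of `weight`, divided by `x`. -/
def errorCoeffs : List ℚ :=
  addCoeffs [1 / 10000, 0, 0, 49 / 20000] (mulCoeffs [1, -1]
    (seriesCoeffs (fun j => if j = 9 then 22 / 1250 else if j = 25 then 73 / 2000 else 0) 0 26)
    |> addCoeffs (seriesCoeffs (fun j => if j = 42 then 49 / 10000 else 0) 0 43))

theorem evalCoeffs_errorCoeffs (x : ℝ) : evalCoeffs errorCoeffs x = 1 / 10000 + 49 / 20000 * x ^ 3 +
    22 / 1250 * x ^ 9 * (1 - x) + 73 / 2000 * x ^ 25 * (1 - x) + 49 / 10000 * x ^ 42 := by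
  rw [errorCoeffs, evalCoeffs_addCoeffs, evalCoeffs_addCoeffs, evalCoeffs_mulCoeffs]
  simp [evalCoeffs, seriesCoeffs]
  ring

theorem abs_weight_sub_le {x : ℝ} (h0 : 0 < x) (h1 : x ≤ 1) :
    |weight x - evalCoeffs weightCoeffs x| ≤ x * evalCoeffs errorCoeffs x := by
  have l1 := Real.log_two_gt_d9
  have l2 := Real.log_two_lt_d9
  set u := 2 * log 2 * x with hu
  have hu0 : 0 < u := by positivity
  have hk := abs_kernel_sub_le hu0 (by nlinarith)
  set K := u * exp (-u / 4) / (1 - exp (-u)) with hK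
  set k := evalCoeffs [1, 13863 / 40000, -(13863 / 10000) ^ 2 / 96, -(13863 / 10000) ^ 3 / 128] x
    with hk'
  have e : weight x - evalCoeffs weightCoeffs x =
      (K - k) * minorantHat x + k * (minorantHat x - evalCoeffs minorantHatCoeffs x) := by
    rw [weight, weightCoeffs, evalCoeffs_mulCoeffs]
    ring
  have hkk : k = evalCoeffs kernelCoeffs (13863 / 10000 * x) := by
    simp only [hk', kernelCoeffs, evalCoeffs]
    push_cast
    ring
  set v := 13863 / 10000 * x with hv
  have hv0 : 0 < v := by positivity
  have hv1 : v ≤ 13863 / 10000 := by linarith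
  have huv : u ≤ v := by rw [hu, hv]; gcongr; linarith
  have huv2 : v - u ≤ 6 / 1000000 * x := by
    rw [hu, hv, ← sub_mul]; gcongr; linarith
  have hdk : |evalCoeffs kernelCoeffs u - k| ≤ 6 / 1000000 * x := by
    rw [hkk]
    simp only [kernelCoeffs, evalCoeffs]
    push_cast
    have e2 : 1 + u * (1 / 4 + u * (-1 / 96 + u * (-1 / 128 + u * 0))) -
        (1 + v * (1 / 4 + v * (-1 / 96 + v * (-1 / 128 + v * 0)))) =
        -((v - u) * (1 / 4 - (u + v) / 96 - (u ^ 2 + u * v + v ^ 2) / 128)) := by ring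
    rw [e2, abs_neg, abs_mul, abs_of_nonneg (sub_nonneg.2 huv)]
    have : |1 / 4 - (u + v) / 96 - (u ^ 2 + u * v + v ^ 2) / 128| ≤ 1 := by
      rw [abs_le]; constructor <;> nlinarith
    nlinarith [sub_nonneg.2 huv]
  have hkb : |k| ≤ 1347 / 1000 := by
    rw [hkk]
    simp only [kernelCoeffs, evalCoeffs]
    push_cast
    have : 0 ≤ v ^ 2 := by positivity
    have : 0 ≤ v ^ 3 := by positivity
    have : v ^ 2 ≤ 2 := by nlinarith
    have : v ^ 3 ≤ 3 := by nlinarith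
    rw [abs_le]; constructor <;> nlinarith
  have hu4 : u ^ 4 ≤ 3694 / 1000 * x ^ 4 := by
    calc u ^ 4 ≤ v ^ 4 := by gcongr
      _ = (13863 / 10000) ^ 4 * x ^ 4 := by rw [hv]; ring
      _ ≤ _ := by gcongr; norm_num
  have hKk : |K - k| ≤ 2217 / 1000000 * x ^ 4 + 6 / 1000000 * x := by
    have := abs_sub_le K (evalCoeffs kernelCoeffs u) k
    have : 0 ≤ x ^ 4 := by positivity
    linarith
  have hs := abs_minorantHat_le h0.le h1
  have hsd := abs_minorantHat_sub_le h0.le h1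
  have p1 : |(K - k) * minorantHat x| ≤
      (2217 / 1000000 * x ^ 4 + 6 / 1000000 * x) * (11 / 10) := by
    rw [abs_mul]; gcongr
  have p2 : |k * (minorantHat x - evalCoeffs minorantHatCoeffs x)| ≤ 1347 / 1000 *
      (x * (4 / 100000 + 13 / 1000 * x ^ 9 * (1 - x) + 27 / 1000 * x ^ 25 * (1 - x) +
        9 / 2500 * x ^ 42)) := by
    rw [abs_mul]; gcongr
  have p3 := abs_add_le ((K - k) * minorantHat x)
    (k * (minorantHat x - evalCoeffs minorantHatCoeffs x))
  rw [e, evalCoeffs_errorCoeffs]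
  have n1 : 0 ≤ x ^ 10 * (1 - x) := by have : 0 ≤ 1 - x := by linarith
                                       positivity
  have n2 : 0 ≤ x ^ 26 * (1 - x) := by have : 0 ≤ 1 - x := by linarith
                                       positivity
  have n3 : 0 ≤ x ^ 43 := by positivity
  have n4 : 0 ≤ x ^ 4 := by positivity
  nlinarith

theorem abs_weightCoeffs_le {x : ℝ} (h0 : 0 ≤ x) (h1 : x ≤ 1) :
    |evalCoeffs weightCoeffs x| ≤ 2 := by
  have hs := abs_minorantHat_le h0 h1
  have hsd := abs_minorantHat_sub_le h0 h1
  have e : evalCoeffs weightCoeffs x = (1 + x * (13863 / 40000 + x * (-(13863 / 10000) ^ 2 / 96 +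
      x * (-(13863 / 10000) ^ 3 / 128)))) * evalCoeffs minorantHatCoeffs x := by
    rw [weightCoeffs, evalCoeffs_mulCoeffs]
    simp only [evalCoeffs]
    push_cast
    ring
  have a1 : |1 + x * (13863 / 40000 + x * (-(13863 / 10000) ^ 2 / 96 +
      x * (-(13863 / 10000) ^ 3 / 128)))| ≤ 3 / 2 := by
    have : x ^ 2 ≤ 1 := pow_le_one₀ h0 h1
    have : x ^ 3 ≤ 1 := pow_le_one₀ h0 h1
    have : 0 ≤ x ^ 2 := by positivity
    have : 0 ≤ x ^ 3 := by positivity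
    rw [abs_le]; constructor <;> nlinarith
  have a2 : |evalCoeffs minorantHatCoeffs x| ≤ 4 / 3 := by
    have h := abs_sub_abs_le_abs_sub (evalCoeffs minorantHatCoeffs x) (minorantHat x)
    rw [abs_sub_comm] at h
    have q1 : x ^ 9 ≤ 1 := pow_le_one₀ h0 h1
    have q2 : x ^ 25 ≤ 1 := pow_le_one₀ h0 h1
    have q3 : x ^ 42 ≤ 1 := pow_le_one₀ h0 h1
    have q4 : x ^ 9 * (1 - x) ≤ 1 := mul_le_one₀ q1 (by linarith) (by linarith)
    have q5 : x ^ 25 * (1 - x) ≤ 1 := mul_le_one₀ q2 (by linarith) (by linarith)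
    have q6 : x * (4 / 100000 + 13 / 1000 * x ^ 9 * (1 - x) + 27 / 1000 * x ^ 25 * (1 - x) +
        9 / 2500 * x ^ 42) ≤ 1 * (1 / 10) := by
      have : 0 ≤ 1 - x := by linarith
      refine mul_le_mul h1 ?_ (by positivity) zero_le_one
      linarith
    linarith
  rw [e, abs_mul]
  calc _ ≤ (3 / 2 : ℝ) * (4 / 3) := by gcongr
    _ = 2 := by norm_num

theorem evalCoeffs_weightCoeffs (x : ℝ) :
    evalCoeffs weightCoeffs x = 1 + x * evalCoeffs weightCoeffs.tail x := by
  have h : weightCoeffs = 1 :: weightCoeffs.tail := by decide +kernel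
  conv_lhs => rw [h]
  simp [evalCoeffs]

theorem measurable_weight : Measurable weight := by
  have : Measurable minorantHat := by unfold minorantHat; fun_prop
  unfold weight
  fun_prop

theorem exists_abs_weight_sub_one_le :
    ∃ C : ℝ, 0 ≤ C ∧ ∀ x : ℝ, 0 < x → x ≤ 1 → |weight x - 1| ≤ C * x := by
  obtain ⟨C, hC⟩ := isCompact_Icc.exists_bound_of_continuousOn (s := Set.Icc (0 : ℝ) 1)
    (f := fun x => |evalCoeffs weightCoeffs.tail x| + |evalCoeffs errorCoeffs x|)
    (by have h1 := continuous_evalCoeffs weightCoeffs.tail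
        have h2 := continuous_evalCoeffs errorCoeffs
        fun_prop)
  refine ⟨C, ?_, fun x h0 h1 => ?_⟩
  · exact (norm_nonneg _).trans (hC 0 ⟨le_rfl, zero_le_one⟩)
  · have h := hC x ⟨h0.le, h1⟩
    rw [Real.norm_of_nonneg (by positivity)] at h
    have h2 := abs_weight_sub_le h0 h1
    rw [evalCoeffs_weightCoeffs] at h2
    have h3 := abs_add_le (weight x - (1 + x * evalCoeffs weightCoeffs.tail x))
      (x * evalCoeffs weightCoeffs.tail x)
    rw [abs_mul, abs_of_pos h0] at h3
    have h4 : weight x - (1 + x * evalCoeffs weightCoeffs.tail x) +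
      x * evalCoeffs weightCoeffs.tail x = weight x - 1 := by ring
    rw [h4] at h3
    have h5 := mul_le_mul_of_nonneg_left h h0.le
    have h6 := mul_le_mul_of_nonneg_left (le_abs_self (evalCoeffs errorCoeffs x)) h0.le
    linarith

theorem abs_one_sub_cos_le (u : ℝ) : |1 - cos u| ≤ |u| := by
  have := abs_cos_sub_cos_le 0 u
  simpa using this

theorem intervalIntegrable_one_sub_cos_mul_weight (Y : ℝ) :
    IntervalIntegrable (fun x => (1 - cos (Y * x) * weight x) / x) volume 0 1 := by
  obtain ⟨C, hC0, hC⟩ := exists_abs_weight_sub_one_le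
  have hm := measurable_weight
  have hm' : Measurable fun x => (1 - cos (Y * x) * weight x) / x :=
    Measurable.div (by fun_prop) measurable_id
  refine (intervalIntegrable_const (c := C + |Y|)).mono_fun hm'.aestronglyMeasurable ?_
  rw [Filter.EventuallyLE, ae_restrict_iff' measurableSet_uIoc]
  refine Filter.Eventually.of_forall fun x hx => ?_
  rw [Set.uIoc_of_le zero_le_one] at hx
  obtain ⟨h0, h1⟩ := hx
  rw [norm_div, Real.norm_of_nonneg h0.le, div_le_iff₀ h0, Real.norm_eq_abs,
    Real.norm_of_nonneg (by positivity)]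
  have h2 := abs_one_sub_cos_le (Y * x)
  rw [abs_mul, abs_of_pos h0] at h2
  have h3 : 1 - cos (Y * x) * weight x = (1 - cos (Y * x)) - cos (Y * x) * (weight x - 1) := by
    ring
  have h4 : |cos (Y * x) * (weight x - 1)| ≤ 1 * (C * x) := by
    rw [abs_mul]
    exact mul_le_mul (abs_cos_le_one _) (hC x h0 h1) (abs_nonneg _) zero_le_one
  rw [h3]
  have := abs_sub (1 - cos (Y * x)) (cos (Y * x) * (weight x - 1))
  linarith

theorem one_sub_cos_mul_weight_ge (Y : ℝ) {x : ℝ} (h0 : 0 < x) (h1 : x ≤ 1) :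
    (1 - cos (Y * x) * evalCoeffs weightCoeffs x) / x - evalCoeffs errorCoeffs x ≤
      (1 - cos (Y * x) * weight x) / x := by
  have h2 := abs_weight_sub_le h0 h1
  have h4 : |cos (Y * x) * (weight x - evalCoeffs weightCoeffs x)| ≤
      1 * (x * evalCoeffs errorCoeffs x) := by
    rw [abs_mul]
    exact mul_le_mul (abs_cos_le_one _) h2 (abs_nonneg _) zero_le_one
  have h5 := (abs_le.1 h4).2
  rw [sub_le_iff_le_add, div_add' _ _ _ h0.ne', div_le_div_iff_of_pos_right h0]
  linarith

/-- Coefficients in `Y ^ 2` of a lower bound for `∫ x in 0..1, (1 - cos (Y x) * weight x) / x`. -/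
def cosineIntegralCoeffs : List ℚ :=
  addCoeffs [-momentCoeffs 1 1 weightCoeffs.tail - momentCoeffs 1 1 errorCoeffs]
    (addCoeffs (0 :: seriesCoeffs (fun j => (-1) ^ j / ((2 * j + 2).factorial : ℚ) *
        momentCoeffs 1 (2 * j + 2) weightCoeffs) 0 16)
      (seriesCoeffs (fun j => if j = 17 then -2 / (34 * (34).factorial) else 0) 0 18))

/-- Lower bound for a polynomial certified on consecutive cells of width `w`. -/
theorem le_evalCoeffs_of_cells {c w : ℚ} {n : ℕ} {l : List ℚ} (hw : 0 < w)
    (h : (List.range n).all (fun k : ℕ => decide (c ≤ lowerCoeffs w (shiftCoeffs (w * k) l))) = true)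
    {x : ℝ} (h0 : 0 ≤ x) (h1 : x < w * n) : (c : ℝ) ≤ evalCoeffs l x := by
  have hw' : (0 : ℝ) < w := by exact_mod_cast hw
  have hf := Nat.floor_le (a := x / w) (by positivity)
  have hf2 := Nat.lt_floor_add_one (x / w)
  rw [le_div_iff₀ hw'] at hf
  rw [div_lt_iff₀ hw'] at hf2
  have hk : ⌊x / w⌋₊ < n := by
    rw [Nat.floor_lt (by positivity), div_lt_iff₀ hw']
    linarith
  rw [List.all_eq_true] at h
  have h2 := of_decide_eq_true (h _ (List.mem_range.2 hk))
  refine (Rat.cast_le.2 h2).trans (lowerCoeffs_shiftCoeffs_le _ _ _ ?_ ?_)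
  · push_cast; linarith
  · push_cast; linarith

theorem evalCoeffs_cosineIntegralCoeffs_ge {z : ℝ} (h0 : 0 ≤ z) (h1 : z ≤ 169) :
    20491 / 10000 ≤ evalCoeffs cosineIntegralCoeffs z := by
  have := le_evalCoeffs_of_cells (c := 20491 / 10000) (w := 16) (n := 11)
    (l := cosineIntegralCoeffs) (by norm_num) (by decide +kernel) h0 (by push_cast; linarith)
  push_cast at this
  exact this

theorem evalCoeffs_cosineIntegralCoeffs_le (Y : ℝ) :
    evalCoeffs cosineIntegralCoeffs (Y ^ 2) ≤ ∫ x in (0 : ℝ)..1, (1 - cos (Y * x) * weight x) / x := by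
  have c1 := continuous_evalCoeffs weightCoeffs.tail
  have c2 := continuous_evalCoeffs errorCoeffs
  have c3 := continuous_evalCoeffs weightCoeffs
  have e : ∫ x in (0 : ℝ)..1, (-(x ^ 0 * evalCoeffs weightCoeffs.tail x)
      - x ^ 0 * evalCoeffs errorCoeffs x + ∑ j ∈ Finset.range 16, ((-1) ^ j * Y ^ (2 * j + 2) /
        ((2 * j + 2).factorial : ℝ)) * (x ^ (2 * j + 1) * evalCoeffs weightCoeffs x) -
      2 * Y ^ 34 / ((34).factorial : ℝ) * x ^ 33) = evalCoeffs cosineIntegralCoeffs (Y ^ 2) := by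
    rw [intervalIntegral.integral_sub (Continuous.intervalIntegrable (by fun_prop) _ _)
      (Continuous.intervalIntegrable (by fun_prop) _ _),
      intervalIntegral.integral_add (Continuous.intervalIntegrable (by fun_prop) _ _)
      (Continuous.intervalIntegrable (by fun_prop) _ _),
      intervalIntegral.integral_sub (Continuous.intervalIntegrable (by fun_prop) _ _)
      (Continuous.intervalIntegrable (by fun_prop) _ _), intervalIntegral.integral_neg,
      intervalIntegral.integral_finsetSum
        fun j _ => (Continuous.intervalIntegrable (by fun_prop) _ _)]
    simp only [intervalIntegral.integral_const_mul]
    have m1 : ∀ (k : ℕ) (l : List ℚ), ∫ x in (0 : ℝ)..1, x ^ k * evalCoeffs l x =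
        momentCoeffs 1 (k + 1) l := by
      intro k l
      have := integral_pow_mul_evalCoeffs 1 k l
      push_cast at this
      exact this
    simp only [m1, integral_pow]
    rw [cosineIntegralCoeffs, evalCoeffs_addCoeffs, evalCoeffs_addCoeffs,
      evalCoeffs_seriesCoeffs]
    have t : ∀ (a : ℚ) (l : List ℚ) (x : ℝ), evalCoeffs (a :: l) x = a + x * evalCoeffs l x :=
      fun _ _ _ => rfl
    have t0 : ∀ x : ℝ, evalCoeffs [] x = 0 := fun _ => rfl
    have w : ∑ j ∈ Finset.range 18, ((if 0 + j = 17 then -2 / (34 * (34).factorial) else 0 : ℚ) : ℝ)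
        * (Y ^ 2) ^ j = -2 / (34 * (34).factorial) * (Y ^ 2) ^ 17 := by
      rw [Finset.sum_eq_single 17 (by intro j _ hj; simp [hj]) (by simp)]
      push_cast
      simp
    rw [t, t, t0, evalCoeffs_seriesCoeffs, Finset.mul_sum, w]
    have s : ∀ j ∈ Finset.range 16, (-1) ^ j * Y ^ (2 * j + 2) / ((2 * j + 2).factorial : ℝ) *
        (momentCoeffs 1 (2 * j + 1 + 1) weightCoeffs : ℝ) = Y ^ 2 * ((((-1) ^ (0 + j) /
        ((2 * (0 + j) + 2).factorial : ℚ) * momentCoeffs 1 (2 * (0 + j) + 2) weightCoeffs : ℚ) : ℝ)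
          * (Y ^ 2) ^ j) := by
      intro j _
      push_cast
      rw [zero_add, ← pow_mul]
      ring
    rw [Finset.sum_congr rfl s]
    push_cast
    simp
    ring
  rw [← e]
  refine intervalIntegral.integral_mono_on_of_le_Ioo zero_le_one
    (Continuous.intervalIntegrable (by fun_prop) _ _)
    (intervalIntegrable_one_sub_cos_mul_weight Y) fun x hx => ?_
  refine le_trans ?_ (one_sub_cos_mul_weight_ge Y hx.1 hx.2.le)
  have hx0 := hx.1
  have hQ := abs_weightCoeffs_le hx.1.le hx.2.le
  have hT := (abs_cos_sin_sub_taylor_le 17 (|Y * x|) (abs_nonneg _)).1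
  rw [cos_abs, Finset.sum_range_succ'] at hT
  set S := ∑ j ∈ Finset.range 16, (-1 : ℝ) ^ j * (Y * x) ^ (2 * j + 2) /
    ((2 * j + 2).factorial : ℝ) with hS
  have hS' : ∑ k ∈ Finset.range 16, (-1 : ℝ) ^ (k + 1) * |Y * x| ^ (2 * (k + 1)) /
      ((2 * (k + 1)).factorial : ℝ) = -S := by
    rw [hS, ← Finset.sum_neg_distrib]
    refine Finset.sum_congr rfl fun j _ => ?_
    rw [pow_mul |Y * x|, sq_abs, ← pow_mul, show 2 * (j + 1) = 2 * j + 2 by ring]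
    ring
  have hpow : |Y * x| ^ (2 * 17) = Y ^ 34 * x ^ 34 := by
    rw [pow_mul, sq_abs, ← pow_mul, mul_pow]
  rw [hS', hpow] at hT
  have hT' : |(1 - cos (Y * x)) - S| ≤ Y ^ 34 * x ^ 34 / ((34).factorial : ℝ) := by
    rw [← abs_neg]
    convert hT using 2
    simp
    ring
  set Q := evalCoeffs weightCoeffs x with hQd
  have hprod : |Q * ((1 - cos (Y * x)) - S)| ≤ 2 * (Y ^ 34 * x ^ 34 / ((34).factorial : ℝ)) := by
    rw [abs_mul]; gcongr
  have hp := (abs_le.1 hprod).1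
  have hsum : ∑ j ∈ Finset.range 16, ((-1) ^ j * Y ^ (2 * j + 2) /
        ((2 * j + 2).factorial : ℝ)) * (x ^ (2 * j + 1) * Q) = Q * S / x := by
    rw [hS, Finset.mul_sum, Finset.sum_div]
    refine Finset.sum_congr rfl fun j _ => ?_
    field_simp
    ring
  have htail : evalCoeffs weightCoeffs.tail x = (Q - 1) / x := by
    rw [hQd, evalCoeffs_weightCoeffs]; field_simp; ring
  rw [hsum, htail]
  have e33 : 2 * Y ^ 34 / ((34).factorial : ℝ) * x ^ 33 =
      2 * (Y ^ 34 * x ^ 34 / ((34).factorial : ℝ)) / x := by field_simp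
  rw [e33]
  have hfin : -((Q - 1) / x) + Q * S / x - 2 * (Y ^ 34 * x ^ 34 / ((34).factorial : ℝ)) / x ≤
      (1 - cos (Y * x) * Q) / x := by
    rw [← neg_div, ← add_div, ← sub_div, div_le_div_iff_of_pos_right hx0]
    linarith
  simp only [pow_zero, one_mul]
  linarith

theorem sin_half_mul_sinc_half {u : ℝ} (hu : u ≠ 0) :
    sin (u / 2) * sinc (u / 2) = (1 - cos u) / u := by
  rw [sinc_of_ne_zero (by positivity)]
  have := Real.cos_two_mul (u / 2)
  rw [show 2 * (u / 2) = u by ring] at this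
  have h2 := Real.sin_sq_add_cos_sq (u / 2)
  field_simp
  nlinarith

theorem integral_one_sub_cos_div_ge {Y : ℝ} (hY : 13 ≤ Y) :
    4 / 5 ≤ ∫ x in (0 : ℝ)..3 / 20, Y * (sin (Y * x / 2) * sinc (Y * x / 2)) := by
  have hc : Continuous fun u : ℝ => sin (u / 2) * sinc (u / 2) :=
    (continuous_sin.comp (by fun_prop)).mul (continuous_sinc.comp (by fun_prop))
  rw [intervalIntegral.integral_const_mul,
    intervalIntegral.mul_integral_comp_mul_left (f := fun u : ℝ => sin (u / 2) * sinc (u / 2)),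
    mul_zero]
  have hnn : ∀ u : ℝ, 0 ≤ u → 0 ≤ sin (u / 2) * sinc (u / 2) := by
    intro u hu
    rcases hu.eq_or_lt with rfl | h
    · simp
    · rw [sin_half_mul_sinc_half h.ne']
      exact div_nonneg (by linarith [cos_le_one u]) hu
  have h1 : ∫ u in (0 : ℝ)..39 / 20, sin (u / 2) * sinc (u / 2) ≤
      ∫ u in (0 : ℝ)..Y * (3 / 20), sin (u / 2) * sinc (u / 2) := by
    refine intervalIntegral.integral_mono_interval le_rfl (by norm_num) (by linarith) ?_
      (hc.intervalIntegrable _ _)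
    rw [Filter.EventuallyLE, ae_restrict_iff' measurableSet_Ioc]
    exact Filter.Eventually.of_forall fun u hu => hnn u hu.1.le
  refine le_trans ?_ h1
  have h2 : ∫ u in (0 : ℝ)..39 / 20, (u / 2 - u ^ 3 / 24) ≤
      ∫ u in (0 : ℝ)..39 / 20, sin (u / 2) * sinc (u / 2) := by
    refine intervalIntegral.integral_mono_on_of_le_Ioo (by norm_num)
      (Continuous.intervalIntegrable (by fun_prop) _ _) (hc.intervalIntegrable _ _) fun u hu => ?_
    rw [sin_half_mul_sinc_half hu.1.ne', le_div_iff₀ hu.1]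
    have := (abs_le.1 (abs_cos_sin_sub_taylor_le 2 u hu.1.le).1).2
    norm_num [Finset.sum_range_succ, Nat.factorial] at this
    linarith
  refine le_trans ?_ h2
  rw [intervalIntegral.integral_sub (Continuous.intervalIntegrable (by fun_prop) _ _)
      (Continuous.intervalIntegrable (by fun_prop) _ _), intervalIntegral.integral_div,
      intervalIntegral.integral_div, integral_id, integral_pow]
  norm_num

theorem log_five_gt : (8 / 5 : ℝ) < log 5 := by
  rw [Real.lt_log_iff_exp_lt (by norm_num)]
  have h := Real.exp_one_lt_d9
  have h5 : exp (8 / 5) ^ 5 < 5 ^ 5 := by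
    rw [← Real.exp_nat_mul, show ((5 : ℕ) : ℝ) * (8 / 5) = (8 : ℕ) * 1 by norm_num,
      Real.exp_nat_mul]
    calc exp 1 ^ 8 < 2.7182818286 ^ 8 := by gcongr
      _ < _ := by norm_num
  exact lt_of_pow_lt_pow_left₀ 5 (by norm_num) h5

theorem intervalIntegrable_inv_sub_inv_cube :
    IntervalIntegrable (fun x : ℝ => 1 / x - 1 / (104 * x ^ 3)) volume (1 / 5) 1 := by
  refine ContinuousOn.intervalIntegrable fun x hx => ContinuousAt.continuousWithinAt ?_
  rw [Set.uIcc_of_le (by norm_num)] at hx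
  have h0 : 0 < x := lt_of_lt_of_le (by norm_num) hx.1
  have h1 : 104 * x ^ 3 ≠ 0 := by positivity
  have h2 : x ≠ 0 := h0.ne'
  fun_prop (disch := assumption)

theorem integral_inv_sub_inv_cube :
    ∫ x in (1 / 5 : ℝ)..1, (1 / x - 1 / (104 * x ^ 3)) = log 5 - 12 / 104 := by
  have hd : ∀ x ∈ Set.uIcc (1 / 5 : ℝ) 1,
      HasDerivAt (fun x : ℝ => log x + 1 / 208 * (x ^ 2)⁻¹) (1 / x - 1 / (104 * x ^ 3)) x := by
    intro x hx
    rw [Set.uIcc_of_le (by norm_num)] at hx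
    have h0 : 0 < x := lt_of_lt_of_le (by norm_num) hx.1
    refine ((hasDerivAt_log h0.ne').add (((hasDerivAt_pow 2 x).inv (by positivity)).const_mul
      (1 / 208))).congr_deriv ?_
    push_cast
    field_simp
    ring
  rw [intervalIntegral.integral_eq_sub_of_hasDerivAt hd intervalIntegrable_inv_sub_inv_cube, log_one, Real.log_div one_ne_zero (by norm_num),
    log_one]
  norm_num
  ring

theorem weight_integral_ge_of_large {Y : ℝ} (hY : 13 ≤ Y) :
    20491 / 10000 ≤ ∫ x in (0 : ℝ)..1, (1 - cos (Y * x) * weight x) / x := by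
  have c1 := continuous_evalCoeffs weightCoeffs.tail
  have c2 := continuous_evalCoeffs errorCoeffs
  have c3 := continuous_evalCoeffs weightCoeffs
  have c5 : Continuous fun x : ℝ => x ^ 1 * evalCoeffs (mulCoeffs weightCoeffs weightCoeffs) x := by
    have := continuous_evalCoeffs (mulCoeffs weightCoeffs weightCoeffs)
    fun_prop
  have hi := intervalIntegrable_inv_sub_inv_cube
  have c4 : Continuous fun x : ℝ => sin (Y * x / 2) * sinc (Y * x / 2) :=
    (continuous_sin.comp (by fun_prop)).mul (continuous_sinc.comp (by fun_prop))
  set H : ℝ → ℝ := fun x => -(x ^ 0 * evalCoeffs weightCoeffs.tail x) +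
    evalCoeffs weightCoeffs x * (Y * (sin (Y * x / 2) * sinc (Y * x / 2))) with hH
  have cH : Continuous H := by fun_prop
  have hHeq : ∀ x : ℝ, 0 < x → H x = (1 - cos (Y * x) * evalCoeffs weightCoeffs x) / x := by
    intro x hx
    simp only [hH]
    rw [sin_half_mul_sinc_half (by positivity), evalCoeffs_weightCoeffs]
    field_simp
    ring
  have hE : ∫ x in (0 : ℝ)..1, x ^ 0 * evalCoeffs errorCoeffs x ≤ 11 / 10000 := by
    have h := integral_pow_mul_evalCoeffs 1 0 errorCoeffs
    push_cast at h
    rw [h]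
    have : momentCoeffs 1 (0 + 1) errorCoeffs ≤ 11 / 10000 := by decide +kernel
    have := (Rat.cast_le (K := ℝ)).2 this
    push_cast at this
    exact this
  have hmain : (∫ x in (0 : ℝ)..1, H x) - ∫ x in (0 : ℝ)..1, x ^ 0 * evalCoeffs errorCoeffs x ≤
      ∫ x in (0 : ℝ)..1, (1 - cos (Y * x) * weight x) / x := by
    rw [← intervalIntegral.integral_sub (cH.intervalIntegrable _ _)
      (Continuous.intervalIntegrable (by fun_prop) _ _)]
    refine intervalIntegral.integral_mono_on_of_le_Ioo zero_le_one
      (Continuous.intervalIntegrable (by fun_prop) _ _)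
      (intervalIntegrable_one_sub_cos_mul_weight Y) fun x hx => ?_
    rw [hHeq x hx.1, pow_zero, one_mul]
    exact one_sub_cos_mul_weight_ge Y hx.1 hx.2.le
  have k0 : ∀ x : ℝ, 0 < x → 0 ≤ Y * (sin (Y * x / 2) * sinc (Y * x / 2)) := by
    intro x hx
    rw [sin_half_mul_sinc_half (by positivity)]
    have := cos_le_one (Y * x)
    exact mul_nonneg (by linarith) (div_nonneg (by linarith) (by positivity))
  have i1 : (∫ x in (0 : ℝ)..3 / 20, (-(x ^ 0 * evalCoeffs weightCoeffs.tail x) +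
      1 / 2 * (Y * (sin (Y * x / 2) * sinc (Y * x / 2))))) ≤ ∫ x in (0 : ℝ)..3 / 20, H x := by
    refine intervalIntegral.integral_mono_on_of_le_Ioo (by norm_num)
      (Continuous.intervalIntegrable (by fun_prop) _ _) (cH.intervalIntegrable _ _) fun x hx => ?_
    have hq := le_evalCoeffs_of_cells (c := 1 / 2) (w := 1 / 40) (n := 6)
      (l := weightCoeffs) (by norm_num) (by decide +kernel) hx.1.le
      (by push_cast; linarith [hx.2])
    push_cast at hq
    have := mul_le_mul_of_nonneg_right hq (k0 x hx.1)
    simp only [hH]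
    linarith
  have i2 : (∫ x in (3 / 20 : ℝ)..1 / 5, -(x ^ 0 * evalCoeffs weightCoeffs.tail x)) ≤
      ∫ x in (3 / 20 : ℝ)..1 / 5, H x := by
    refine intervalIntegral.integral_mono_on_of_le_Ioo (by norm_num)
      (Continuous.intervalIntegrable (by fun_prop) _ _) (cH.intervalIntegrable _ _) fun x hx => ?_
    have hx0 : 0 < x := lt_trans (by norm_num) hx.1
    have hq : 0 ≤ evalCoeffs weightCoeffs x := by
      refine le_trans ?_ (lowerCoeffs_shiftCoeffs_le (3 / 20) (1 / 20) weightCoeffs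
        (by push_cast; exact hx.1.le) (by push_cast; linarith [hx.2]))
      have : 0 ≤ lowerCoeffs (1 / 20) (shiftCoeffs (3 / 20) weightCoeffs) := by decide +kernel
      exact_mod_cast this
    have := mul_nonneg hq (k0 x hx0)
    simp only [hH]
    linarith
  have i3 : (∫ x in (1 / 5 : ℝ)..1, ((1 / x - 1 / (104 * x ^ 3)) -
      26 * (x ^ 1 * evalCoeffs (mulCoeffs weightCoeffs weightCoeffs) x))) ≤
      ∫ x in (1 / 5 : ℝ)..1, H x := by
    refine intervalIntegral.integral_mono_on_of_le_Ioo (by norm_num)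
      (hi.sub (Continuous.intervalIntegrable (by fun_prop) _ _)) (cH.intervalIntegrable _ _)
      fun x hx => ?_
    have hx0 : 0 < x := lt_trans (by norm_num) hx.1
    rw [hHeq x hx0, evalCoeffs_mulCoeffs]
    set Q := evalCoeffs weightCoeffs x
    have h1 : cos (Y * x) * Q ≤ |Q| := by
      refine (le_abs_self _).trans ?_
      rw [abs_mul]
      exact mul_le_of_le_one_left (abs_nonneg _) (abs_cos_le_one _)
    have h2 : |Q| ≤ 26 * (Q * Q) * x ^ 2 + 1 / (104 * x ^ 2) := by
      have h3 : 0 ≤ 26 / x ^ 2 * (|Q| * x ^ 2 - 1 / 52) ^ 2 := by positivity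
      have h4 : 26 / x ^ 2 * (|Q| * x ^ 2 - 1 / 52) ^ 2 =
          26 * |Q| ^ 2 * x ^ 2 + 1 / (104 * x ^ 2) - |Q| := by
        field_simp
        ring
      rw [h4, sq_abs] at h3
      linarith
    have h5 : 1 / x - 1 / (104 * x ^ 3) - 26 * (x ^ 1 * (Q * Q)) =
        (1 - (26 * (Q * Q) * x ^ 2 + 1 / (104 * x ^ 2))) / x := by
      field_simp
      ring
    rw [h5, div_le_div_iff_of_pos_right hx0]
    linarith
  have j0 := intervalIntegral.integral_add_adjacent_intervals
    (cH.intervalIntegrable (μ := volume) 0 (1 / 5)) (cH.intervalIntegrable (1 / 5) 1)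
  have j1 := intervalIntegral.integral_add_adjacent_intervals
    (cH.intervalIntegrable (μ := volume) 0 (3 / 20)) (cH.intervalIntegrable (3 / 20) (1 / 5))
  have cR : Continuous fun x : ℝ => -(x ^ 0 * evalCoeffs weightCoeffs.tail x) := by fun_prop
  have j2 := intervalIntegral.integral_add_adjacent_intervals
    (cR.intervalIntegrable (μ := volume) 0 (3 / 20)) (cR.intervalIntegrable (3 / 20) (1 / 5))
  rw [intervalIntegral.integral_add (cR.intervalIntegrable _ _)
    (Continuous.intervalIntegrable (by fun_prop) _ _), intervalIntegral.integral_const_mul] at i1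
  have hk := integral_one_sub_cos_div_ge hY
  have hR : 379 / 1000 ≤ ∫ x in (0 : ℝ)..1 / 5, -(x ^ 0 * evalCoeffs weightCoeffs.tail x) := by
    have h := integral_pow_mul_evalCoeffs (1 / 5) 0 weightCoeffs.tail
    push_cast at h
    rw [intervalIntegral.integral_neg, h]
    have : momentCoeffs (1 / 5) (0 + 1) weightCoeffs.tail ≤ -379 / 1000 := by decide +kernel
    have := (Rat.cast_le (K := ℝ)).2 this
    push_cast at this
    linarith
  have hQQ : ∫ x in (1 / 5 : ℝ)..1, x ^ 1 * evalCoeffs (mulCoeffs weightCoeffs weightCoeffs) x ≤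
      45 / 10000 := by
    have h := integral_pow_mul_evalCoeffs (1 / 5) 1 (mulCoeffs weightCoeffs weightCoeffs)
    have h1 := integral_pow_mul_evalCoeffs 1 1 (mulCoeffs weightCoeffs weightCoeffs)
    push_cast at h h1
    have j := intervalIntegral.integral_add_adjacent_intervals
      (c5.intervalIntegrable (μ := volume) 0 (1 / 5)) (c5.intervalIntegrable (1 / 5) 1)
    rw [h, h1] at j
    have : momentCoeffs 1 (1 + 1) (mulCoeffs weightCoeffs weightCoeffs) ≤ 45 / 10000 +
      momentCoeffs (1 / 5) (1 + 1) (mulCoeffs weightCoeffs weightCoeffs) := by decide +kernel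
    have := (Rat.cast_le (K := ℝ)).2 this
    push_cast at this
    linarith
  have i3' : log 5 - 12 / 104 - 26 * (45 / 10000) ≤ ∫ x in (1 / 5 : ℝ)..1, H x := by
    rw [intervalIntegral.integral_sub hi ((c5.const_mul 26).intervalIntegrable _ _),
      integral_inv_sub_inv_cube, intervalIntegral.integral_const_mul] at i3
    linarith
  have := log_five_gt
  linarith

theorem weight_integral_ge (Y : ℝ) :
    20491 / 10000 ≤ ∫ x in (0 : ℝ)..1, (1 - cos (Y * x) * weight x) / x := by
  have e : ∫ x in (0 : ℝ)..1, (1 - cos (Y * x) * weight x) / x =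
      ∫ x in (0 : ℝ)..1, (1 - cos (|Y| * x) * weight x) / x := by
    rcases abs_choice Y with h | h
    · rw [h]
    · rw [h]; simp only [neg_mul, cos_neg]
  rcases le_total |Y| 13 with h | h
  · refine le_trans ?_ (evalCoeffs_cosineIntegralCoeffs_le Y)
    refine evalCoeffs_cosineIntegralCoeffs_ge (sq_nonneg _) ?_
    rw [← sq_abs]
    nlinarith [abs_nonneg Y]
  · rw [e]
    exact weight_integral_ge_of_large h

theorem eulerMascheroniConstant_le_harmonic_sub_log (n : ℕ) :
    eulerMascheroniConstant ≤ harmonic n - log (n + 1 / 2) := by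
  have ht : Filter.Tendsto (fun n : ℕ => (harmonic n : ℝ) - log (n + 1 / 2)) Filter.atTop
      (nhds eulerMascheroniConstant) := by
    have h1 := Real.tendsto_harmonic_sub_log
    have h2 : Filter.Tendsto (fun n : ℕ => log (1 + 1 / 2 * (1 / (n : ℝ)))) Filter.atTop
        (nhds 0) := by
      have : Filter.Tendsto (fun n : ℕ => 1 + 1 / 2 * (1 / (n : ℝ))) Filter.atTop
          (nhds (1 + 1 / 2 * 0)) := (tendsto_one_div_atTop_nhds_zero_nat.const_mul _).const_add _
      have h3 := this.log (by norm_num)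
      simpa using h3
    have h3 := h1.sub h2
    rw [sub_zero] at h3
    refine h3.congr' ?_
    filter_upwards [Filter.eventually_gt_atTop 0] with n hn
    have hn' : (0 : ℝ) < n := by exact_mod_cast hn
    rw [show (n : ℝ) + 1 / 2 = n * (1 + 1 / 2 * (1 / n)) by field_simp,
      log_mul hn'.ne' (by positivity)]
    ring
  have ha : Antitone (fun n : ℕ => (harmonic n : ℝ) - log (n + 1 / 2)) := by
    refine antitone_nat_of_succ_le fun n => ?_
    have hn : (0 : ℝ) ≤ n := n.cast_nonneg
    have h1 := Real.le_log_one_add_of_nonneg (x := 1 / ((n : ℝ) + 1 / 2)) (by positivity)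
    have h2 : 2 * (1 / ((n : ℝ) + 1 / 2)) / (1 / ((n : ℝ) + 1 / 2) + 2) = 1 / ((n : ℝ) + 1) := by
      field_simp
      ring
    have h3 : ((n + 1 : ℕ) : ℝ) + 1 / 2 = ((n : ℝ) + 1 / 2) * (1 + 1 / ((n : ℝ) + 1 / 2)) := by
      push_cast
      field_simp
      ring
    rw [h2] at h1
    rw [h3, log_mul (by positivity) (by positivity), harmonic_succ]
    push_cast
    rw [← one_div]
    linarith
  exact ha.le_of_tendsto ht n

theorem log_pi_lt_constant :
    log π < -eulerMascheroniConstant + log (4 / 3) + (-(2 * log 2) / 2 + (2 * log 2) ^ 2 / 24 -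
      (2 * log 2) ^ 4 / 2880) + 20491 / 10000 := by
  have hg := eulerMascheroniConstant_le_harmonic_sub_log 10
  have hh : (harmonic 10 : ℝ) = 7381 / 2520 := by
    have : harmonic 10 = 7381 / 2520 := by decide +kernel
    rw [this]; norm_num
  rw [hh] at hg
  have hL : 1.38629436 ≤ 2 * log 2 := by linarith [Real.log_two_gt_d9]
  have hL' : 2 * log 2 ≤ 1.38629437 := by linarith [Real.log_two_lt_d9]
  set L := 2 * log 2
  have hl : (149425 / 100000 : ℝ) ≤ log (14 / π) := by
    rw [Real.le_log_iff_exp_le (by positivity)]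
    have h := exp_le_evalCoeffs_expUpperCoeffs (149425 / 100000) 12 (x := 1)
      (by norm_num) (by norm_num)
    rw [mul_one] at h
    push_cast at h
    refine h.trans ?_
    have h2 : evalCoeffs (expUpperCoeffs (149425 / 100000) 12) 1 ≤ 14 / 3.1416 := by
      have h3 := lowerCoeffs_shiftCoeffs_le 1 0 (addCoeffs [14 / 3.1416]
        (smulCoeffs (-1) (expUpperCoeffs (149425 / 100000) 12))) (x := 1) (by norm_num) (by norm_num)
      rw [evalCoeffs_addCoeffs, evalCoeffs_smulCoeffs] at h3
      have h4 : 0 ≤ lowerCoeffs 0 (shiftCoeffs 1 (addCoeffs [14 / 3.1416]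
        (smulCoeffs (-1) (expUpperCoeffs (149425 / 100000) 12)))) := by decide +kernel
      have h5 := (Rat.cast_le (K := ℝ)).2 h4
      have h6 := h5.trans h3
      simp only [evalCoeffs] at h6
      push_cast at h6
      linarith
    refine h2.trans ?_
    have := pi_lt_d4
    gcongr
  have e : log (14 / π) = log (10 + 1 / 2) + log (4 / 3) - log π := by
    rw [← log_mul (by norm_num) (by norm_num), ← log_div (by norm_num) pi_pos.ne']
    norm_num
  push_cast at hg
  have h2 : L ^ 2 ≥ 1.38629436 ^ 2 := by gcongr
  have h4 : L ^ 4 ≤ 1.38629437 ^ 4 := by gcongr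
  norm_num at h2 h4 hL hL' ⊢
  rw [e] at hl
  norm_num at hl hg
  linarith

theorem log_pi_lt_of_weight_integral {w : ℝ} (hw : 20491 / 10000 ≤ w) :
    log π < -eulerMascheroniConstant + log (4 / 3) + (-(2 * log 2) / 2 + (2 * log 2) ^ 2 / 24 -
      (2 * log 2) ^ 4 / 2880) + w := by
  have := log_pi_lt_constant
  linarith

theorem intervalIntegrable_one_sub_exp_mul_weight (s : ℂ) :
    IntervalIntegrable (fun x : ℝ => (1 - Complex.exp (-s * x) * (weight x : ℂ)) / x)
      volume 0 1 := by
  obtain ⟨C, hC0, hC⟩ := exists_abs_weight_sub_one_le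
  have hm := measurable_weight
  have hm' : Measurable fun x : ℝ => (1 - Complex.exp (-s * x) * (weight x : ℂ)) / (x : ℂ) :=
    Measurable.div (by fun_prop) (by fun_prop)
  refine (intervalIntegrable_const (c := exp ‖s‖ * C + ‖s‖ * exp ‖s‖)).mono_fun
    hm'.aestronglyMeasurable ?_
  rw [Filter.EventuallyLE, ae_restrict_iff' measurableSet_uIoc]
  refine Filter.Eventually.of_forall fun x hx => ?_
  rw [Set.uIoc_of_le zero_le_one] at hx
  obtain ⟨h0, h1⟩ := hx
  have hsx : ‖-s * (x : ℂ)‖ ≤ ‖s‖ * x := by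
    rw [norm_mul, norm_neg, Complex.norm_real, Real.norm_of_nonneg h0.le]
  have hsx1 : ‖s‖ * x ≤ ‖s‖ := mul_le_of_le_one_right (norm_nonneg _) h1
  rw [norm_div, Complex.norm_real, Real.norm_of_nonneg h0.le, div_le_iff₀ h0,
    Real.norm_of_nonneg (by positivity)]
  have h2 := Complex.norm_exp_sub_sum_le_norm_mul_exp (-s * x) 1
  rw [Finset.sum_range_one, pow_zero, Nat.factorial_zero, Nat.cast_one, div_one, pow_one] at h2
  have h2' : ‖Complex.exp (-s * x) - 1‖ ≤ ‖s‖ * x * exp ‖s‖ := by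
    refine h2.trans ?_
    gcongr
    exact hsx.trans hsx1
  have h3 : 1 - Complex.exp (-s * x) * (weight x : ℂ) = -(Complex.exp (-s * x) - 1) -
      Complex.exp (-s * x) * ((weight x - 1 : ℝ) : ℂ) := by push_cast; ring
  have h4 : ‖Complex.exp (-s * x) * ((weight x - 1 : ℝ) : ℂ)‖ ≤ exp ‖s‖ * (C * x) := by
    rw [norm_mul, Complex.norm_real]
    gcongr
    · refine (Complex.norm_exp_le_exp_norm _).trans ?_
      gcongr
      exact hsx.trans hsx1
    · exact hC x h0 h1
  rw [h3]
  have := norm_sub_le (-(Complex.exp (-s * x) - 1)) (Complex.exp (-s * x) *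
    ((weight x - 1 : ℝ) : ℂ))
  rw [norm_neg] at this
  linarith

theorem differentiable_integral_one_sub_exp_mul_weight : Differentiable ℂ fun s : ℂ =>
    ∫ x in (0 : ℝ)..1, (1 - Complex.exp (-s * x) * (weight x : ℂ)) / x := by
  intro s₀
  obtain ⟨C, hC0, hC⟩ := exists_abs_weight_sub_one_le
  have hm := measurable_weight
  have hm' : ∀ s : ℂ, Measurable fun x : ℝ =>
      (1 - Complex.exp (-s * x) * (weight x : ℂ)) / (x : ℂ) :=
    fun s => Measurable.div (by fun_prop) (by fun_prop)
  refine (intervalIntegral.hasDerivAt_integral_of_dominated_loc_of_deriv_le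
    (F := fun (s : ℂ) (x : ℝ) => (1 - Complex.exp (-s * x) * (weight x : ℂ)) / x)
    (F' := fun (s : ℂ) (x : ℝ) => Complex.exp (-s * x) * (weight x : ℂ))
    (bound := fun _ => exp (‖s₀‖ + 1) * (1 + C))
    (Metric.ball_mem_nhds s₀ one_pos)
    (Filter.Eventually.of_forall fun s => (hm' s).aestronglyMeasurable)
    (intervalIntegrable_one_sub_exp_mul_weight s₀)
    (Measurable.aestronglyMeasurable (by fun_prop)) ?_ intervalIntegrable_const
    ?_).2.differentiableAt
  · refine Filter.Eventually.of_forall fun x hx s hs => ?_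
    rw [Set.uIoc_of_le zero_le_one] at hx
    have hs' : ‖s‖ ≤ ‖s₀‖ + 1 := by
      have := norm_sub_norm_le s s₀
      rw [mem_ball_iff_norm] at hs
      linarith
    rw [norm_mul, Complex.norm_real]
    gcongr
    · refine (Complex.norm_exp_le_exp_norm _).trans ?_
      gcongr
      rw [norm_mul, norm_neg, Complex.norm_real, Real.norm_of_nonneg hx.1.le]
      exact (mul_le_of_le_one_right (norm_nonneg _) hx.2).trans hs'
    · have h1 := hC x hx.1 hx.2
      have h2 := abs_sub_abs_le_abs_sub (weight x) 1
      rw [abs_one] at h2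
      rw [Real.norm_eq_abs]
      nlinarith [hx.2]
  · refine Filter.Eventually.of_forall fun x hx s _ => ?_
    rw [Set.uIoc_of_le zero_le_one] at hx
    have hx0 : (x : ℂ) ≠ 0 := by exact_mod_cast hx.1.ne'
    have h1 : HasDerivAt (fun s : ℂ => -s * x) (-1 * x) s := (hasDerivAt_id s).neg.mul_const _
    refine (((h1.cexp.mul_const (weight x : ℂ)).const_sub 1).div_const (x : ℂ)).congr_deriv ?_
    field_simp

theorem re_integral_one_sub_exp_mul_weight_ge {s : ℂ} (hs : 0 ≤ s.re) : 20491 / 10000 ≤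
    (∫ x in (0 : ℝ)..1, (1 - Complex.exp (-s * x) * (weight x : ℂ)) / x).re := by
  obtain ⟨C, hC0, hC⟩ := exists_abs_weight_sub_one_le
  set G : ℂ → ℂ := fun s => ∫ x in (0 : ℝ)..1, (1 - Complex.exp (-s * x) * (weight x : ℂ)) / x
    with hG
  have hGd : Differentiable ℂ G := differentiable_integral_one_sub_exp_mul_weight
  have hre : ∀ s, (G s).re =
      ∫ x in (0 : ℝ)..1, ((1 - Complex.exp (-s * x) * (weight x : ℂ)) / x).re := by
    intro s
    exact ((Complex.reCLM.intervalIntegral_comp_comm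
      (intervalIntegrable_one_sub_exp_mul_weight s)).symm)
  have hlow : ∀ s : ℂ, 0 ≤ s.re → -C ≤ (G s).re := by
    intro s hs
    rw [hre]
    have h1 : ∫ _ in (0 : ℝ)..1, -C = -C := by simp
    rw [← h1]
    refine intervalIntegral.integral_mono_on_of_le_Ioo zero_le_one intervalIntegrable_const
      (by
        have := intervalIntegrable_one_sub_exp_mul_weight s
        exact ⟨this.1.re, this.2.re⟩) fun x hx => ?_
    rw [Complex.div_ofReal_re, le_div_iff₀ hx.1]
    have h2 : ‖Complex.exp (-s * x)‖ ≤ 1 := by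
      rw [Complex.norm_exp, Real.exp_le_one_iff]
      simp
      exact mul_nonneg hs hx.1.le
    have h3 : 1 - Complex.exp (-s * x) * (weight x : ℂ) = (1 - Complex.exp (-s * x)) -
      Complex.exp (-s * x) * ((weight x - 1 : ℝ) : ℂ) := by push_cast; ring
    have h4 : ‖Complex.exp (-s * x) * ((weight x - 1 : ℝ) : ℂ)‖ ≤ 1 * (C * x) := by
      rw [norm_mul, Complex.norm_real]
      gcongr
      exact hC x hx.1 hx.2.le
    have h5 := Complex.re_le_norm (Complex.exp (-s * x))
    have h6 := Complex.re_le_norm (Complex.exp (-s * x) * ((weight x - 1 : ℝ) : ℂ))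
    rw [h3, Complex.sub_re, Complex.sub_re, Complex.one_re]
    linarith
  have hbound : ‖Complex.exp (-G s)‖ ≤ exp (-(20491 / 10000)) := by
    have hb : ∀ z : ℂ, 0 ≤ z.re → ‖Complex.exp (-G z)‖ ≤ exp C := by
      intro z hz
      rw [Complex.norm_exp, Complex.neg_re]
      have := hlow z hz
      gcongr
      linarith
    refine PhragmenLindelof.right_half_plane_of_bounded_on_real
      (f := fun z => Complex.exp (-G z)) hGd.neg.cexp.diffContOnCl ?_ ?_ ?_ hs
    · refine ⟨0, by norm_num, 0, Asymptotics.IsBigO.of_bound (exp C) ?_⟩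
      refine Filter.eventually_inf_principal.2 (Filter.Eventually.of_forall fun z hz => ?_)
      simpa using hb z (le_of_lt hz)
    · refine Filter.isBoundedUnder_of_eventually_le (a := exp C) ?_
      filter_upwards [Filter.eventually_ge_atTop 0] with x hx
      exact hb x (by simpa using hx)
    · intro y
      rw [Complex.norm_exp, Complex.neg_re, hre]
      gcongr
      refine (weight_integral_ge y).trans (le_of_eq ?_)
      refine intervalIntegral.integral_congr fun x _ => ?_
      rw [Complex.div_ofReal_re, Complex.sub_re, Complex.re_mul_ofReal, Complex.one_re,
        Complex.exp_re]
      simp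
  rw [Complex.norm_exp, Real.exp_le_exp, Complex.neg_re] at hbound
  linarith

theorem hasSum_int_one_div_add_sq {x : ℝ} (hx : ∀ n : ℤ, x ≠ n) :
    HasSum (fun n : ℤ => 1 / (x + n) ^ 2) ((π / sin (π * x)) ^ 2) := by
  have hsin : sin (π * x) ≠ 0 := by
    intro h
    rw [sin_eq_zero_iff] at h
    obtain ⟨n, hn⟩ := h
    exact hx n (by rw [mul_comm] at hn; exact (mul_left_cancel₀ pi_ne_zero hn).symm)
  have key := hasSum_sq_fourierCoeffOn (a := 0) (b := 1)
    (f := fun ξ : ℝ => Complex.exp (Complex.I * ((-(2 * π * x) * ξ : ℝ) : ℂ))) zero_lt_one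
    (MemLp.of_bound (by fun_prop) 1 (Filter.Eventually.of_forall fun ξ => by
      rw [Complex.norm_exp_I_mul_ofReal]))
  have hc : ∀ n : ℤ, ‖fourierCoeffOn (zero_lt_one' ℝ)
      (fun ξ : ℝ => Complex.exp (Complex.I * ((-(2 * π * x) * ξ : ℝ) : ℂ))) n‖ ^ 2 =
      (sin (π * x) / π) ^ 2 * (1 / (x + n) ^ 2) := by
    intro n
    have hy : x + n ≠ 0 := fun h => hx (-n) (by push_cast; linarith)
    have hcne : Complex.I * ((-(2 * π * (x + n)) : ℝ) : ℂ) ≠ 0 :=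
      mul_ne_zero Complex.I_ne_zero (Complex.ofReal_ne_zero.2
        (neg_ne_zero.2 (mul_ne_zero (by positivity) hy)))
    rw [fourierCoeffOn_eq_integral]
    have h1 : ∀ ξ : ℝ, (fourier (-n) (ξ : AddCircle ((1 : ℝ) - 0))) •
        Complex.exp (Complex.I * ((-(2 * π * x) * ξ : ℝ) : ℂ)) =
        Complex.exp (Complex.I * ((-(2 * π * (x + n)) : ℝ) : ℂ) * ξ) := by
      intro ξ
      rw [fourier_coe_apply, smul_eq_mul, ← Complex.exp_add]
      congr 1
      push_cast
      ring
    simp only [h1]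
    rw [integral_exp_mul_complex hcne]
    have h2 : Complex.I * ((-(2 * π * (x + n)) : ℝ) : ℂ) * ((1 : ℝ) : ℂ) =
      Complex.I * ((-(2 * π * (x + n)) : ℝ) : ℂ) := by push_cast; ring
    rw [h2]
    simp only [Complex.ofReal_zero, mul_zero, Complex.exp_zero, sub_zero, one_div, inv_one,
      one_smul]
    rw [norm_div, Complex.norm_exp_I_mul_ofReal_sub_one, norm_mul, norm_mul Complex.I, Complex.norm_I, one_mul,
      Complex.norm_real, div_pow]
    simp only [Real.norm_eq_abs, mul_pow, sq_abs]
    have h3 : sin (-(2 * π * (x + n)) / 2) ^ 2 = sin (π * x) ^ 2 := by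
      have : -(2 * π * (x + n)) / 2 = -(π * x + n * π) := by ring
      rw [this, sin_neg, neg_sq, sin_add_int_mul_pi, mul_pow, ← sq_abs (_ ^ n), abs_zpow]
      simp
    rw [h3]
    field_simp
  simp only [hc] at key
  have key2 := key.mul_left ((π / sin (π * x)) ^ 2)
  simp only [Complex.norm_exp_I_mul_ofReal] at key2
  have h4 : (π / sin (π * x)) ^ 2 * (sin (π * x) / π) ^ 2 = 1 := by
    field_simp
  simp only [← mul_assoc, h4, one_mul] at key2
  simpa using key2

/-- The closed form of the Selberg minorant of `[-5/2, 5/2]` with parameter `1`, valid away from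
the half-integers. -/
noncomputable def minorantKernel (w : ℝ) : ℝ :=
  (cos (π * w) / π) ^ 2 * (1 / (w - 3 / 2) ^ 2 + 1 / (w - 1 / 2) ^ 2 + 1 / (w + 1 / 2) ^ 2 +
    1 / (w + 3 / 2) ^ 2 + 5 / (25 / 4 - w ^ 2))

theorem beurlingB_add_beurlingB {w : ℝ} (hw : ∀ n : ℤ, w - 5 / 2 ≠ n) :
    -(1 / 2) * (beurlingB (-5 / 2 - w) + beurlingB (w - 5 / 2)) = minorantKernel w := by
  have hw1 : ∀ n : ℤ, w + 5 / 2 ≠ n := fun n h => hw (n - 5) (by push_cast; linarith)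
  have hw2 : ∀ n : ℤ, -5 / 2 - w ≠ n := fun n h => hw1 (-n) (by push_cast; linarith)
  have hsq : sin (π * (w - 5 / 2)) ^ 2 = cos (π * w) ^ 2 := by
    have : π * (w - 5 / 2) = π * w - π / 2 - 2 * π := by ring
    rw [this, sin_sub_two_pi, sin_sub_pi_div_two, neg_sq]
  have hsq2 : sin (π * (-5 / 2 - w)) ^ 2 = cos (π * w) ^ 2 := by
    have : π * (-5 / 2 - w) = -(π * w + π / 2 + 2 * π) := by ring
    rw [this, sin_neg, neg_sq, sin_add_two_pi, sin_add_pi_div_two]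
  have hsq3 : sin (π * (w + 5 / 2)) ^ 2 = cos (π * w) ^ 2 := by
    have : π * (w + 5 / 2) = (π * w + π / 2 + 2 * π) := by ring
    rw [this, sin_add_two_pi, sin_add_pi_div_two]
  have hcos : cos (π * w) ≠ 0 := by
    intro h
    have h1 : sin (π * (w + 5 / 2)) = 0 := by
      rw [← sq_eq_zero_iff, hsq3, h]; simp
    rw [sin_eq_zero_iff] at h1
    obtain ⟨n, hn⟩ := h1
    exact hw1 n (by rw [mul_comm] at hn; exact (mul_left_cancel₀ pi_ne_zero hn).symm)
  have hz := hasSum_int_one_div_add_sq hw1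
  have hs1 := (hz.summable.comp_injective Nat.cast_injective)
  have hs2 : Summable fun n : ℕ => 1 / (w + 5 / 2 + ((-((n : ℤ) + 1) : ℤ) : ℝ)) ^ 2 :=
    hz.summable.comp_injective (i := fun n : ℕ => -((n : ℤ) + 1)) fun a b h => by
      simpa using h
  have ht := tsum_of_nat_of_neg_add_one (f := fun n : ℤ => 1 / (w + 5 / 2 + n) ^ 2) hs1 hs2
  rw [hz.tsum_eq] at ht
  have hsh : Summable fun n : ℕ => 1 / (((n : ℝ) + 1) + (w - 5 / 2)) ^ 2 := by
    rw [← summable_nat_add_iff 4]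
    refine hs1.congr fun n => ?_
    simp only [Function.comp]
    push_cast
    congr 2
    ring
  have h4 := hsh.sum_add_tsum_nat_add 4
  have e1 : ∑' n : ℕ, 1 / ((((n + 4 : ℕ) : ℝ) + 1) + (w - 5 / 2)) ^ 2 =
      ∑' n : ℕ, 1 / (w + 5 / 2 + ((n : ℤ) : ℝ)) ^ 2 := by
    congr 1 with n
    push_cast
    congr 2
    ring
  have e2 : ∑' n : ℕ, 1 / (((n : ℝ) + 1) + (-5 / 2 - w)) ^ 2 =
      ∑' n : ℕ, 1 / (w + 5 / 2 + ((-((n : ℤ) + 1) : ℤ) : ℝ)) ^ 2 := by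
    congr 1 with n
    push_cast
    congr 1
    ring
  rw [e1] at h4
  rw [beurlingB_of_ne_int hw, beurlingB_of_ne_int hw2, e2, ← h4]
  have h5 : ∑' n : ℕ, 1 / (w + 5 / 2 + ((-((n : ℤ) + 1) : ℤ) : ℝ)) ^ 2 =
    (π / sin (π * (w + 5 / 2))) ^ 2 - ∑' n : ℕ, 1 / (w + 5 / 2 + ((n : ℤ) : ℝ)) ^ 2 := by
    rw [ht]; ring
  rw [h5, div_pow, div_pow, div_pow, hsq, hsq2, hsq3, minorantKernel]
  simp only [Finset.sum_range_succ, Finset.sum_range_zero]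
  generalize ∑' n : ℕ, 1 / (w + 5 / 2 + ((n : ℤ) : ℝ)) ^ 2 = S
  have n0 : w - 5 / 2 ≠ 0 := by simpa using hw 0
  have n5 : w + 5 / 2 ≠ 0 := by simpa using hw1 0
  have n5' : -5 / 2 - w ≠ 0 := by simpa using hw2 0
  have hrat : 5 / (25 / 4 - w ^ 2) = -(1 / (w - 5 / 2)) - 1 / (-5 / 2 - w) := by
    have : 25 / 4 - w ^ 2 = (w - 5 / 2) * (-5 / 2 - w) := by ring
    rw [this, ← neg_add', div_add_div _ _ n0 n5', ← neg_div]
    congr 1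
    ring
  rw [hrat]
  push_cast
  have a1 : (0 : ℝ) + 1 + (w - 5 / 2) = w - 3 / 2 := by ring
  have a2 : (1 : ℝ) + 1 + (w - 5 / 2) = w - 1 / 2 := by ring
  have a3 : (2 : ℝ) + 1 + (w - 5 / 2) = w + 1 / 2 := by ring
  have a4 : (3 : ℝ) + 1 + (w - 5 / 2) = w + 3 / 2 := by ring
  rw [a1, a2, a3, a4, div_pow]
  have hone : cos (π * w) ^ 2 / π ^ 2 * (π ^ 2 / cos (π * w) ^ 2) = 1 := by
    field_simp
  linear_combination hone

/-- The even extension by zero of `4 * minorantHat`: the Fourier transform of the Selberg minorant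
of `[-5/2, 5/2]` with parameter `1`. -/
noncomputable def minorantTransform (ξ : ℝ) : ℝ := 4 * minorantHat (min |ξ| 1)

theorem continuous_minorantTransform : Continuous minorantTransform := by
  unfold minorantTransform minorantHat
  fun_prop

theorem minorantHat_one : minorantHat 1 = 0 := by
  have : sin (5 * π * 1) = 0 := by
    have := sin_nat_mul_pi 5
    push_cast at this
    rw [mul_one, this]
  rw [minorantHat, this]
  simp

theorem minorantTransform_of_one_le_abs {ξ : ℝ} (h : 1 ≤ |ξ|) : minorantTransform ξ = 0 := by
  rw [minorantTransform, min_eq_right h, minorantHat_one, mul_zero]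

theorem minorantTransform_of_mem {ξ : ℝ} (h : ξ ∈ Set.Icc (0 : ℝ) 1) :
    minorantTransform ξ = 4 * minorantHat ξ := by
  rw [minorantTransform, abs_of_nonneg h.1, min_eq_left h.2]

theorem minorantTransform_neg (ξ : ℝ) : minorantTransform (-ξ) = minorantTransform ξ := by
  rw [minorantTransform, minorantTransform, abs_neg]

theorem hasCompactSupport_minorantTransform : HasCompactSupport minorantTransform := by
  refine HasCompactSupport.intro (isCompact_Icc (a := (-1 : ℝ)) (b := 1)) fun x hx => ?_
  refine minorantTransform_of_one_le_abs ?_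
  by_contra! h
  rw [abs_lt] at h
  exact hx ⟨h.1.le, h.2.le⟩

theorem integrable_minorantTransform : Integrable minorantTransform :=
  continuous_minorantTransform.integrable_of_hasCompactSupport hasCompactSupport_minorantTransform

theorem integral_one_sub_mul_cos {c : ℝ} (hc : c ≠ 0) :
    ∫ x in (0 : ℝ)..1, (1 - x) * cos (c * x) = (1 - cos c) / c ^ 2 := by
  have hd : ∀ x ∈ Set.uIcc (0 : ℝ) 1,
      HasDerivAt (fun x => (1 - x) * (sin (c * x) / c) - cos (c * x) / c ^ 2)
        ((1 - x) * cos (c * x)) x := by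
    intro x _
    have h1 : HasDerivAt (fun x : ℝ => c * x) c x := by
      simpa using (hasDerivAt_id x).const_mul c
    have h := ((((hasDerivAt_id x).const_sub 1).mul (h1.sin.div_const c)).sub
      (h1.cos.div_const (c ^ 2)))
    refine h.congr_deriv ?_
    simp only [id]
    field_simp
    ring
  rw [intervalIntegral.integral_eq_sub_of_hasDerivAt hd
    (Continuous.intervalIntegrable (by fun_prop) _ _)]
  simp
  ring

theorem integral_sin_const_mul {c : ℝ} (hc : c ≠ 0) :
    ∫ x in (0 : ℝ)..1, sin (c * x) = (1 - cos c) / c := by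
  rw [intervalIntegral.integral_comp_mul_left _ hc]
  simp
  ring

theorem integral_minorantHat_mul_cos {w : ℝ} (hw : ∀ n : ℤ, w - 5 / 2 ≠ n) :
    8 * ∫ x in (0 : ℝ)..1, minorantHat x * cos (2 * π * w * x) = minorantKernel w := by
  have hne : ∀ n : ℤ, (2 * w + (2 * n + 1)) * π ≠ 0 := fun n h => by
    have h2 : 2 * w + (2 * n + 1) = 0 := (mul_eq_zero.1 h).resolve_right pi_ne_zero
    exact hw (-n - 3) (by push_cast; linarith)
  have hcos : ∀ n : ℤ, cos ((2 * w + (2 * n + 1)) * π) = 1 - 2 * cos (π * w) ^ 2 := by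
    intro n
    have : (2 * w + (2 * n + 1)) * π = 2 * (π * w) + π + n * (2 * π) := by ring
    rw [this, cos_add_int_mul_two_pi, cos_add_pi, cos_two_mul]
    ring
  have e : ∀ x : ℝ, 8 * (minorantHat x * cos (2 * π * w * x)) =
      2 * ((1 - x) * cos ((2 * w + (2 * (0 : ℤ) + 1)) * π * x)) +
      2 * ((1 - x) * cos ((2 * w + (2 * (-1 : ℤ) + 1)) * π * x)) +
      2 * ((1 - x) * cos ((2 * w + (2 * (1 : ℤ) + 1)) * π * x)) +
      2 * ((1 - x) * cos ((2 * w + (2 * (-2 : ℤ) + 1)) * π * x)) +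
      1 / π * sin ((2 * w + (2 * (2 : ℤ) + 1)) * π * x) -
      1 / π * sin ((2 * w + (2 * (-3 : ℤ) + 1)) * π * x) := by
    intro x
    have a1 : (2 * w + (2 * ((0 : ℤ) : ℝ) + 1)) * π * x = 2 * π * w * x + π * x := by
      push_cast; ring
    have a2 : (2 * w + (2 * ((-1 : ℤ) : ℝ) + 1)) * π * x = 2 * π * w * x - π * x := by
      push_cast; ring
    have a3 : (2 * w + (2 * ((1 : ℤ) : ℝ) + 1)) * π * x = 2 * π * w * x + 3 * π * x := by
      push_cast; ring
    have a4 : (2 * w + (2 * ((-2 : ℤ) : ℝ) + 1)) * π * x = 2 * π * w * x - 3 * π * x := by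
      push_cast; ring
    have a5 : (2 * w + (2 * ((2 : ℤ) : ℝ) + 1)) * π * x = 2 * π * w * x + 5 * π * x := by
      push_cast; ring
    have a6 : (2 * w + (2 * ((-3 : ℤ) : ℝ) + 1)) * π * x = 2 * π * w * x - 5 * π * x := by
      push_cast; ring
    rw [a1, a2, a3, a4, a5, a6]
    simp only [cos_add, cos_sub, sin_add, sin_sub, minorantHat]
    have : sin (5 * π * x) / (4 * π) = 1 / π * sin (5 * π * x) / 4 := by
      field_simp
    rw [this]
    ring
  rw [← intervalIntegral.integral_const_mul]
  simp only [e]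
  have ic : ∀ c : ℝ, IntervalIntegrable (fun x => 2 * ((1 - x) * cos (c * x))) volume 0 1 :=
    fun c => Continuous.intervalIntegrable (by fun_prop) _ _
  have is : ∀ c : ℝ, IntervalIntegrable (fun x => 1 / π * sin (c * x)) volume 0 1 :=
    fun c => Continuous.intervalIntegrable (by fun_prop) _ _
  rw [intervalIntegral.integral_sub (((((ic _).add (ic _)).add (ic _)).add (ic _)).add (is _))
      (is _), intervalIntegral.integral_add ((((ic _).add (ic _)).add (ic _)).add (ic _)) (is _),
    intervalIntegral.integral_add (((ic _).add (ic _)).add (ic _)) (ic _),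
    intervalIntegral.integral_add ((ic _).add (ic _)) (ic _),
    intervalIntegral.integral_add (ic _) (ic _)]
  simp only [intervalIntegral.integral_const_mul]
  rw [integral_one_sub_mul_cos (hne 0), integral_one_sub_mul_cos (hne (-1)),
    integral_one_sub_mul_cos (hne 1), integral_one_sub_mul_cos (hne (-2)),
    integral_sin_const_mul (hne 2), integral_sin_const_mul (hne (-3))]
  simp only [hcos]
  rw [minorantKernel]
  have n1 : w + 1 / 2 ≠ 0 := fun h => hw (-3) (by push_cast; linarith)
  have n2 : w - 1 / 2 ≠ 0 := fun h => hw (-2) (by push_cast; linarith)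
  have n3 : w + 3 / 2 ≠ 0 := fun h => hw (-4) (by push_cast; linarith)
  have n4 : w - 3 / 2 ≠ 0 := fun h => hw (-1) (by push_cast; linarith)
  have n5 : w + 5 / 2 ≠ 0 := fun h => hw (-5) (by push_cast; linarith)
  have n6 : w - 5 / 2 ≠ 0 := fun h => hw 0 (by push_cast; linarith)
  have b1 : (2 * w + (2 * ((0 : ℤ) : ℝ) + 1)) = 2 * (w + 1 / 2) := by push_cast; ring
  have b2 : (2 * w + (2 * ((-1 : ℤ) : ℝ) + 1)) = 2 * (w - 1 / 2) := by push_cast; ring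
  have b3 : (2 * w + (2 * ((1 : ℤ) : ℝ) + 1)) = 2 * (w + 3 / 2) := by push_cast; ring
  have b4 : (2 * w + (2 * ((-2 : ℤ) : ℝ) + 1)) = 2 * (w - 3 / 2) := by push_cast; ring
  have b5 : (2 * w + (2 * ((2 : ℤ) : ℝ) + 1)) = 2 * (w + 5 / 2) := by push_cast; ring
  have b6 : (2 * w + (2 * ((-3 : ℤ) : ℝ) + 1)) = 2 * (w - 5 / 2) := by push_cast; ring
  have b7 : 5 / (25 / 4 - w ^ 2) = 1 / (w + 5 / 2) - 1 / (w - 5 / 2) := by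
    have : 25 / 4 - w ^ 2 = -((w + 5 / 2) * (w - 5 / 2)) := by ring
    rw [this, div_sub_div _ _ n5 n6, div_neg, ← neg_div]
    congr 1
    ring
  rw [b1, b2, b3, b4, b5, b6, b7]
  generalize cos (π * w) = k
  field_simp
  ring

theorem fourier_minorantTransform (w : ℝ) :
    FourierTransform.fourier (fun ξ : ℝ => (minorantTransform ξ : ℂ)) w =
      ((8 * ∫ x in (0 : ℝ)..1, minorantHat x * cos (2 * π * w * x) : ℝ) : ℂ) := by
  rw [Real.fourier_real_eq_integral_exp_smul]
  set g : ℝ → ℂ := fun v => Complex.exp (((-2 * π * v * w : ℝ) : ℂ) * Complex.I) •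
    (minorantTransform v : ℂ) with hg
  have hgc : Continuous g := by
    have := continuous_minorantTransform
    rw [hg]
    fun_prop
  have hz : ∀ v ∉ Set.Ioc (-1 : ℝ) 1, g v = 0 := by
    intro v hv
    have : 1 ≤ |v| := by
      by_contra! h
      rw [abs_lt] at h
      exact hv ⟨h.1, h.2.le⟩
    simp [hg, minorantTransform_of_one_le_abs this]
  rw [← setIntegral_eq_integral_of_forall_compl_eq_zero hz,
    ← intervalIntegral.integral_of_le (by norm_num),
    ← intervalIntegral.integral_add_adjacent_intervals (hgc.intervalIntegrable (-1) 0)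
      (hgc.intervalIntegrable 0 1)]
  have hneg : ∫ x in (-1 : ℝ)..0, g x = ∫ x in (0 : ℝ)..1, g (-x) := by
    rw [intervalIntegral.integral_comp_neg]
    simp
  have hgn : Continuous fun x => g (-x) := hgc.comp continuous_neg
  rw [hneg, ← intervalIntegral.integral_add (hgn.intervalIntegrable 0 1) (hgc.intervalIntegrable 0 1),
    ← intervalIntegral.integral_const_mul, ← intervalIntegral.integral_ofReal]
  refine intervalIntegral.integral_congr fun x hx => ?_
  rw [Set.uIcc_of_le zero_le_one] at hx
  simp only [hg, minorantTransform_neg, minorantTransform_of_mem hx, smul_eq_mul]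
  have e1 : ((-2 * π * -x * w : ℝ) : ℂ) * Complex.I = ((2 * π * w * x : ℝ) : ℂ) * Complex.I := by
    push_cast; ring
  have e2 : ((-2 * π * x * w : ℝ) : ℂ) * Complex.I = -((2 * π * w * x : ℝ) : ℂ) * Complex.I := by
    push_cast; ring
  have h := Complex.two_cos ((2 * π * w * x : ℝ) : ℂ)
  rw [e1, e2, ← add_mul, ← h]
  push_cast
  ring

theorem ae_ne_int_add (c : ℝ) : ∀ᵐ w : ℝ, ∀ n : ℤ, w - c ≠ n := by
  filter_upwards [(Set.countable_range fun n : ℤ => (n : ℝ) + c).ae_notMem volume] with w hw n h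
  exact hw ⟨n, by simp only; linarith⟩

theorem fourier_minorantTransform_ae_eq :
    FourierTransform.fourier (fun ξ : ℝ => (minorantTransform ξ : ℂ)) =ᵐ[volume]
      fun w : ℝ => (minorantKernel w : ℂ) := by
  filter_upwards [ae_ne_int_add (5 / 2)] with w hw
  rw [fourier_minorantTransform, integral_minorantHat_mul_cos hw]

theorem exists_ae_abs_minorantKernel_le :
    ∃ C, 0 ≤ C ∧ ∀ᵐ w : ℝ, |minorantKernel w| ≤ C * (1 + |w|) ^ (-2 : ℝ) := by
  refine ⟨25 * (∫ v : ℝ, ‖(minorantTransform v : ℂ)‖) + 70, by positivity, ?_⟩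
  filter_upwards [fourier_minorantTransform_ae_eq] with w hw
  have hp : (0 : ℝ) < 1 + |w| := by positivity
  have hpow : (1 + |w|) ^ (-2 : ℝ) = ((1 + |w|) ^ 2)⁻¹ := by
    rw [rpow_neg hp.le]; norm_cast
  rw [hpow, ← div_eq_mul_inv, le_div_iff₀ (by positivity)]
  have hM0 : 0 ≤ ∫ v : ℝ, ‖(minorantTransform v : ℂ)‖ := by positivity
  rcases le_total |w| 4 with h4 | h4
  · have h1 : |minorantKernel w| ≤ ∫ v : ℝ, ‖(minorantTransform v : ℂ)‖ := by
      have := VectorFourier.norm_fourierIntegral_le_integral_norm Real.fourierChar volume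
        (innerₗ ℝ) (fun ξ : ℝ => (minorantTransform ξ : ℂ)) w
      change ‖FourierTransform.fourier (fun ξ : ℝ => (minorantTransform ξ : ℂ)) w‖ ≤ _ at this
      rwa [hw, Complex.norm_real, Real.norm_eq_abs] at this
    have h2 : (1 + |w|) ^ 2 ≤ 25 := by nlinarith [abs_nonneg w]
    nlinarith [abs_nonneg (minorantKernel w), sq_nonneg (1 + |w|)]
  · have hq : ∀ c : ℝ, |c| ≤ 5 / 2 → 1 / (w - c) ^ 2 ≤ 12 / (1 + |w|) ^ 2 := by
      intro c hc
      have h1 : 3 / 10 * (1 + |w|) ≤ |w - c| := by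
        have := abs_sub_abs_le_abs_sub w c
        linarith
      rw [div_le_div_iff₀ (by rw [← sq_abs]; nlinarith) (by positivity), ← sq_abs (w - c)]
      nlinarith
    have hr : |5 / (25 / 4 - w ^ 2)| ≤ 20 / (1 + |w|) ^ 2 := by
      rw [← sq_abs w]
      generalize |w| = a at h4
      have h1 : 25 / 4 - a ^ 2 < 0 := by nlinarith
      rw [abs_div, abs_of_neg h1, abs_of_nonneg (by norm_num : (0 : ℝ) ≤ 5),
        div_le_div_iff₀ (by linarith) (by positivity)]
      nlinarith
    have b1 := hq (3 / 2) (by norm_num [abs_of_pos])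
    have b2 := hq (1 / 2) (by norm_num [abs_of_pos])
    have b3 := hq (-1 / 2) (by norm_num [abs_of_pos])
    have b4 := hq (-3 / 2) (by norm_num [abs_of_pos])
    rw [show w - -1 / 2 = w + 1 / 2 by ring] at b3
    rw [show w - -3 / 2 = w + 3 / 2 by ring] at b4
    have hk : (cos (π * w) / π) ^ 2 ≤ 1 := by
      rw [div_pow, div_le_one (by positivity)]
      nlinarith [cos_sq_le_one (π * w), pi_gt_three]
    have hb : |1 / (w - 3 / 2) ^ 2 + 1 / (w - 1 / 2) ^ 2 + 1 / (w + 1 / 2) ^ 2 +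
        1 / (w + 3 / 2) ^ 2 + 5 / (25 / 4 - w ^ 2)| ≤ 68 / (1 + |w|) ^ 2 := by
      rw [abs_le] at hr ⊢
      have p1 : 0 ≤ 1 / (w - 3 / 2) ^ 2 := by positivity
      have p2 : 0 ≤ 1 / (w - 1 / 2) ^ 2 := by positivity
      have p3 : 0 ≤ 1 / (w + 1 / 2) ^ 2 := by positivity
      have p4 : 0 ≤ 1 / (w + 3 / 2) ^ 2 := by positivity
      have e : 68 / (1 + |w|) ^ 2 = 4 * (12 / (1 + |w|) ^ 2) + 20 / (1 + |w|) ^ 2 := by ring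
      have p5 : 0 ≤ 12 / (1 + |w|) ^ 2 := by positivity
      constructor <;> linarith
    have : |minorantKernel w| ≤ 68 / (1 + |w|) ^ 2 := by
      rw [minorantKernel, abs_mul, abs_of_nonneg (sq_nonneg _)]
      exact (mul_le_of_le_one_left (abs_nonneg _) hk).trans hb
    rw [le_div_iff₀ (by positivity)] at this
    linarith

theorem measurable_minorantKernel : Measurable minorantKernel := by
  unfold minorantKernel
  fun_prop

theorem integrable_one_add_abs_rpow_mul_minorantKernel :
    Integrable fun w : ℝ => (1 + |w|) ^ (1 / 2 : ℝ) * minorantKernel w := by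
  obtain ⟨C, hC0, hC⟩ := exists_ae_abs_minorantKernel_le
  have hi : Integrable fun w : ℝ => (1 + ‖w‖) ^ (-(3 / 2 : ℝ)) :=
    integrable_one_add_norm (by norm_num)
  have hm := measurable_minorantKernel
  refine (hi.const_mul C).mono' (by fun_prop) ?_
  filter_upwards [hC] with w hw
  have hp : (0 : ℝ) < 1 + |w| := by positivity
  rw [norm_mul, Real.norm_eq_abs, Real.norm_eq_abs, abs_of_nonneg (by positivity), Real.norm_eq_abs]
  calc (1 + |w|) ^ (1 / 2 : ℝ) * |minorantKernel w|
      ≤ (1 + |w|) ^ (1 / 2 : ℝ) * (C * (1 + |w|) ^ (-2 : ℝ)) := by gcongr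
    _ = C * ((1 + |w|) ^ (1 / 2 : ℝ) * (1 + |w|) ^ (-2 : ℝ)) := by ring
    _ = C * (1 + |w|) ^ (-(3 / 2 : ℝ)) := by
      rw [← rpow_add hp]
      norm_num

theorem integrable_minorantKernel : Integrable minorantKernel := by
  refine integrable_one_add_abs_rpow_mul_minorantKernel.mono
    measurable_minorantKernel.aestronglyMeasurable (Filter.Eventually.of_forall fun w => ?_)
  rw [norm_mul]
  refine le_mul_of_one_le_left (norm_nonneg _) ?_
  rw [Real.norm_of_nonneg (by positivity)]
  exact one_le_rpow (by linarith [abs_nonneg w]) (by norm_num)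

theorem integral_exp_mul_minorantKernel (ξ : ℝ) :
    ∫ w : ℝ, Complex.exp (((-(2 * π * w * ξ) : ℝ) : ℂ) * Complex.I) * (minorantKernel w : ℂ) =
      (minorantTransform ξ : ℂ) := by
  have h := Continuous.fourierInv_fourier_eq
    (f := fun ξ : ℝ => (minorantTransform ξ : ℂ))
    (Complex.continuous_ofReal.comp continuous_minorantTransform)
    integrable_minorantTransform.ofReal
    (integrable_minorantKernel.ofReal.congr fourier_minorantTransform_ae_eq.symm)
  have h2 := congr_fun h (-ξ)
  rw [Real.fourierInv_eq', minorantTransform_neg] at h2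
  rw [← h2]
  refine integral_congr_ae ?_
  filter_upwards [fourier_minorantTransform_ae_eq] with w hw
  rw [hw, smul_eq_mul]
  congr 4
  simp
  ring

theorem differentiableAt_log_comp_Gamma {x : ℝ} (hx : 0 < x) :
    DifferentiableAt ℝ (log ∘ Gamma) x :=
  (differentiableAt_Gamma fun m => by
    have : (0 : ℝ) ≤ m := m.cast_nonneg
    linarith).log (Gamma_pos_of_pos hx).ne'

theorem deriv_log_comp_Gamma_add_nat {x : ℝ} (hx : 0 < x) (n : ℕ) :
    deriv (log ∘ Gamma) (x + n) = deriv (log ∘ Gamma) x + ∑ k ∈ Finset.range n, 1 / (k + x) := by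
  have h1 : ∀ y : ℝ, 0 < y → deriv (log ∘ Gamma) (y + 1) = deriv (log ∘ Gamma) y + 1 / y := by
    intro y hy
    rw [← deriv_comp_add_const, one_div, ← deriv_log,
      ← deriv_add (differentiableAt_log_comp_Gamma hy) (differentiableAt_log hy.ne')]
    apply Filter.EventuallyEq.deriv_eq
    filter_upwards [eventually_gt_nhds hy] with z hz
    simp only [Function.comp_apply, Pi.add_apply, Gamma_add_one hz.ne',
      log_mul hz.ne' (Gamma_pos_of_pos hz).ne', add_comm]
  induction n with
  | zero => simp
  | succ n ih =>
    rw [Nat.cast_succ, ← add_assoc, h1 _ (by positivity), ih, Finset.sum_range_succ, add_assoc,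
      add_comm x n]

theorem deriv_log_comp_Gamma_one : deriv (log ∘ Gamma) 1 = -eulerMascheroniConstant := by
  rw [Function.comp_def, deriv.log (differentiableAt_Gamma fun m => by
    have : (0 : ℝ) ≤ m := m.cast_nonneg
    linarith) (by simp), Gamma_one, eulerMascheroniConstant_eq_neg_deriv]
  simp

theorem tendsto_sum_one_div_sub_one_div {x : ℝ} (hx : 0 < x) :
    Filter.Tendsto (fun N : ℕ => ∑ n ∈ Finset.range N, (1 / ((n : ℝ) + 1) - 1 / (n + x)))
      Filter.atTop (nhds (deriv (log ∘ Gamma) x + eulerMascheroniConstant)) := by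
  set d := deriv (log ∘ Gamma) with hd
  have hmono : MonotoneOn d (Set.Ioi 0) :=
    convexOn_log_Gamma.monotoneOn_deriv fun y hy => differentiableAt_log_comp_Gamma hy
  obtain ⟨k, hk⟩ := exists_nat_ge x
  have hsum : ∀ N : ℕ, ∑ n ∈ Finset.range N, (1 / ((n : ℝ) + 1) - 1 / (n + x)) =
      (d (1 + N) - d (x + N)) + (d x + eulerMascheroniConstant) := by
    intro N
    rw [hd, deriv_log_comp_Gamma_add_nat hx, deriv_log_comp_Gamma_add_nat one_pos,
      deriv_log_comp_Gamma_one, Finset.sum_sub_distrib]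
    ring
  simp only [hsum]
  have hzero : Filter.Tendsto (fun N : ℕ => d (1 + N) - d (x + N)) Filter.atTop (nhds 0) := by
    have hup : Filter.Tendsto (fun N : ℕ => 1 / (N : ℝ)) Filter.atTop (nhds 0) :=
      tendsto_one_div_atTop_nhds_zero_nat
    have hlo : Filter.Tendsto (fun N : ℕ => -(k : ℝ) * (1 / (N : ℝ))) Filter.atTop (nhds 0) := by
      simpa using hup.const_mul (-(k : ℝ))
    refine tendsto_of_tendsto_of_tendsto_of_le_of_le' hlo hup ?_ ?_
    · filter_upwards [Filter.eventually_gt_atTop 0] with N hN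
      have hN' : (0 : ℝ) < N := Nat.cast_pos.2 hN
      have h1 : d (x + N) ≤ d (1 + N + k) :=
        hmono (Set.mem_Ioi.2 (by positivity)) (Set.mem_Ioi.2 (by positivity)) (by linarith)
      rw [hd, deriv_log_comp_Gamma_add_nat (by positivity : (0 : ℝ) < 1 + N), ← hd] at h1
      have h2 : ∑ i ∈ Finset.range k, 1 / ((i : ℝ) + (1 + N)) ≤ k * (1 / (N : ℝ)) := by
        refine (Finset.sum_le_card_nsmul _ _ (1 / (N : ℝ)) fun i _ => ?_).trans_eq (by simp)
        gcongr
        have : (0 : ℝ) ≤ i := i.cast_nonneg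
        linarith
      linarith
    · filter_upwards [Filter.eventually_gt_atTop 0] with N hN
      have hN' : (0 : ℝ) < N := Nat.cast_pos.2 hN
      have h1 : d N ≤ d (x + N) :=
        hmono (Set.mem_Ioi.2 hN') (Set.mem_Ioi.2 (by positivity)) (by linarith)
      have h2 := deriv_log_comp_Gamma_add_nat hN' 1
      rw [← hd] at h2
      simp only [Nat.cast_one, Finset.sum_range_one, Nat.cast_zero, zero_add] at h2
      rw [add_comm] at h2
      linarith
  simpa using hzero.add_const (d x + eulerMascheroniConstant)

theorem Complex.deriv_Gamma_div_Gamma_ofReal {x : ℝ} (hx : 0 < x) :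
    deriv Complex.Gamma x / Complex.Gamma x = ((deriv (Real.log ∘ Real.Gamma) x : ℝ) : ℂ) := by
  have hm : ∀ m : ℕ, x ≠ -m := fun m => by
    have : (0 : ℝ) ≤ m := m.cast_nonneg
    linarith
  have h1 : HasDerivAt (fun y : ℝ => Complex.Gamma y) (deriv Complex.Gamma x) x :=
    (Complex.differentiableAt_Gamma _ fun m => by exact_mod_cast hm m).hasDerivAt.comp_ofReal
  have h2 : HasDerivAt (fun y : ℝ => ((Real.Gamma y : ℝ) : ℂ)) ((deriv Real.Gamma x : ℝ) : ℂ) x :=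
    (Real.differentiableAt_Gamma hm).hasDerivAt.ofReal_comp
  simp only [Complex.Gamma_ofReal] at h1
  rw [h1.unique h2, Complex.Gamma_ofReal, Function.comp_def,
    deriv.log (Real.differentiableAt_Gamma hm) (Real.Gamma_pos_of_pos hx).ne']
  push_cast
  rfl

theorem mul_le_norm_natCast_add {c : ℝ} (hc1 : c ≤ 1) {z : ℂ} (hz : c ≤ z.re) (n : ℕ) :
    c * (n + 1) ≤ ‖(n : ℂ) + z‖ := by
  have h1 : (n : ℝ) + z.re ≤ ‖(n : ℂ) + z‖ := by
    simpa using Complex.re_le_norm ((n : ℂ) + z)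
  have : (0 : ℝ) ≤ n := n.cast_nonneg
  nlinarith

theorem one_div_sub_one_div_eq {z : ℂ} (hz : 0 < z.re) (n : ℕ) :
    1 / ((n : ℂ) + 1) - 1 / (n + z) = (z - 1) / ((n + 1) * (n + z)) := by
  have h1 : (n : ℂ) + 1 ≠ 0 := Nat.cast_add_one_ne_zero n
  have h2 : (n : ℂ) + z ≠ 0 := fun h => by
    have := congr_arg Complex.re h
    simp only [Complex.add_re, Complex.natCast_re, Complex.zero_re] at this
    have : (0 : ℝ) ≤ n := n.cast_nonneg
    linarith
  rw [div_sub_div _ _ h1 h2]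
  congr 1
  ring

theorem norm_one_div_sub_one_div {z : ℂ} (hz : 0 < z.re) (n : ℕ) :
    ‖1 / ((n : ℂ) + 1) - 1 / (n + z)‖ = ‖z - 1‖ / ((n + 1) * ‖(n : ℂ) + z‖) := by
  rw [one_div_sub_one_div_eq hz, norm_div, norm_mul]
  norm_cast

theorem norm_one_div_sub_one_div_le {c : ℝ} (hc : 0 < c) (hc1 : c ≤ 1) {z : ℂ} (hz : c ≤ z.re)
    (n : ℕ) : ‖1 / ((n : ℂ) + 1) - 1 / (n + z)‖ ≤ ‖z - 1‖ / c * (1 / ((n : ℝ) + 1) ^ 2) := by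
  rw [norm_one_div_sub_one_div (hc.trans_le hz), div_mul_div_comm, mul_one]
  have := mul_le_norm_natCast_add hc1 hz n
  refine div_le_div_of_nonneg_left (norm_nonneg _) (by positivity) ?_
  nlinarith [(by positivity : (0 : ℝ) < n + 1)]

theorem norm_one_div_sub_one_div_le_rpow {z : ℂ} (hz : 1 / 4 ≤ z.re) (n : ℕ) :
    ‖1 / ((n : ℂ) + 1) - 1 / (n + z)‖ ≤
      5 * ‖z - 1‖ ^ (1 / 2 : ℝ) * (1 / ((n : ℝ) + 1) ^ (3 / 2 : ℝ)) := by
  have hn : (0 : ℝ) < n + 1 := by positivity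
  have h1 := mul_le_norm_natCast_add (by norm_num) hz n
  have h0 : 0 < ‖(n : ℂ) + z‖ := lt_of_lt_of_le (by positivity) h1
  have h2 : ‖z - 1‖ ≤ 5 * ‖(n : ℂ) + z‖ := by
    have : z - 1 = (n + z) - ((n + 1 : ℕ) : ℂ) := by push_cast; ring
    rw [this]
    refine (norm_sub_le _ _).trans ?_
    rw [Complex.norm_natCast]
    push_cast
    linarith
  have hs : (‖z - 1‖ ^ (1 / 2 : ℝ)) ^ 2 = ‖z - 1‖ := by
    rw [← rpow_natCast, ← rpow_mul (norm_nonneg _)]; norm_num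
  have ht : ((n + 1 : ℝ) ^ (1 / 2 : ℝ)) ^ 2 = n + 1 := by
    rw [← rpow_natCast, ← rpow_mul hn.le]; norm_num
  have h3 : (n + 1 : ℝ) ^ (3 / 2 : ℝ) = (n + 1) * (n + 1) ^ (1 / 2 : ℝ) := by
    rw [← rpow_one_add' hn.le (by norm_num)]; norm_num
  have hspos : 0 ≤ ‖z - 1‖ ^ (1 / 2 : ℝ) := by positivity
  have htpos : 0 < (n + 1 : ℝ) ^ (1 / 2 : ℝ) := by positivity
  rw [norm_one_div_sub_one_div (by linarith), h3]
  generalize ‖z - 1‖ ^ (1 / 2 : ℝ) = s at *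
  generalize (n + 1 : ℝ) ^ (1 / 2 : ℝ) = t at *
  rw [mul_one_div, div_le_div_iff₀ (by positivity) (by positivity)]
  have h4 : s * t ≤ 5 * ‖(n : ℂ) + z‖ := by
    refine le_of_sq_le_sq ?_ (by positivity)
    nlinarith
  calc ‖z - 1‖ * ((n + 1) * t) = (s * t) * (s * (n + 1)) := by rw [← hs]; ring
    _ ≤ (5 * ‖(n : ℂ) + z‖) * (s * (n + 1)) := by gcongr
    _ = _ := by ring

theorem summable_one_div_nat_add_one_sq : Summable fun n : ℕ => 1 / ((n : ℝ) + 1) ^ 2 := by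
  have := (summable_nat_add_iff 1).2 (Real.summable_one_div_nat_pow.2 one_lt_two)
  simpa using this

theorem summable_one_div_sub_one_div {z : ℂ} (hz : 0 < z.re) :
    Summable fun n : ℕ => 1 / ((n : ℂ) + 1) - 1 / (n + z) := by
  refine Summable.of_norm_bounded
    (summable_one_div_nat_add_one_sq.mul_left (‖z - 1‖ / min z.re 1)) fun n => ?_
  exact norm_one_div_sub_one_div_le (lt_min hz one_pos) (min_le_right _ _) (min_le_left _ _) n

theorem Complex.deriv_Gamma_div_Gamma_eq_tsum_ofReal {x : ℝ} (hx : 0 < x) :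
    deriv Complex.Gamma x / Complex.Gamma x =
      -(eulerMascheroniConstant : ℂ) + ∑' n : ℕ, (1 / ((n : ℂ) + 1) - 1 / (n + (x : ℂ))) := by
  have h1 := (summable_one_div_sub_one_div (z := (x : ℂ)) (by simpa using hx)).hasSum.tendsto_sum_nat
  have h2 := (Complex.continuous_ofReal.tendsto _).comp (tendsto_sum_one_div_sub_one_div hx)
  have h3 : (Complex.ofReal ∘ fun N : ℕ =>
      ∑ n ∈ Finset.range N, (1 / ((n : ℝ) + 1) - 1 / (n + x))) =
      fun N : ℕ => ∑ n ∈ Finset.range N, (1 / ((n : ℂ) + 1) - 1 / (n + (x : ℂ))) := by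
    ext N
    simp
  rw [h3] at h2
  rw [tendsto_nhds_unique h1 h2, Complex.deriv_Gamma_div_Gamma_ofReal hx]
  push_cast
  ring

theorem Complex.deriv_Gamma_div_Gamma_eq_tsum {z : ℂ} (hz : 0 < z.re) :
    deriv Complex.Gamma z / Complex.Gamma z =
      -(eulerMascheroniConstant : ℂ) + ∑' n : ℕ, (1 / ((n : ℂ) + 1) - 1 / (n + z)) := by
  set c := min z.re 1 / 2 with hc
  have hc0 : 0 < c := by have := lt_min hz one_pos; positivity
  have hcz : c < z.re := by have := min_le_left z.re 1; linarith
  have hc1 : c < 1 := by have := min_le_right z.re 1; linarith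
  set U : Set ℂ := {w | c < w.re} ∩ Metric.ball 0 (‖z‖ + 2) with hU
  have hUo : IsOpen U := (isOpen_lt continuous_const Complex.continuous_re).inter Metric.isOpen_ball
  have hUc : IsPreconnected U :=
    ((convex_halfSpace_re_gt c).inter (convex_ball 0 (‖z‖ + 2))).isPreconnected
  have hzU : z ∈ U := ⟨hcz, by simp⟩
  have h1U : (1 : ℂ) ∈ U := ⟨by simpa using hc1, by simp; linarith [norm_nonneg z]⟩
  have hpos : ∀ w ∈ U, 0 < w.re := fun w hw => hc0.trans hw.1
  have hne : ∀ w ∈ U, ∀ m : ℕ, w ≠ -m := fun w hw m h => by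
    have h1 := hpos w hw
    rw [h] at h1
    simp only [Complex.neg_re, Complex.natCast_re] at h1
    have : (0 : ℝ) ≤ m := m.cast_nonneg
    linarith
  have hGd : DifferentiableOn ℂ Complex.Gamma U := fun w hw =>
    (Complex.differentiableAt_Gamma w (hne w hw)).differentiableWithinAt
  have hf : AnalyticOnNhd ℂ (fun w => deriv Complex.Gamma w / Complex.Gamma w) U :=
    ((hGd.deriv hUo).div hGd fun w hw => Complex.Gamma_ne_zero (hne w hw)).analyticOnNhd hUo
  have hsum : DifferentiableOn ℂ
      (fun w : ℂ => ∑' n : ℕ, (1 / ((n : ℂ) + 1) - 1 / (n + w))) U := by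
    refine Complex.differentiableOn_tsum_of_summable_norm
      (summable_one_div_nat_add_one_sq.mul_left ((‖z‖ + 3) / c)) (fun n w hw => ?_) hUo
      fun n w hw => ?_
    · have : (n : ℂ) + w ≠ 0 := fun h => hne w hw n (eq_neg_of_add_eq_zero_right h)
      exact DifferentiableAt.differentiableWithinAt (by fun_prop (disch := assumption))
    · refine (norm_one_div_sub_one_div_le hc0 hc1.le hw.1.le n).trans ?_
      have h1 : ‖w - 1‖ ≤ ‖z‖ + 3 := by
        have h2 := hw.2
        rw [mem_ball_zero_iff] at h2
        have h3 := norm_sub_le w 1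
        rw [norm_one] at h3
        linarith
      gcongr
  have hg : AnalyticOnNhd ℂ (fun w => -(eulerMascheroniConstant : ℂ) +
      ∑' n : ℕ, (1 / ((n : ℂ) + 1) - 1 / (n + w))) U :=
    (hsum.const_add _).analyticOnNhd hUo
  refine hf.eqOn_of_preconnected_of_frequently_eq hg hUc h1U ?_ hzU
  have ht : Filter.Tendsto (fun x : ℝ => (x : ℂ)) (nhdsWithin 1 {1}ᶜ) (nhdsWithin 1 {1}ᶜ) := by
    refine tendsto_nhdsWithin_iff.2 ⟨?_, ?_⟩
    · exact (Complex.continuous_ofReal.tendsto' 1 1 (by simp)).mono_left nhdsWithin_le_nhds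
    · filter_upwards [self_mem_nhdsWithin] with x hx
      simpa using hx
  refine ht.frequently (Filter.Eventually.frequently ?_)
  filter_upwards [nhdsWithin_le_nhds (eventually_gt_nhds (zero_lt_one' ℝ))] with x hx
  exact Complex.deriv_Gamma_div_Gamma_eq_tsum_ofReal hx

theorem integral_minorantKernel : ∫ w : ℝ, (minorantKernel w : ℂ) = 4 := by
  have h := integral_exp_mul_minorantKernel 0
  simp only [mul_zero, neg_zero, Complex.ofReal_zero, zero_mul, Complex.exp_zero, one_mul] at h
  rw [h, minorantTransform_of_mem (by simp)]
  simp [minorantHat]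

theorem integral_minorantKernel_div {b : ℂ} (hb : 0 < b.re) :
    ∫ w : ℝ, (minorantKernel w : ℂ) / (b + 2 * π * w * Complex.I) =
      4 * ∫ x in (0 : ℝ)..1, Complex.exp (-b * x) * (minorantHat x : ℂ) := by
  have hre : ∀ w : ℝ, (-(b + 2 * π * w * Complex.I)).re = -b.re := fun w => by simp
  have h1 : ∀ w : ℝ, (minorantKernel w : ℂ) / (b + 2 * π * w * Complex.I) =
      ∫ x in Set.Ioi (0 : ℝ), (minorantKernel w : ℂ) *
        Complex.exp (-(b + 2 * π * w * Complex.I) * x) := by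
    intro w
    rw [integral_const_mul, integral_exp_mul_complex_Ioi (by rw [hre]; linarith)]
    simp only [Complex.ofReal_zero, mul_zero, Complex.exp_zero, neg_div_neg_eq, mul_one_div]
  simp only [h1]
  have hm := measurable_minorantKernel
  have hprod : Integrable (Function.uncurry fun (w x : ℝ) => (minorantKernel w : ℂ) *
      Complex.exp (-(b + 2 * π * w * Complex.I) * x))
      (volume.prod (volume.restrict (Set.Ioi (0 : ℝ)))) := by
    refine (integrable_minorantKernel.norm.mul_prod
      (exp_neg_integrableOn_Ioi 0 hb)).mono' ?_ (Filter.Eventually.of_forall fun p => ?_)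
    · refine Measurable.aestronglyMeasurable ?_
      unfold Function.uncurry
      fun_prop
    · simp only [Function.uncurry]
      rw [norm_mul, Complex.norm_real, Complex.norm_exp]
      simp
  rw [integral_integral_swap hprod]
  have h2 : ∀ x : ℝ, ∫ w : ℝ, (minorantKernel w : ℂ) *
      Complex.exp (-(b + 2 * π * w * Complex.I) * x) =
      Complex.exp (-b * x) * (minorantTransform x : ℂ) := by
    intro x
    rw [← integral_exp_mul_minorantKernel, ← integral_const_mul]
    congr 1 with w
    have : -(b + 2 * π * w * Complex.I) * x =
      -b * x + ((-(2 * π * w * x) : ℝ) : ℂ) * Complex.I := by push_cast; ring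
    rw [this, Complex.exp_add]
    ring
  simp only [h2]
  rw [setIntegral_eq_of_subset_of_forall_sdiff_eq_zero measurableSet_Ioi
    (Set.Ioc_subset_Ioi_self : Set.Ioc (0 : ℝ) 1 ⊆ Set.Ioi 0) fun x hx => ?_,
    ← intervalIntegral.integral_of_le zero_le_one, ← intervalIntegral.integral_const_mul]
  · refine intervalIntegral.integral_congr fun x hx => ?_
    rw [Set.uIcc_of_le zero_le_one] at hx
    simp only [minorantTransform_of_mem hx]
    push_cast
    ring
  · have h3 : 1 ≤ |x| := by
      by_contra! h
      exact hx.2 ⟨hx.1, (le_abs_self x).trans h.le⟩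
    rw [minorantTransform_of_one_le_abs h3]
    simp

theorem integrable_minorantKernel_div {b : ℂ} (hb : 0 < b.re) :
    Integrable fun w : ℝ => (minorantKernel w : ℂ) / (b + 2 * π * w * Complex.I) := by
  have hm := measurable_minorantKernel
  refine (integrable_minorantKernel.norm.const_mul (1 / b.re)).mono'
    (Measurable.aestronglyMeasurable (by fun_prop)) (Filter.Eventually.of_forall fun w => ?_)
  have h1 : b.re ≤ ‖b + 2 * π * w * Complex.I‖ := by
    simpa using Complex.re_le_norm (b + 2 * π * w * Complex.I)
  rw [norm_div, Complex.norm_real, div_eq_mul_one_div, mul_comm]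
  gcongr

/-- The line on which the digamma function is integrated, in the rescaled variable. -/
noncomputable def gammaLine (μ : ℂ) (w : ℝ) : ℂ := 1 / 4 + μ + π * w / log 2 * Complex.I

theorem gammaLine_re (μ : ℂ) (w : ℝ) : (gammaLine μ w).re = 1 / 4 + μ.re := by
  have : (π * w / log 2 * Complex.I : ℂ) = ((π * w / log 2 : ℝ) : ℂ) * Complex.I := by push_cast; rfl
  rw [gammaLine, this, Complex.add_re, Complex.re_ofReal_mul, Complex.I_re, mul_zero, add_zero,
    Complex.add_re]
  norm_num

theorem one_div_nat_add_gammaLine (μ : ℂ) (w : ℝ) (n : ℕ) :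
    1 / ((n : ℂ) + gammaLine μ w) =
      2 * log 2 / (2 * log 2 * (n + 1 / 4 + μ) + 2 * π * w * Complex.I) := by
  have hl : (log 2 : ℂ) ≠ 0 := Complex.ofReal_ne_zero.2 (log_pos one_lt_two).ne'
  have : 2 * log 2 * (n + 1 / 4 + μ) + 2 * π * w * Complex.I =
      (2 * log 2) * ((n : ℂ) + gammaLine μ w) := by
    rw [gammaLine]
    field_simp
    ring
  rw [this, div_mul_cancel_left₀ (by simpa using hl), one_div]

theorem integrable_minorantKernel_mul_term {μ : ℂ} (hμ : 0 ≤ μ.re) (n : ℕ) :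
    Integrable (fun w : ℝ => (minorantKernel w : ℂ) *
      (1 / ((n : ℂ) + 1) - 1 / (n + gammaLine μ w))) ∧
    ∫ w : ℝ, (minorantKernel w : ℂ) * (1 / ((n : ℂ) + 1) - 1 / (n + gammaLine μ w)) =
      4 * (1 / ((n : ℂ) + 1) - 2 * log 2 * ∫ x in (0 : ℝ)..1,
        Complex.exp (-(2 * log 2 * (n + 1 / 4 + μ)) * x) * (minorantHat x : ℂ)) := by
  have hb : 0 < (2 * log 2 * (n + 1 / 4 + μ) : ℂ).re := by
    have h1 : (2 * log 2 * (n + 1 / 4 + μ) : ℂ) =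
      ((2 * log 2 : ℝ) : ℂ) * (((n + 1 / 4 : ℝ) : ℂ) + μ) := by push_cast; rfl
    have : 0 < log 2 := log_pos one_lt_two
    rw [h1, Complex.re_ofReal_mul, Complex.add_re, Complex.ofReal_re]
    positivity
  have e : ∀ w : ℝ, (minorantKernel w : ℂ) * (1 / ((n : ℂ) + 1) - 1 / (n + gammaLine μ w)) =
      (minorantKernel w : ℂ) * (1 / ((n : ℂ) + 1)) - 2 * log 2 * ((minorantKernel w : ℂ) /
        (2 * log 2 * (n + 1 / 4 + μ) + 2 * π * w * Complex.I)) := by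
    intro w
    rw [one_div_nat_add_gammaLine]
    ring
  simp only [e]
  have i1 : Integrable fun w : ℝ => (minorantKernel w : ℂ) * (1 / ((n : ℂ) + 1)) :=
    integrable_minorantKernel.ofReal.mul_const _
  have i2 := (integrable_minorantKernel_div hb).const_mul (2 * log 2 : ℂ)
  refine ⟨i1.sub i2, ?_⟩
  rw [integral_sub i1 i2, integral_mul_const, integral_const_mul, integral_minorantKernel,
    integral_minorantKernel_div hb]
  ring

theorem exists_norm_minorantKernel_mul_term_le {μ : ℂ} (hμ : 0 ≤ μ.re) :
    ∃ A : ℝ, 0 ≤ A ∧ ∀ (n : ℕ) (w : ℝ),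
      ‖(minorantKernel w : ℂ) * (1 / ((n : ℂ) + 1) - 1 / (n + gammaLine μ w))‖ ≤
        A * ‖(1 + |w|) ^ (1 / 2 : ℝ) * minorantKernel w‖ * (1 / ((n : ℝ) + 1) ^ (3 / 2 : ℝ)) := by
  have hl : 0 < log 2 := log_pos one_lt_two
  set K : ℝ := ‖μ‖ + 1 + π / log 2 with hK
  have hK0 : 0 ≤ K := by positivity
  refine ⟨5 * K ^ (1 / 2 : ℝ), by positivity, fun n w => ?_⟩
  have h1 := norm_one_div_sub_one_div_le_rpow (z := gammaLine μ w)
    (by rw [gammaLine_re]; linarith) n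
  have h2 : ‖gammaLine μ w - 1‖ ≤ K * (1 + |w|) := by
    have : gammaLine μ w - 1 = μ + ((-(3 / 4) : ℝ) : ℂ) +
      ((π / log 2 * w : ℝ) : ℂ) * Complex.I := by
      rw [gammaLine]; push_cast; ring
    rw [this]
    refine (norm_add₃_le).trans ?_
    rw [norm_mul, Complex.norm_real, Complex.norm_real, Complex.norm_I, mul_one,
      Real.norm_eq_abs, Real.norm_eq_abs, abs_mul, abs_of_pos (by positivity : 0 < π / log 2),
      abs_neg, abs_of_pos (by norm_num : (0 : ℝ) < 3 / 4)]
    have h3 : 0 ≤ ‖μ‖ * |w| := by positivity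
    have h4 : 0 < π / log 2 := by positivity
    rw [hK]
    nlinarith [abs_nonneg w]
  have h5 : ‖gammaLine μ w - 1‖ ^ (1 / 2 : ℝ) ≤ K ^ (1 / 2 : ℝ) * (1 + |w|) ^ (1 / 2 : ℝ) := by
    rw [← mul_rpow hK0 (by positivity)]
    gcongr
  rw [norm_mul, norm_mul, Complex.norm_real,
    Real.norm_of_nonneg (by positivity : 0 ≤ (1 + |w|) ^ (1 / 2 : ℝ))]
  calc ‖minorantKernel w‖ * ‖1 / ((n : ℂ) + 1) - 1 / (n + gammaLine μ w)‖
      ≤ ‖minorantKernel w‖ * (5 * (K ^ (1 / 2 : ℝ) * (1 + |w|) ^ (1 / 2 : ℝ)) *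
        (1 / ((n : ℝ) + 1) ^ (3 / 2 : ℝ))) := by
        gcongr
        exact h1.trans (by gcongr)
    _ = _ := by ring

theorem summable_one_div_nat_add_one_rpow :
    Summable fun n : ℕ => 1 / ((n : ℝ) + 1) ^ (3 / 2 : ℝ) := by
  have := (summable_nat_add_iff 1).2
    (Real.summable_one_div_nat_rpow.2 (by norm_num : (1 : ℝ) < 3 / 2))
  simpa using this

theorem measurable_deriv_Gamma_div_Gamma_gammaLine (μ : ℂ) :
    Measurable fun w : ℝ =>
      deriv Complex.Gamma (gammaLine μ w) / Complex.Gamma (gammaLine μ w) := by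
  have h1 : Measurable (gammaLine μ) := by
    unfold gammaLine
    fun_prop
  have h2 : Measurable Complex.Gamma := by
    simpa [Pi.inv_def] using Complex.differentiable_one_div_Gamma.continuous.measurable.inv
  exact ((measurable_deriv _).comp h1).div (h2.comp h1)

theorem hasSum_integral_gammaLine {μ : ℂ} (hμ : 0 ≤ μ.re) :
    HasSum (fun n : ℕ => 4 * (1 / ((n : ℂ) + 1) - 2 * log 2 * ∫ x in (0 : ℝ)..1,
        Complex.exp (-(2 * log 2 * (n + 1 / 4 + μ)) * x) * (minorantHat x : ℂ)))
      ((∫ w : ℝ, deriv Complex.Gamma (gammaLine μ w) / Complex.Gamma (gammaLine μ w) *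
        (minorantKernel w : ℂ)) + 4 * eulerMascheroniConstant) := by
  obtain ⟨A, hA0, hA⟩ := exists_norm_minorantKernel_mul_term_le hμ
  have hs := summable_one_div_nat_add_one_rpow
  have hI := integrable_one_add_abs_rpow_mul_minorantKernel.norm
  have hsum : Summable fun n : ℕ => ∫ w : ℝ, ‖(minorantKernel w : ℂ) *
      (1 / ((n : ℂ) + 1) - 1 / (n + gammaLine μ w))‖ := by
    refine Summable.of_nonneg_of_le (fun n => integral_nonneg fun w => norm_nonneg _) (fun n => ?_)
      (hs.mul_left (A * ∫ w : ℝ, ‖(1 + |w|) ^ (1 / 2 : ℝ) * minorantKernel w‖))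
    refine (integral_mono (integrable_minorantKernel_mul_term hμ n).1.norm
      ((hI.const_mul A).mul_const _) (hA n)).trans_eq ?_
    rw [integral_mul_const, integral_const_mul]
  have h := hasSum_integral_of_summable_integral_norm
    (fun n => (integrable_minorantKernel_mul_term hμ n).1) hsum
  simp only [(integrable_minorantKernel_mul_term hμ _).2] at h
  have hseries : ∀ w : ℝ,
      deriv Complex.Gamma (gammaLine μ w) / Complex.Gamma (gammaLine μ w) * (minorantKernel w : ℂ) +
        eulerMascheroniConstant * (minorantKernel w : ℂ) =
      ∑' n : ℕ, (minorantKernel w : ℂ) * (1 / ((n : ℂ) + 1) - 1 / (n + gammaLine μ w)) := by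
    intro w
    rw [Complex.deriv_Gamma_div_Gamma_eq_tsum (by rw [gammaLine_re]; linarith), tsum_mul_left]
    ring
  have hi : Integrable fun w : ℝ => eulerMascheroniConstant * (minorantKernel w : ℂ) :=
    integrable_minorantKernel.ofReal.const_mul _
  have hm := measurable_minorantKernel
  have hm' := measurable_deriv_Gamma_div_Gamma_gammaLine μ
  have hprod : Integrable fun w : ℝ => deriv Complex.Gamma (gammaLine μ w) /
      Complex.Gamma (gammaLine μ w) * (minorantKernel w : ℂ) +
        eulerMascheroniConstant * (minorantKernel w : ℂ) := by
    refine ((hI.const_mul A).mul_const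
      (∑' n : ℕ, 1 / ((n : ℝ) + 1) ^ (3 / 2 : ℝ))).mono'
      (Measurable.aestronglyMeasurable (by fun_prop)) (Filter.Eventually.of_forall fun w => ?_)
    rw [hseries, ← tsum_mul_left]
    exact tsum_of_norm_bounded (hs.mul_left _).hasSum fun n => hA n w
  have hprod' := hprod.sub hi
  simp only [Pi.sub_def, add_sub_cancel_right] at hprod'
  simp only [← hseries] at h
  rwa [integral_add hprod' hi, integral_const_mul, integral_minorantKernel, mul_comm _ (4 : ℂ)] at h

theorem exp_neg_two_mul_log_two : Complex.exp (-(2 * log 2)) = 1 / 4 := by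
  have : (-(2 * log 2) : ℂ) = ((-(2 * log 2) : ℝ) : ℂ) := by push_cast; rfl
  rw [this, ← Complex.ofReal_exp, Real.exp_neg, two_mul, Real.exp_add, Real.exp_log two_pos]
  push_cast
  norm_num

theorem one_div_nat_add_one_eq (n : ℕ) :
    1 / ((n : ℂ) + 1) = (((1 / 4 : ℝ) ^ (n + 1) / (n + 1) : ℝ) : ℂ) +
      2 * log 2 * ∫ x in (0 : ℝ)..1, Complex.exp (-(2 * log 2 * (n + 1)) * x) := by
  have hl : (log 2 : ℂ) ≠ 0 := Complex.ofReal_ne_zero.2 (log_pos one_lt_two).ne'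
  have hn : (n : ℂ) + 1 ≠ 0 := Nat.cast_add_one_ne_zero n
  have hc : (-(2 * log 2 * (n + 1)) : ℂ) ≠ 0 := by
    simp only [ne_eq, neg_eq_zero, mul_eq_zero, not_or]
    exact ⟨⟨two_ne_zero, hl⟩, hn⟩
  have he : Complex.exp (-(2 * log 2 * (n + 1))) = (1 / 4) ^ (n + 1) := by
    rw [← exp_neg_two_mul_log_two, ← Complex.exp_nat_mul]
    congr 1
    push_cast
    ring
  rw [integral_exp_mul_complex hc]
  simp only [Complex.ofReal_one, mul_one, Complex.ofReal_zero, mul_zero, Complex.exp_zero, he]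
  push_cast
  field_simp
  ring

/-- The integrand of the limiting integral obtained by summing the digamma series. -/
noncomputable def gammaIntegrand (μ : ℂ) (x : ℝ) : ℂ :=
  2 * log 2 * (Complex.exp (-(2 * log 2) * x) -
    Complex.exp (-(2 * log 2 * (1 / 4 + μ)) * x) * (minorantHat x : ℂ)) /
      (1 - Complex.exp (-(2 * log 2) * x))

theorem gammaIntegrand_eq (μ : ℂ) {x : ℝ} (hx : 0 < x) :
    gammaIntegrand μ x = ((2 * log 2 / (exp (2 * log 2 * x) - 1) - 1 / x : ℝ) : ℂ) +
      (1 - Complex.exp (-(2 * log 2 * μ) * x) * (weight x : ℂ)) / x := by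
  have hl : 0 < log 2 := log_pos one_lt_two
  have hexp : 1 < exp (2 * log 2 * x) := one_lt_exp_iff.2 (by positivity)
  have h1 : Complex.exp (-(2 * log 2) * x) = ((exp (-(2 * log 2 * x)) : ℝ) : ℂ) := by
    push_cast
    congr 1
    ring
  have h2 : Complex.exp (-(2 * log 2 * (1 / 4 + μ)) * x) =
      ((exp (-(2 * log 2 * x) / 4) : ℝ) : ℂ) * Complex.exp (-(2 * log 2 * μ) * x) := by
    push_cast
    rw [← Complex.exp_add]
    congr 1
    ring
  have h3 : 2 * log 2 / (exp (2 * log 2 * x) - 1) =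
      2 * log 2 * exp (-(2 * log 2 * x)) / (1 - exp (-(2 * log 2 * x))) := by
    rw [exp_neg]
    have : exp (2 * log 2 * x) - 1 ≠ 0 := by linarith
    field_simp
  have h4 : (1 : ℂ) - ((exp (-(2 * log 2 * x)) : ℝ) : ℂ) ≠ 0 := by
    have : exp (-(2 * log 2 * x)) < 1 := exp_lt_one_iff.2 (by simp; positivity)
    rw [← Complex.ofReal_one, ← Complex.ofReal_sub, Complex.ofReal_ne_zero]
    linarith
  have hx' : (x : ℂ) ≠ 0 := Complex.ofReal_ne_zero.2 hx.ne'
  rw [gammaIntegrand, h3, weight, h1, h2]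
  push_cast at h4 ⊢
  generalize Complex.exp (-(2 * log 2 * x)) = E at *
  field_simp
  ring

theorem two_log_two_div_exp_sub_one_bounds {x : ℝ} (h0 : 0 < x) (h1 : x ≤ 1) :
    -(2 * log 2) / 2 + (2 * log 2) ^ 2 / 12 * x - (2 * log 2) ^ 4 / 720 * x ^ 3 ≤
      2 * log 2 / (exp (2 * log 2 * x) - 1) - 1 / x ∧
    2 * log 2 / (exp (2 * log 2 * x) - 1) - 1 / x ≤ 0 := by
  have hl : 0 < log 2 := log_pos one_lt_two
  have hl2 := log_two_lt_d9
  have hu : 0 < 2 * log 2 * x := by positivity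
  have h := inv_exp_sub_one_ge hu (by nlinarith)
  have e : 1 / x = 2 * log 2 * (1 / (2 * log 2 * x)) := by field_simp
  have e2 : 2 * log 2 / (exp (2 * log 2 * x) - 1) =
      2 * log 2 * (1 / (exp (2 * log 2 * x) - 1)) := div_eq_mul_one_div _ _
  rw [e, e2]
  constructor
  · have := mul_le_mul_of_nonneg_left h (by positivity : 0 ≤ 2 * log 2)
    linarith
  · have : 1 / (exp (2 * log 2 * x) - 1) ≤ 1 / (2 * log 2 * x) :=
      one_div_le_one_div_of_le hu (by linarith [add_one_le_exp (2 * log 2 * x)])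
    nlinarith

theorem intervalIntegrable_two_log_two_div_exp_sub_one :
    IntervalIntegrable (fun x : ℝ => 2 * log 2 / (exp (2 * log 2 * x) - 1) - 1 / x)
      volume 0 1 := by
  have hb : IntervalIntegrable (fun x : ℝ => -(2 * log 2) / 2 + (2 * log 2) ^ 2 / 12 * x -
      (2 * log 2) ^ 4 / 720 * x ^ 3) volume 0 1 := Continuous.intervalIntegrable (by fun_prop) _ _
  refine hb.mono_fun (Measurable.aestronglyMeasurable (by fun_prop)) ?_
  rw [Filter.EventuallyLE, ae_restrict_iff' measurableSet_uIoc]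
  refine Filter.Eventually.of_forall fun x hx => ?_
  rw [Set.uIoc_of_le zero_le_one] at hx
  obtain ⟨h1, h2⟩ := two_log_two_div_exp_sub_one_bounds hx.1 hx.2
  rw [Real.norm_eq_abs, Real.norm_eq_abs, abs_of_nonpos h2, abs_of_nonpos (h1.trans h2)]
  linarith

theorem intervalIntegrable_ofReal_two_log_two_div_exp_sub_one :
    IntervalIntegrable (fun x : ℝ =>
      ((2 * log 2 / (exp (2 * log 2 * x) - 1) - 1 / x : ℝ) : ℂ)) volume 0 1 :=
  ⟨intervalIntegrable_two_log_two_div_exp_sub_one.1.ofReal,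
    intervalIntegrable_two_log_two_div_exp_sub_one.2.ofReal⟩

theorem intervalIntegrable_gammaIntegrand (μ : ℂ) :
    IntervalIntegrable (gammaIntegrand μ) volume 0 1 := by
  refine (intervalIntegrable_ofReal_two_log_two_div_exp_sub_one.add
    (intervalIntegrable_one_sub_exp_mul_weight (2 * log 2 * μ))).congr fun x hx => ?_
  rw [Set.uIoc_of_le zero_le_one] at hx
  exact (gammaIntegrand_eq μ hx.1).symm

theorem le_re_integral_gammaIntegrand {μ : ℂ} (hμ : 0 ≤ μ.re) :
    (-(2 * log 2) / 2 + (2 * log 2) ^ 2 / 24 - (2 * log 2) ^ 4 / 2880) + 20491 / 10000 ≤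
      (∫ x in (0 : ℝ)..1, gammaIntegrand μ x).re := by
  have hi := intervalIntegrable_two_log_two_div_exp_sub_one
  have e : ∫ x in (0 : ℝ)..1, gammaIntegrand μ x =
      ((∫ x in (0 : ℝ)..1, (2 * log 2 / (exp (2 * log 2 * x) - 1) - 1 / x) : ℝ) : ℂ) +
      ∫ x in (0 : ℝ)..1, (1 - Complex.exp (-(2 * log 2 * μ) * x) * (weight x : ℂ)) / x := by
    rw [← intervalIntegral.integral_ofReal, ← intervalIntegral.integral_add
      intervalIntegrable_ofReal_two_log_two_div_exp_sub_one
      (intervalIntegrable_one_sub_exp_mul_weight (2 * log 2 * μ))]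
    refine intervalIntegral.integral_congr_ae (Filter.Eventually.of_forall fun x hx => ?_)
    rw [Set.uIoc_of_le zero_le_one] at hx
    exact gammaIntegrand_eq μ hx.1
  have hs : 0 ≤ (2 * log 2 * μ : ℂ).re := by
    have h1 : (2 * log 2 * μ : ℂ) = ((2 * log 2 : ℝ) : ℂ) * μ := by push_cast; rfl
    have : 0 < log 2 := log_pos one_lt_two
    rw [h1, Complex.re_ofReal_mul]
    positivity
  rw [e, Complex.add_re, Complex.ofReal_re]
  refine add_le_add ?_ (re_integral_one_sub_exp_mul_weight_ge hs)
  have hp : ∫ x in (0 : ℝ)..1, (-(2 * log 2) / 2 + (2 * log 2) ^ 2 / 12 * x -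
      (2 * log 2) ^ 4 / 720 * x ^ 3) =
      -(2 * log 2) / 2 + (2 * log 2) ^ 2 / 24 - (2 * log 2) ^ 4 / 2880 := by
    rw [intervalIntegral.integral_sub (Continuous.intervalIntegrable (by fun_prop) _ _)
      (Continuous.intervalIntegrable (by fun_prop) _ _),
      intervalIntegral.integral_add (Continuous.intervalIntegrable (by fun_prop) _ _)
      (Continuous.intervalIntegrable (by fun_prop) _ _),
      intervalIntegral.integral_const_mul, intervalIntegral.integral_const_mul, integral_pow,
      integral_id]
    simp
    ring
  rw [← hp]
  refine intervalIntegral.integral_mono_on_of_le_Ioo zero_le_one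
    (Continuous.intervalIntegrable (by fun_prop) _ _) hi fun x hx => ?_
  exact (two_log_two_div_exp_sub_one_bounds hx.1 hx.2.le).1

theorem tendsto_integral_one_sub_pow_mul_gammaIntegrand (μ : ℂ) :
    Filter.Tendsto (fun N : ℕ => ∫ x in (0 : ℝ)..1,
        (1 - Complex.exp (-(2 * log 2) * x) ^ N) * gammaIntegrand μ x)
      Filter.atTop (nhds (∫ x in (0 : ℝ)..1, gammaIntegrand μ x)) := by
  have hl : 0 < log 2 := log_pos one_lt_two
  have hi := intervalIntegrable_gammaIntegrand μ
  have hlt : ∀ x : ℝ, 0 < x → ‖Complex.exp (-(2 * log 2) * x)‖ < 1 := by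
    intro x hx
    rw [Complex.norm_exp]
    refine exp_lt_one_iff.2 ?_
    have : (-(2 * log 2) * x : ℂ) = ((-(2 * log 2 * x) : ℝ) : ℂ) := by push_cast; ring
    rw [this, Complex.ofReal_re]
    simp only [Left.neg_neg_iff]
    positivity
  refine intervalIntegral.tendsto_integral_filter_of_dominated_convergence
    (fun x => 2 * ‖gammaIntegrand μ x‖) (Filter.Eventually.of_forall fun N => ?_)
    (Filter.Eventually.of_forall fun N => Filter.Eventually.of_forall fun x hx => ?_)
    (hi.norm.const_mul 2) (Filter.Eventually.of_forall fun x hx => ?_)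
  · exact (Continuous.aestronglyMeasurable (by fun_prop)).mul hi.def'.aestronglyMeasurable
  · rw [Set.uIoc_of_le zero_le_one] at hx
    rw [norm_mul]
    gcongr
    refine (norm_sub_le _ _).trans ?_
    rw [norm_one, norm_pow]
    linarith [pow_le_one₀ (n := N) (norm_nonneg _) (hlt x hx.1).le]
  · rw [Set.uIoc_of_le zero_le_one] at hx
    have h1 := tendsto_pow_atTop_nhds_zero_of_norm_lt_one (hlt x hx.1)
    simpa using (h1.const_sub 1).mul_const (gammaIntegrand μ x)

theorem sum_one_div_sub_integral (μ : ℂ) (N : ℕ) :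
    ∑ n ∈ Finset.range N, (1 / ((n : ℂ) + 1) - 2 * log 2 * ∫ x in (0 : ℝ)..1,
        Complex.exp (-(2 * log 2 * (n + 1 / 4 + μ)) * x) * (minorantHat x : ℂ)) =
      ((∑ n ∈ Finset.range N, (1 / 4 : ℝ) ^ (n + 1) / (n + 1) : ℝ) : ℂ) +
        ∫ x in (0 : ℝ)..1, (1 - Complex.exp (-(2 * log 2) * x) ^ N) * gammaIntegrand μ x := by
  have hc : Continuous fun x : ℝ => (minorantHat x : ℂ) := by
    unfold minorantHat
    fun_prop
  have h1 : ∀ n : ℕ, 1 / ((n : ℂ) + 1) - 2 * log 2 * (∫ x in (0 : ℝ)..1,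
        Complex.exp (-(2 * log 2 * (n + 1 / 4 + μ)) * x) * (minorantHat x : ℂ)) =
      (((1 / 4 : ℝ) ^ (n + 1) / (n + 1) : ℝ) : ℂ) + ∫ x in (0 : ℝ)..1,
        2 * log 2 * (Complex.exp (-(2 * log 2 * (n + 1)) * x) -
          Complex.exp (-(2 * log 2 * (n + 1 / 4 + μ)) * x) * (minorantHat x : ℂ)) := by
    intro n
    rw [one_div_nat_add_one_eq, intervalIntegral.integral_const_mul, intervalIntegral.integral_sub
      (Continuous.intervalIntegrable (by fun_prop) _ _)
      (Continuous.intervalIntegrable (by fun_prop) _ _)]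
    ring
  simp only [h1]
  rw [Finset.sum_add_distrib, Complex.ofReal_sum, ← intervalIntegral.integral_finsetSum
    fun n _ => Continuous.intervalIntegrable (by fun_prop) _ _]
  congr 1
  refine intervalIntegral.integral_congr_ae (Filter.Eventually.of_forall fun x hx => ?_)
  rw [Set.uIoc_of_le zero_le_one] at hx
  have h2 : Complex.exp (-(2 * log 2) * x) ≠ 1 := by
    have hl : 0 < log 2 := log_pos one_lt_two
    have : (-(2 * log 2) * x : ℂ) = ((-(2 * log 2 * x) : ℝ) : ℂ) := by push_cast; ring
    rw [this, ← Complex.ofReal_exp]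
    have h3 : exp (-(2 * log 2 * x)) < 1 := exp_lt_one_iff.2 (by
      simp only [Left.neg_neg_iff]
      have := hx.1
      positivity)
    exact_mod_cast h3.ne
  have h3 : ∀ n : ℕ, 2 * log 2 * (Complex.exp (-(2 * log 2 * (n + 1)) * x) -
      Complex.exp (-(2 * log 2 * (n + 1 / 4 + μ)) * x) * (minorantHat x : ℂ)) =
      Complex.exp (-(2 * log 2) * x) ^ n * (2 * log 2 * (Complex.exp (-(2 * log 2) * x) -
        Complex.exp (-(2 * log 2 * (1 / 4 + μ)) * x) * (minorantHat x : ℂ))) := by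
    intro n
    have e1 : Complex.exp (-(2 * log 2 * (n + 1)) * x) =
        Complex.exp (-(2 * log 2) * x) ^ n * Complex.exp (-(2 * log 2) * x) := by
      rw [← Complex.exp_nat_mul, ← Complex.exp_add]
      congr 1
      ring
    have e2 : Complex.exp (-(2 * log 2 * (n + 1 / 4 + μ)) * x) =
        Complex.exp (-(2 * log 2) * x) ^ n * Complex.exp (-(2 * log 2 * (1 / 4 + μ)) * x) := by
      rw [← Complex.exp_nat_mul, ← Complex.exp_add]
      congr 1
      ring
    rw [e1, e2]
    ring
  simp only [h3]
  rw [← Finset.sum_mul, geom_sum_eq h2, gammaIntegrand, ← neg_div_neg_eq, neg_sub, neg_sub]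
  ring

theorem integral_gammaLine {μ : ℂ} (hμ : 0 ≤ μ.re) :
    ∫ w : ℝ, deriv Complex.Gamma (gammaLine μ w) / Complex.Gamma (gammaLine μ w) *
        (minorantKernel w : ℂ) =
      4 * (-eulerMascheroniConstant + log (4 / 3) + ∫ x in (0 : ℝ)..1, gammaIntegrand μ x) := by
  have h1 := (hasSum_integral_gammaLine hμ).tendsto_sum_nat
  simp only [← Finset.mul_sum, sum_one_div_sub_integral] at h1
  have h2 := (hasSum_pow_div_log_of_abs_lt_one
    (x := 1 / 4) (by norm_num [abs_of_pos])).tendsto_sum_nat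
  have h3 : -log (1 - 1 / 4) = log (4 / 3) := by
    rw [← log_inv]
    norm_num
  rw [h3] at h2
  have h4 := (((Complex.continuous_ofReal.tendsto _).comp h2).add
    (tendsto_integral_one_sub_pow_mul_gammaIntegrand μ)).const_mul 4
  have h5 := tendsto_nhds_unique h1 h4
  linear_combination h5

/-- with `δ = (log 2)/(2π)`, `α = −2.5/δ`, `β = 2.5/δ` and `S₋` the
Selberg minorant for `[α, β]` with parameter `δ`, for every complex `μ` with
`Re μ ≥ 0` one has
`Re ∫ (Γ'/Γ)(1/4 + it/2 + μ) S₋(t) dt > Ŝ₋(0) log π`, where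
`Ŝ₋(0) = ∫ S₋ = 4/δ`. -/
theorem selberg_digamma_integral_pos :
    ∀ μ : ℂ, 0 ≤ μ.re →
      (4 / (Real.log 2 / (2 * Real.pi))) * Real.log Real.pi <
        (∫ t : ℝ,
          (deriv Complex.Gamma (1 / 4 + (t : ℂ) * Complex.I / 2 + μ) /
              Complex.Gamma (1 / 4 + (t : ℂ) * Complex.I / 2 + μ)) *
            ((selbergMinus (-2.5 / (Real.log 2 / (2 * Real.pi)))
                (2.5 / (Real.log 2 / (2 * Real.pi)))
                (Real.log 2 / (2 * Real.pi)) t : ℝ) : ℂ)).re := by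
  intro μ hμ
  have hl : 0 < log 2 := log_pos one_lt_two
  set δ : ℝ := log 2 / (2 * π) with hδ
  have hδ0 : 0 < δ := by positivity
  have h1 : ∫ t : ℝ, (deriv Complex.Gamma (1 / 4 + (t : ℂ) * Complex.I / 2 + μ) /
        Complex.Gamma (1 / 4 + (t : ℂ) * Complex.I / 2 + μ)) *
          ((selbergMinus (-2.5 / δ) (2.5 / δ) δ t : ℝ) : ℂ) =
      ∫ t : ℝ, (fun w : ℝ => deriv Complex.Gamma (gammaLine μ w) /
        Complex.Gamma (gammaLine μ w) * (minorantKernel w : ℂ)) (δ * t) := by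
    refine integral_congr_ae ?_
    filter_upwards [(Measure.quasiMeasurePreserving_smul volume
      hδ0.ne').ae (ae_ne_int_add (5 / 2))] with t ht
    have ht' : ∀ n : ℤ, δ * t - 5 / 2 ≠ n := ht
    have e1 : gammaLine μ (δ * t) = 1 / 4 + (t : ℂ) * Complex.I / 2 + μ := by
      have hl' : (log 2 : ℂ) ≠ 0 := Complex.ofReal_ne_zero.2 hl.ne'
      have hp' : (π : ℂ) ≠ 0 := Complex.ofReal_ne_zero.2 pi_ne_zero
      rw [gammaLine, hδ]
      push_cast
      field_simp
      ring
    have e2 : δ * (-2.5 / δ - t) = -5 / 2 - δ * t := by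
      field_simp
      norm_num
      ring
    have e3 : δ * (t - 2.5 / δ) = δ * t - 5 / 2 := by
      field_simp
      norm_num
      ring
    simp only [e1]
    rw [selbergMinus, e2, e3, beurlingB_add_beurlingB ht']
  rw [h1, Measure.integral_comp_mul_left (fun w : ℝ => deriv Complex.Gamma (gammaLine μ w) /
      Complex.Gamma (gammaLine μ w) * (minorantKernel w : ℂ)) δ, integral_gammaLine hμ, abs_of_pos (inv_pos.2 hδ0),
    Complex.real_smul, Complex.re_ofReal_mul]
  have h2 := log_pi_lt_of_weight_integral le_rfl
  have h3 := le_re_integral_gammaIntegrand hμ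
  have h4 : ((4 : ℂ) * (-eulerMascheroniConstant + log (4 / 3) +
      ∫ x in (0 : ℝ)..1, gammaIntegrand μ x)).re =
      4 * (-eulerMascheroniConstant + log (4 / 3) +
        (∫ x in (0 : ℝ)..1, gammaIntegrand μ x).re) := by
    have : (4 : ℂ) = ((4 : ℝ) : ℂ) := by norm_num
    rw [this, Complex.re_ofReal_mul]
    simp
  rw [h4, div_mul_eq_mul_div, div_eq_inv_mul]
  refine mul_lt_mul_of_pos_left ?_ (inv_pos.2 hδ0)
  linarith
end
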